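/- For every real ρ > 1, the series ∑_{m=1}^{∞} (1/⌊ρ^m⌋) ∑_{n=1}^{⌊ρ^m⌋} |(1/⌊ρ^m⌋) ∑_{k=1}^{⌊ρ^m⌋} μ(k) μ(k+n)| converges (is finite). -/

import Mathlib

open Finset ArithmeticFunction

lemma sum_range_zmod (q : ℕ) [NeZero q] (g : ZMod q → ℂ) (Y : ℕ) :
    ∑ i ∈ range q, g ((Y + i : ℕ) : ZMod q) = ∑ a, g a := by
  have h1 : ∑ i ∈ range q, g ((Y + i : ℕ) : ZMod q) = ∑ a : ZMod q, g (Y + a) := by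
    refine Finset.sum_bij' (fun i _ => (i : ZMod q)) (fun a _ => a.val) ?_ ?_ ?_ ?_ ?_
    · simp
    · intro a _; simpa using ZMod.val_lt a
    · intro i hi; exact ZMod.val_cast_of_lt (by simpa using hi)
    · simp
    · intro i _; push_cast; rfl
  rw [h1]
  exact Fintype.sum_equiv (Equiv.addLeft (Y : ZMod q)) _ _ (fun _ => rfl)

lemma norm_sum_char_sub_le (q : ℕ) [NeZero q] (χ : DirichletCharacter ℂ q) (Y r : ℕ) :
    ‖∑ i ∈ range r, (χ ((Y + i : ℕ) : ZMod q) - (∑ a, χ a) / q)‖ ≤ 2 * q := by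
  have hq : (0 : ℝ) < q := by exact_mod_cast NeZero.pos q
  have hq' : (q : ℂ) ≠ 0 := by exact_mod_cast NeZero.ne q
  have hκ : ‖(∑ a, χ a) / (q : ℂ)‖ ≤ 1 := by
    rw [norm_div, Complex.norm_natCast, div_le_one hq]
    calc _ ≤ ∑ a : ZMod q, ‖χ a‖ := norm_sum_le _ _
      _ ≤ ∑ a : ZMod q, (1 : ℝ) := Finset.sum_le_sum fun a _ => χ.norm_le_one a
      _ = q := by simp [ZMod.card]
  induction r using Nat.strong_induction_on generalizing Y with
  | _ r ih =>
    rcases lt_or_ge r q with h | h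
    · calc _ ≤ ∑ i ∈ range r, ‖(χ ((Y + i : ℕ) : ZMod q) - (∑ a, χ a) / q)‖ := norm_sum_le _ _
        _ ≤ ∑ i ∈ range r, (2 : ℝ) := Finset.sum_le_sum fun i _ => by
            refine (norm_sub_le _ _).trans ?_
            linarith [χ.norm_le_one ((Y + i : ℕ) : ZMod q)]
        _ ≤ _ := by
            have : (r : ℝ) ≤ q := by exact_mod_cast h.le
            simp; linarith
    · obtain ⟨t, rfl⟩ := Nat.exists_eq_add_of_le h
      rw [Finset.sum_range_add]
      have h0 : ∑ i ∈ range q, (χ ((Y + i : ℕ) : ZMod q) - (∑ a, χ a) / q) = 0 := by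
        rw [Finset.sum_sub_distrib, sum_range_zmod q (fun a => χ a)]
        simp; field_simp; simp
      rw [h0, zero_add]
      have := ih t (by have := NeZero.pos q; omega) (Y + q)
      simpa only [add_assoc] using this

/-- The error in the linear approximation to the partial sums of `f` beyond `Y`. -/
noncomputable def tailError (f : ℕ → ℂ) (Y : ℕ) (κ : ℂ) (u : ℝ) : ℂ :=
  if u ≤ Y then 0 else (∑ k ∈ Icc 1 ⌊u⌋₊, if k ≤ Y then 0 else f k) - κ * (u - Y)

lemma sum_Icc_tail_eq (f : ℕ → ℂ) (Y r : ℕ) :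
    (∑ k ∈ Icc 1 (Y + r), if k ≤ Y then 0 else f k) = ∑ i ∈ range r, f (Y + 1 + i) := by
  induction r with
  | zero =>
    simp only [add_zero, range_zero, sum_empty]
    exact Finset.sum_eq_zero fun k hk => if_pos (mem_Icc.mp hk).2
  | succ r ih =>
    rw [← add_assoc, Finset.sum_Icc_succ_top (by omega), ih, Finset.sum_range_succ,
      if_neg (by omega)]
    congr 2; ring

lemma norm_tailError_le {f : ℕ → ℂ} {Y : ℕ} {κ : ℂ} {B : ℝ}
    (hB : ∀ r, ‖∑ i ∈ range r, (f (Y + 1 + i) - κ)‖ ≤ B) (u : ℝ) :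
    ‖tailError f Y κ u‖ ≤ B + ‖κ‖ := by
  have hB0 : 0 ≤ B := (norm_nonneg _).trans (hB 0)
  unfold tailError
  split_ifs with h
  · simpa using add_nonneg hB0 (norm_nonneg κ)
  · push Not at h
    have hu0 : 0 ≤ u := (Nat.cast_nonneg Y).trans h.le
    obtain ⟨r, hr⟩ := Nat.exists_eq_add_of_le (Nat.le_floor h.le)
    have h1 : (∑ i ∈ range r, f (Y + 1 + i)) - κ * (u - Y) =
        (∑ i ∈ range r, (f (Y + 1 + i) - κ)) - κ * ((u - Y - r : ℝ) : ℂ) := by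
      rw [Finset.sum_sub_distrib]; simp; ring
    rw [hr, sum_Icc_tail_eq, h1]
    refine (norm_sub_le _ _).trans (add_le_add (hB r) ?_)
    rw [norm_mul, Complex.norm_real]
    refine mul_le_of_le_one_right (norm_nonneg _) ?_
    have h2 := Nat.floor_le hu0
    have h3 := Nat.lt_floor_add_one u
    rw [hr] at h2 h3
    push_cast at h2 h3
    rw [Real.norm_eq_abs, abs_le]; constructor <;> linarith

lemma measurable_tailError (f : ℕ → ℂ) (Y : ℕ) (κ : ℂ) : Measurable (tailError f Y κ) := by
  unfold tailError
  refine Measurable.ite measurableSet_Iic measurable_const ?_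
  refine Measurable.sub ?_ (by fun_prop)
  exact (measurable_from_nat (f := fun n => ∑ k ∈ Icc 1 n, if k ≤ Y then 0 else f k)).comp
    Nat.measurable_floor

lemma tailError_isBigO_top {f : ℕ → ℂ} {Y : ℕ} {κ : ℂ} {B : ℝ}
    (hB : ∀ r, ‖∑ i ∈ range r, (f (Y + 1 + i) - κ)‖ ≤ B) :
    (tailError f Y κ) =O[Filter.atTop] fun x : ℝ => x ^ (-(0 : ℝ)) := by
  simp only [neg_zero, Real.rpow_zero]
  exact Asymptotics.IsBigO.of_bound (B + ‖κ‖) (Filter.Eventually.of_forall fun u => by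
    simpa using norm_tailError_le hB u)

lemma tailError_isBigO_zero {f : ℕ → ℂ} {Y : ℕ} (hY : 1 ≤ Y) (κ : ℂ) (b : ℝ) :
    (tailError f Y κ) =O[nhdsWithin 0 (Set.Ioi 0)] fun x : ℝ => x ^ (-b) := by
  refine Asymptotics.IsBigO.of_bound 0 ?_
  have : ∀ᶠ x : ℝ in nhds 0, x ≤ Y :=
    (eventually_lt_nhds (by exact_mod_cast hY : (0 : ℝ) < Y)).mono fun x hx => hx.le
  filter_upwards [nhdsWithin_le_nhds this] with x hx
  simp [tailError, hx]

lemma tailError_locallyIntegrableOn {f : ℕ → ℂ} {Y : ℕ} {κ : ℂ} {B : ℝ}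
    (hB : ∀ r, ‖∑ i ∈ range r, (f (Y + 1 + i) - κ)‖ ≤ B) :
    MeasureTheory.LocallyIntegrableOn (tailError f Y κ) (Set.Ioi 0) := by
  refine MeasureTheory.LocallyIntegrable.locallyIntegrableOn ?_ _
  refine (MeasureTheory.locallyIntegrable_const (B + ‖κ‖ : ℝ)).mono
    (measurable_tailError f Y κ).aestronglyMeasurable (Filter.Eventually.of_forall fun u => ?_)
  refine (norm_tailError_le hB u).trans (Real.le_norm_self _)

lemma mellinConvergent_tailError {f : ℕ → ℂ} {Y : ℕ} (hY : 1 ≤ Y) {κ : ℂ} {B : ℝ}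
    (hB : ∀ r, ‖∑ i ∈ range r, (f (Y + 1 + i) - κ)‖ ≤ B) {s : ℂ} (hs : 0 < s.re) :
    MellinConvergent (tailError f Y κ) (-s) :=
  mellinConvergent_of_isBigO_rpow (a := 0) (b := -s.re - 1) (tailError_locallyIntegrableOn hB)
    (tailError_isBigO_top hB) (by simpa using hs) (tailError_isBigO_zero hY κ _) (by simp)

lemma differentiableAt_mellin_tailError {f : ℕ → ℂ} {Y : ℕ} (hY : 1 ≤ Y) {κ : ℂ} {B : ℝ}
    (hB : ∀ r, ‖∑ i ∈ range r, (f (Y + 1 + i) - κ)‖ ≤ B) {s : ℂ} (hs : 0 < s.re) :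
    DifferentiableAt ℂ (fun s => mellin (tailError f Y κ) (-s)) s :=
  (mellin_differentiableAt_of_isBigO_rpow (a := 0) (b := -s.re - 1)
    (tailError_locallyIntegrableOn hB)
    (tailError_isBigO_top hB) (by simpa using hs) (tailError_isBigO_zero hY κ _) (by simp)).comp s
      differentiableAt_id.neg

lemma norm_mellin_tailError_le {f : ℕ → ℂ} {Y : ℕ} (hY : 1 ≤ Y) {κ : ℂ} {B : ℝ}
    (hB : ∀ r, ‖∑ i ∈ range r, (f (Y + 1 + i) - κ)‖ ≤ B) {s : ℂ} (hs : 0 < s.re) :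
    ‖mellin (tailError f Y κ) (-s)‖ ≤ (B + ‖κ‖) * (Y : ℝ) ^ (-s.re) / s.re := by
  have hY0 : (0 : ℝ) < Y := by exact_mod_cast hY
  have h1 : mellin (tailError f Y κ) (-s) =
      ∫ t in Set.Ioi (Y : ℝ), (t : ℂ) ^ (-s - 1) • tailError f Y κ t := by
    unfold mellin
    refine MeasureTheory.setIntegral_eq_of_subset_of_forall_sdiff_eq_zero measurableSet_Ioi
      (Set.Ioi_subset_Ioi hY0.le) ?_
    intro t ht
    have : t ≤ Y := by simpa using ht.2
    simp [tailError, this]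
  rw [h1]
  have h2 : ∫ t in Set.Ioi (Y : ℝ), (B + ‖κ‖) * t ^ (-s.re - 1) =
      (B + ‖κ‖) * (Y : ℝ) ^ (-s.re) / s.re := by
    rw [MeasureTheory.integral_const_mul, integral_Ioi_rpow_of_lt (by linarith) hY0]
    have : s.re ≠ 0 := hs.ne'
    simp
    field_simp
  rw [← h2]
  refine MeasureTheory.norm_integral_le_of_norm_le ?_ ?_
  · exact (integrableOn_Ioi_rpow_of_lt (by linarith) hY0).const_mul _
  · refine (MeasureTheory.ae_restrict_iff' measurableSet_Ioi).mpr
      (Filter.Eventually.of_forall fun t ht => ?_)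
    have ht0 : 0 < t := hY0.trans ht
    rw [norm_smul, Complex.norm_cpow_eq_rpow_re_of_pos ht0, mul_comm]
    simp only [Complex.sub_re, Complex.neg_re, Complex.one_re]
    exact mul_le_mul_of_nonneg_right (norm_tailError_le hB t) (Real.rpow_nonneg ht0.le _)

lemma integral_linear_tail {Y : ℕ} (hY : 1 ≤ Y) {s : ℂ} (hs : 1 < s.re) :
    MeasureTheory.IntegrableOn (fun t : ℝ => ((t : ℂ) - Y) * (t : ℂ) ^ (-(s + 1)))
        (Set.Ioi (Y : ℝ)) ∧
    s * ∫ t in Set.Ioi (Y : ℝ), ((t : ℂ) - Y) * (t : ℂ) ^ (-(s + 1)) =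
      (Y : ℂ) ^ (1 - s) / (s - 1) := by
  have hY0 : (0 : ℝ) < Y := by exact_mod_cast hY
  have hYc : (Y : ℂ) ≠ 0 := by exact_mod_cast hY0.ne'
  have hs0 : s ≠ 0 := by rintro rfl; simp at hs; linarith
  have hs1 : s - 1 ≠ 0 := by
    intro h; have := congrArg Complex.re h; simp at this; linarith
  have e : Set.EqOn (fun t : ℝ => ((t : ℂ) - Y) * (t : ℂ) ^ (-(s + 1)))
      (fun t : ℝ => (t : ℂ) ^ (-s) - Y * (t : ℂ) ^ (-(s + 1))) (Set.Ioi (Y : ℝ)) := by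
    intro t ht
    have ht0 : (t : ℂ) ≠ 0 := by exact_mod_cast (hY0.trans ht).ne'
    have : (t : ℂ) ^ (-s) = t * (t : ℂ) ^ (-(s + 1)) := by
      rw [show -s = -(s + 1) + 1 by ring, Complex.cpow_add _ _ ht0, Complex.cpow_one]; ring
    simp only [this]; ring
  have i1 := integrableOn_Ioi_cpow_of_lt (a := -s) (by simpa using hs) hY0
  have i2 := (integrableOn_Ioi_cpow_of_lt (a := -(s + 1)) (by simp; linarith) hY0).const_mul (Y : ℂ)
  refine ⟨(MeasureTheory.integrableOn_congr_fun e measurableSet_Ioi).mpr (i1.sub i2), ?_⟩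
  rw [MeasureTheory.setIntegral_congr_fun measurableSet_Ioi e, MeasureTheory.integral_sub i1 i2,
    MeasureTheory.integral_const_mul, integral_Ioi_cpow_of_lt (by simpa using hs) hY0,
    integral_Ioi_cpow_of_lt (by simp; linarith) hY0]
  rw [show -s + 1 = 1 - s by ring, show -(s + 1) + 1 = -s by ring, Complex.ofReal_natCast,
    Complex.cpow_sub _ _ hYc, Complex.cpow_neg, Complex.cpow_one]
  have : (Y : ℂ) ^ s ≠ 0 := by simp [Complex.cpow_eq_zero_iff, hYc]
  have h1s : 1 - s ≠ 0 := by rw [← neg_sub]; exact neg_ne_zero.mpr hs1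
  rw [show (1 - s) = -(s - 1) by ring]
  field_simp
  ring

lemma LSeries_tail_eq {f : ℕ → ℂ} {Y : ℕ} (hY : 1 ≤ Y) {κ : ℂ} {B : ℝ}
    (hB : ∀ r, ‖∑ i ∈ range r, (f (Y + 1 + i) - κ)‖ ≤ B) {s : ℂ} (hs : 1 < s.re)
    (hf : LSeriesSummable f s) :
    LSeries (fun n => if n ≤ Y then 0 else f n) s =
      κ * (Y : ℂ) ^ (1 - s) / (s - 1) + s * mellin (tailError f Y κ) (-s) := by
  have hY0 : (0 : ℝ) < Y := by exact_mod_cast hY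
  have hB0 : 0 ≤ B := (norm_nonneg _).trans (hB 0)
  have hg : LSeriesSummable (fun n => if n ≤ Y then 0 else f n) s := by
    refine Summable.of_norm_bounded hf.norm fun n => ?_
    exact LSeries.norm_term_le s (by split_ifs <;> simp)
  have hS : ∀ u : ℝ, 0 ≤ u → (∑ k ∈ Icc 1 ⌊u⌋₊, if k ≤ Y then 0 else f k) =
      tailError f Y κ u + if u ≤ Y then 0 else κ * (u - Y) := by
    intro u hu
    unfold tailError
    split_ifs with h
    · rw [add_zero]
      refine Finset.sum_eq_zero fun k hk => if_pos ?_
      exact (mem_Icc.mp hk).2.trans (Nat.floor_le_of_le h)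
    · ring
  rw [LSeries_eq_mul_integral _ zero_le_one (by simpa using hs) hg ?_]
  · have i1 : MeasureTheory.IntegrableOn (fun t : ℝ => tailError f Y κ t * (t : ℂ) ^ (-(s + 1)))
        (Set.Ioi 1) := by
      have := mellinConvergent_tailError hY hB (s := s) (by linarith)
      refine (MeasureTheory.IntegrableOn.mono_set this (Set.Ioi_subset_Ioi zero_le_one)).congr_fun
        (fun t _ => ?_) measurableSet_Ioi
      simp only [smul_eq_mul]; rw [mul_comm]; congr 2; ring
    have i2 := (integral_linear_tail hY hs).1
    have i3 : MeasureTheory.IntegrableOn (Set.indicator (Set.Ioi (Y : ℝ))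
        (fun t : ℝ => κ * (((t : ℂ) - Y) * (t : ℂ) ^ (-(s + 1))))) (Set.Ioi 1) := by
      refine MeasureTheory.Integrable.integrableOn ?_
      exact (MeasureTheory.integrable_indicator_iff measurableSet_Ioi).mpr (i2.const_mul κ)
    have e1 : ∫ t in Set.Ioi (1 : ℝ), (∑ k ∈ Icc 1 ⌊t⌋₊, if k ≤ Y then 0 else f k) *
          (t : ℂ) ^ (-(s + 1)) =
        ∫ t in Set.Ioi (1 : ℝ), (tailError f Y κ t * (t : ℂ) ^ (-(s + 1)) +
          Set.indicator (Set.Ioi (Y : ℝ))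
          (fun t : ℝ => κ * (((t : ℂ) - Y) * (t : ℂ) ^ (-(s + 1)))) t) := by
      refine MeasureTheory.setIntegral_congr_fun measurableSet_Ioi fun t ht => ?_
      have ht0 : 0 ≤ t := zero_le_one.trans (le_of_lt ht)
      simp only [hS t ht0, Set.indicator_apply, Set.mem_Ioi]
      by_cases h : t ≤ Y
      · simp [h, not_lt.mpr h]
      · simp [h, not_le.mp h]; ring
    rw [e1, MeasureTheory.integral_add i1 i3, mul_add, add_comm]
    congr 1
    · rw [MeasureTheory.setIntegral_indicator measurableSet_Ioi,
        Set.inter_eq_right.mpr (Set.Ioi_subset_Ioi (by exact_mod_cast hY)),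
        MeasureTheory.integral_const_mul, mul_left_comm, (integral_linear_tail hY hs).2]
      ring
    · congr 1
      unfold mellin
      rw [MeasureTheory.setIntegral_eq_of_subset_of_forall_sdiff_eq_zero (s := Set.Ioi 1)
        measurableSet_Ioi (Set.Ioi_subset_Ioi zero_le_one)]
      · refine MeasureTheory.setIntegral_congr_fun measurableSet_Ioi fun t ht => ?_
        simp only [smul_eq_mul]; rw [mul_comm]; congr 2; ring
      · intro t ht
        have : t ≤ 1 := by simpa using ht.2
        have : t ≤ Y := this.trans (by exact_mod_cast hY)
        simp [tailError, this]
  · refine Asymptotics.IsBigO.of_bound (B + ‖κ‖ + ‖κ‖) ?_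
    filter_upwards [Filter.eventually_ge_atTop 1] with n hn
    have := hS n (Nat.cast_nonneg n)
    rw [Nat.floor_natCast] at this
    have hn' : (1 : ℝ) ≤ n := by exact_mod_cast hn
    rw [this, Real.rpow_one, Real.norm_natCast, add_mul]
    refine (norm_add_le _ _).trans (add_le_add ((norm_tailError_le hB _).trans ?_) ?_)
    · exact le_mul_of_one_le_right (by positivity) hn'
    · split_ifs with h
      · simp; positivity
      · push Not at h
        rw [norm_mul]
        refine mul_le_mul_of_nonneg_left ?_ (norm_nonneg _)
        rw [← Complex.ofReal_natCast Y, ← Complex.ofReal_sub, Complex.norm_real, Real.norm_eq_abs,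
          abs_of_nonneg (by linarith)]
        linarith

lemma LSeries_split {f : ℕ → ℂ} (Y : ℕ) {s : ℂ} (hf : LSeriesSummable f s) :
    LSeries f s = ∑ n ∈ Icc 1 Y, f n * (n : ℂ) ^ (-s) +
      LSeries (fun n => if n ≤ Y then 0 else f n) s := by
  have hg : LSeriesSummable (fun n => if n ≤ Y then 0 else f n) s := by
    refine Summable.of_norm_bounded hf.norm fun n => ?_
    exact LSeries.norm_term_le s (by split_ifs <;> simp)
  rw [← sub_eq_iff_eq_add, ← LSeries_sub hf hg, LSeries, tsum_eq_sum (s := Icc 1 Y)]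
  · refine Finset.sum_congr rfl fun n hn => ?_
    have := mem_Icc.mp hn
    rw [LSeries.term_of_ne_zero (by omega), Complex.cpow_neg]
    simp [this.2, div_eq_mul_inv]
  · intro n hn
    simp only [mem_Icc, not_and, not_le] at hn
    rcases Nat.eq_zero_or_pos n with rfl | h
    · simp
    · have := hn h
      rw [LSeries.term_of_ne_zero (by omega)]
      simp [not_le.mpr this]

lemma isPreconnected_re_pos_sdiff_one :
    IsPreconnected ({s : ℂ | 0 < s.re} \ ({1} : Set ℂ)) := by
  have c1 : Convex ℝ ({s : ℂ | 0 < s.re} ∩ {s | 0 < s.im}) :=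
    (convex_halfSpace_re_gt 0).inter (convex_halfSpace_im_gt 0)
  have c2 : Convex ℝ {s : ℂ | 1 < s.re} := convex_halfSpace_re_gt 1
  have c3 : Convex ℝ ({s : ℂ | 0 < s.re} ∩ {s | s.im < 0}) :=
    (convex_halfSpace_re_gt 0).inter (convex_halfSpace_im_lt 0)
  have c4 : Convex ℝ ({s : ℂ | 0 < s.re} ∩ {s | s.re < 1}) :=
    (convex_halfSpace_re_gt 0).inter (convex_halfSpace_re_lt 1)
  have h12 := c1.isPreconnected.union (⟨2, 1⟩ : ℂ) (by simp) (by simp) c2.isPreconnected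
  have h123 := h12.union (⟨2, -1⟩ : ℂ) (Or.inr (by simp)) (by simp) c3.isPreconnected
  have h := h123.union (⟨1 / 2, 1⟩ : ℂ) (Or.inl (Or.inl (by simp)))
    (by simp; norm_num) c4.isPreconnected
  convert h using 1
  ext z
  simp only [Set.mem_sdiff, Set.mem_ofPred_eq, Set.mem_singleton_iff, Set.mem_union,
    Set.mem_inter_iff,
    Complex.ext_iff, Complex.one_re, Complex.one_im]
  rcases lt_trichotomy z.re 1 with h | h | h <;> rcases lt_trichotomy z.im 0 with h' | h' | h' <;>
    grind

theorem norm_sub_partial_sum_le {f : ℕ → ℂ} {Y : ℕ} (hY : 1 ≤ Y) {κ : ℂ} {B : ℝ}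
    (hB : ∀ r, ‖∑ i ∈ range r, (f (Y + 1 + i) - κ)‖ ≤ B)
    (hf : ∀ s : ℂ, 1 < s.re → LSeriesSummable f s) {F : ℂ → ℂ}
    (hF : ∀ s : ℂ, 1 < s.re → F s = LSeries f s)
    (hFd : ∀ s : ℂ, (s ≠ 1 ∨ κ = 0) → DifferentiableAt ℂ F s) {s : ℂ} (hs : 0 < s.re)
    (hs1 : s ≠ 1 ∨ κ = 0) :
    ‖F s - ∑ n ∈ Icc 1 Y, f n * (n : ℂ) ^ (-s) - κ * (Y : ℂ) ^ (1 - s) / (s - 1)‖ ≤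
      ‖s‖ * ((B + ‖κ‖) * (Y : ℝ) ^ (-s.re) / s.re) := by
  set V : Set ℂ := {s : ℂ | 0 < s.re} ∩ {s | s ≠ 1 ∨ κ = 0} with hV
  have hopen0 : IsOpen {s : ℂ | 0 < s.re} := isOpen_lt continuous_const Complex.continuous_re
  have hVo : IsOpen V := by
    refine hopen0.inter ?_
    by_cases h : κ = 0
    · simp [h]
    · simpa [h] using isOpen_ne
  have hVc : IsPreconnected V := by
    have hconv : Convex ℝ {s : ℂ | 0 < s.re} := convex_halfSpace_re_gt 0
    by_cases h : κ = 0
    · simpa [hV, h] using hconv.isPreconnected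
    · have : V = {s : ℂ | 0 < s.re} \ ({1} : Set ℂ) := by
        ext z; simp [hV, h]
      rw [this]
      exact isPreconnected_re_pos_sdiff_one
  have hFV : ∀ z ∈ V, DifferentiableAt ℂ F z := fun z hz => hFd z hz.2
  set G : ℂ → ℂ := fun s => ∑ n ∈ Icc 1 Y, f n * (n : ℂ) ^ (-s) +
    (κ * (Y : ℂ) ^ (1 - s) / (s - 1) + s * mellin (tailError f Y κ) (-s)) with hG
  have hYc : (Y : ℂ) ≠ 0 := by exact_mod_cast (by omega : Y ≠ 0)
  have hGV : ∀ z ∈ V, DifferentiableAt ℂ G z := by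
    intro z hz
    refine DifferentiableAt.add ?_ (DifferentiableAt.add ?_ ?_)
    · refine DifferentiableAt.fun_sum fun n hn => ?_
      have : (n : ℂ) ≠ 0 := by have := mem_Icc.mp hn; exact_mod_cast (by omega : n ≠ 0)
      exact (differentiableAt_id.neg.const_cpow (Or.inl this)).const_mul _
    · rcases hz.2 with h | h
      · refine DifferentiableAt.div ?_ (by fun_prop) (sub_ne_zero.mpr h)
        exact ((differentiableAt_id.const_sub 1).const_cpow (Or.inl hYc)).const_mul _
      · simp [h]
    · exact differentiableAt_id.mul (differentiableAt_mellin_tailError hY hB hz.1)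
  have hEq : Set.EqOn F G V := by
    have hFa : AnalyticOnNhd ℂ F V :=
      DifferentiableOn.analyticOnNhd (fun z hz => (hFV z hz).differentiableWithinAt) hVo
    have hGa : AnalyticOnNhd ℂ G V :=
      DifferentiableOn.analyticOnNhd (fun z hz => (hGV z hz).differentiableWithinAt) hVo
    refine hFa.eqOn_of_preconnected_of_eventuallyEq hGa hVc (z₀ := 2) ⟨by simp, Or.inl (by simp)⟩ ?_
    have : ∀ᶠ z : ℂ in nhds 2, 1 < z.re :=
      (isOpen_lt continuous_const Complex.continuous_re).mem_nhds (by simp)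
    filter_upwards [this] with z hz
    rw [hF z hz, LSeries_split Y (hf z hz), LSeries_tail_eq hY hB hz (hf z hz)]
  rw [hEq ⟨hs, hs1⟩, hG]
  simp only
  rw [add_sub_cancel_left, add_sub_cancel_left, norm_mul]
  exact mul_le_mul_of_nonneg_left (norm_mellin_tailError_le hY hB hs) (norm_nonneg _)

/-- The analytic conductor `q (|t| + 2)`. -/
noncomputable def aCond (q : ℕ) (s : ℂ) : ℝ := q * (|s.im| + 2)

lemma two_le_aCond (q : ℕ) [NeZero q] (s : ℂ) : 2 ≤ aCond q s := by
  have hq : (1 : ℝ) ≤ q := by exact_mod_cast NeZero.one_le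
  unfold aCond
  nlinarith [abs_nonneg s.im]

/-- The mean value of a Dirichlet character. -/
noncomputable def charMean {q : ℕ} [NeZero q] (χ : DirichletCharacter ℂ q) : ℂ := (∑ a, χ a) / q

lemma norm_charMean_le {q : ℕ} [NeZero q] (χ : DirichletCharacter ℂ q) : ‖charMean χ‖ ≤ 1 := by
  have hq : (0 : ℝ) < q := by exact_mod_cast NeZero.pos q
  rw [charMean, norm_div, Complex.norm_natCast, div_le_one hq]
  calc _ ≤ ∑ a : ZMod q, ‖χ a‖ := norm_sum_le _ _
    _ ≤ ∑ a : ZMod q, (1 : ℝ) := Finset.sum_le_sum fun a _ => χ.norm_le_one a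
    _ = q := by simp [ZMod.card]

lemma charMean_eq_zero_iff {q : ℕ} [NeZero q] (χ : DirichletCharacter ℂ q) :
    charMean χ = 0 ↔ χ ≠ 1 := by
  have hq : (q : ℂ) ≠ 0 := by exact_mod_cast NeZero.ne q
  constructor
  · rintro h rfl
    rw [charMean, MulChar.sum_one_eq_card_units, div_eq_zero_iff] at h
    simp [NeZero.ne q] at h
  · intro h
    simp [charMean, MulChar.sum_eq_zero_of_ne_one h]

lemma norm_LFunction_sub_partial_sum_le {q : ℕ} [NeZero q] (χ : DirichletCharacter ℂ q) {Y : ℕ}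
    (hY : 1 ≤ Y) {s : ℂ} (hs : 0 < s.re) (hs1 : s ≠ 1 ∨ χ ≠ 1) :
    ‖χ.LFunction s - ∑ n ∈ Icc 1 Y, χ n * (n : ℂ) ^ (-s) -
      charMean χ * (Y : ℂ) ^ (1 - s) / (s - 1)‖ ≤
      ‖s‖ * ((2 * q + ‖charMean χ‖) * (Y : ℝ) ^ (-s.re) / s.re) := by
  refine norm_sub_partial_sum_le hY (f := fun n => χ n) (F := χ.LFunction) ?_ ?_ ?_ ?_ hs ?_
  · intro r; simpa [charMean] using norm_sum_char_sub_le q χ (Y + 1) r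
  · intro s hs; exact DirichletCharacter.LSeriesSummable_of_one_lt_re χ hs
  · intro s hs; exact DirichletCharacter.LFunction_eq_LSeries χ hs
  · intro s hs; exact DirichletCharacter.differentiableAt_LFunction χ s
      (by rwa [charMean_eq_zero_iff] at hs)
  · rwa [charMean_eq_zero_iff]

lemma norm_LFunction_le_crude {q : ℕ} [NeZero q] {χ : DirichletCharacter ℂ q} (hχ : χ ≠ 1)
    {s : ℂ} (hs : 1 / 2 ≤ s.re) : ‖χ.LFunction s‖ ≤ 1 + 4 * q * ‖s‖ := by
  have h := norm_LFunction_sub_partial_sum_le χ le_rfl (s := s) (by linarith) (Or.inr hχ)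
  rw [(charMean_eq_zero_iff χ).mpr hχ] at h
  simp only [Icc_self, sum_singleton, Nat.cast_one, map_one, Complex.one_cpow, mul_one,
    zero_div, sub_zero, norm_zero, add_zero, Real.one_rpow] at h
  have h2 : ‖χ.LFunction s‖ ≤ ‖χ.LFunction s - 1‖ + 1 := by
    simpa using norm_add_le (χ.LFunction s - 1) 1
  have h3 : 2 * (q : ℝ) / s.re ≤ 4 * q := by
    rw [div_le_iff₀ (by linarith)]
    nlinarith [(Nat.cast_nonneg q : (0 : ℝ) ≤ q)]
  nlinarith [norm_nonneg s]

theorem norm_LFunction_le {δ : ℝ} (hδ : 0 < δ) (hδ4 : δ ≤ 1 / 4) :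
    ∃ C : ℝ, 0 < C ∧ ∀ (q : ℕ) [NeZero q] (χ : DirichletCharacter ℂ q) (s : ℂ),
      1 - δ ≤ s.re → s.re ≤ 3 → (χ ≠ 1 ∨ 1 / 4 ≤ |s.im|) →
      ‖χ.LFunction s‖ ≤ C * aCond q s ^ (2 * δ) := by
  set K : ℝ := ∑' n : ℕ, 1 / (n : ℝ) ^ (1 + δ) with hK
  have hKs : Summable fun n : ℕ => 1 / (n : ℝ) ^ (1 + δ) :=
    Real.summable_one_div_nat_rpow.mpr (by linarith)
  have hK0 : 0 ≤ K := tsum_nonneg fun n => by positivity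
  refine ⟨(K + 16) * 2, by positivity, fun q _ χ s h1 h3 hχ => ?_⟩
  have hτ := two_le_aCond q s
  set τ := aCond q s with hτd
  have hq : (1 : ℝ) ≤ q := by exact_mod_cast NeZero.one_le
  set Y := ⌈τ⌉₊ with hYd
  have hYτ : τ ≤ Y := Nat.le_ceil τ
  have hY2 : (Y : ℝ) ≤ 2 * τ := by
    have := Nat.ceil_lt_add_one (show 0 ≤ τ by linarith); linarith
  have hY1 : 1 ≤ Y := by
    have : (1 : ℝ) ≤ Y := by linarith
    exact_mod_cast this
  have hYr : (1 : ℝ) ≤ Y := by exact_mod_cast hY1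
  have hs0 : 0 < s.re := by linarith
  have hs1 : s ≠ 1 ∨ χ ≠ 1 := by
    rcases hχ with h | h
    · exact Or.inr h
    · left; rintro rfl; norm_num at h
  have key := norm_LFunction_sub_partial_sum_le χ hY1 hs0 hs1
  have hYp : (Y : ℝ) ^ (1 - s.re) ≤ (Y : ℝ) ^ (2 * δ) :=
    Real.rpow_le_rpow_of_exponent_le hYr (by linarith)
  have b1 : ‖∑ n ∈ Icc 1 Y, χ n * (n : ℂ) ^ (-s)‖ ≤ K * (Y : ℝ) ^ (2 * δ) := by
    calc _ ≤ ∑ n ∈ Icc 1 Y, (1 / (n : ℝ) ^ (1 + δ)) * (Y : ℝ) ^ (2 * δ) := by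
          refine norm_sum_le_of_le _ fun n hn => ?_
          have hn := mem_Icc.mp hn
          have hn1 : (1 : ℝ) ≤ n := by exact_mod_cast hn.1
          have hn0 : (0 : ℝ) < n := by linarith
          rw [norm_mul, Complex.norm_natCast_cpow_of_pos (by omega)]
          calc _ ≤ 1 * (n : ℝ) ^ (-(1 + δ) + 2 * δ) := by
                refine mul_le_mul (χ.norm_le_one _) ?_ (by positivity) zero_le_one
                exact Real.rpow_le_rpow_of_exponent_le hn1 (by simp; linarith)
            _ = 1 / (n : ℝ) ^ (1 + δ) * (n : ℝ) ^ (2 * δ) := by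
                rw [one_mul, Real.rpow_add hn0, Real.rpow_neg hn0.le, one_div]
            _ ≤ _ := by
                refine mul_le_mul_of_nonneg_left ?_ (by positivity)
                exact Real.rpow_le_rpow hn0.le (by exact_mod_cast hn.2) (by linarith)
      _ ≤ _ := by
          rw [← Finset.sum_mul]
          exact mul_le_mul_of_nonneg_right (hKs.sum_le_tsum _ fun n _ => by positivity)
            (by positivity)
  have b2 : ‖charMean χ * (Y : ℂ) ^ (1 - s) / (s - 1)‖ ≤ 4 * (Y : ℝ) ^ (2 * δ) := by
    rcases hχ with h | h
    · rw [(charMean_eq_zero_iff χ).mpr h]; simp; positivity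
    · have hi : 1 / 4 ≤ ‖s - 1‖ := by
        refine h.trans ?_
        simpa using Complex.abs_im_le_norm (s - 1)
      rw [norm_div, norm_mul, Complex.norm_natCast_cpow_of_pos (by omega), div_le_iff₀
        (by linarith)]
      have : ‖charMean χ‖ * (Y : ℝ) ^ (1 - s).re ≤ 1 * (Y : ℝ) ^ (2 * δ) :=
        mul_le_mul (norm_charMean_le χ) (by simpa using hYp) (by positivity) zero_le_one
      have h0 : 0 ≤ (Y : ℝ) ^ (2 * δ) := by positivity
      nlinarith
  have b3 : ‖s‖ * ((2 * q + ‖charMean χ‖) * (Y : ℝ) ^ (-s.re) / s.re) ≤ 12 * (Y : ℝ) ^ (2 * δ) := by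
    have hs' : ‖s‖ ≤ 2 * (|s.im| + 2) := by
      have := Complex.norm_le_abs_re_add_abs_im s
      rw [abs_of_pos hs0] at this
      linarith [abs_nonneg s.im]
    have h2 : ‖s‖ * (2 * q + ‖charMean χ‖) ≤ 6 * Y := by
      calc _ ≤ (2 * (|s.im| + 2)) * (3 * q) := by
            refine mul_le_mul hs' ?_ (by positivity) (by positivity)
            linarith [norm_charMean_le χ]
        _ = 6 * τ := by rw [hτd, aCond]; ring
        _ ≤ _ := by linarith
    have h3' : (Y : ℝ) * (Y : ℝ) ^ (-s.re) = (Y : ℝ) ^ (1 - s.re) := by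
      rw [sub_eq_add_neg, Real.rpow_add (by linarith), Real.rpow_one]
    have h4 : 1 / s.re ≤ 2 := by rw [div_le_iff₀ hs0]; linarith
    calc _ = (‖s‖ * (2 * q + ‖charMean χ‖)) * (Y : ℝ) ^ (-s.re) * (1 / s.re) := by ring
      _ ≤ (6 * Y) * (Y : ℝ) ^ (-s.re) * 2 := by gcongr
      _ = 12 * (Y : ℝ) ^ (1 - s.re) := by rw [← h3']; ring
      _ ≤ _ := by linarith
  have hfin : (Y : ℝ) ^ (2 * δ) ≤ 2 * τ ^ (2 * δ) := by
    calc _ ≤ (2 * τ) ^ (2 * δ) := Real.rpow_le_rpow (by linarith) hY2 (by linarith)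
      _ = 2 ^ (2 * δ) * τ ^ (2 * δ) := Real.mul_rpow (by norm_num) (by linarith)
      _ ≤ 2 * τ ^ (2 * δ) := by
          refine mul_le_mul_of_nonneg_right ?_ (by positivity)
          calc (2 : ℝ) ^ (2 * δ) ≤ 2 ^ (1 : ℝ) :=
                Real.rpow_le_rpow_of_exponent_le (by norm_num) (by linarith)
            _ = 2 := Real.rpow_one 2
  set A := ∑ n ∈ Icc 1 Y, χ n * (n : ℂ) ^ (-s)
  set D := charMean χ * (Y : ℂ) ^ (1 - s) / (s - 1)
  calc ‖χ.LFunction s‖ = ‖(χ.LFunction s - A - D) + A + D‖ := by congr 1; ring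
    _ ≤ ‖χ.LFunction s - A - D‖ + ‖A‖ + ‖D‖ := norm_add₃_le
    _ ≤ (K + 16) * (Y : ℝ) ^ (2 * δ) := by linarith
    _ ≤ (K + 16) * (2 * τ ^ (2 * δ)) := mul_le_mul_of_nonneg_left hfin (by positivity)
    _ = _ := by ring

theorem norm_iteratedDeriv_LFunction_le (j : ℕ) {ε : ℝ} (hε : 0 < ε) :
    ∃ C : ℝ, 0 < C ∧ ∀ (q : ℕ) [NeZero q] (χ : DirichletCharacter ℂ q) (s : ℂ),
      1 ≤ s.re → s.re ≤ 2 → (χ ≠ 1 ∨ 1 / 2 ≤ |s.im|) →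
      ‖iteratedDeriv j χ.LFunction s‖ ≤ C * aCond q s ^ ε := by
  set δ := min (ε / 2) (1 / 4) with hδd
  have hδ : 0 < δ := by positivity
  have hδ4 : δ ≤ 1 / 4 := min_le_right _ _
  have hδε : 2 * δ ≤ ε := by have := min_le_left (ε / 2) (1 / 4 : ℝ); linarith
  obtain ⟨C, hC, hb⟩ := norm_LFunction_le hδ hδ4
  refine ⟨j.factorial * (C * 2) / δ ^ j, by positivity, fun q _ χ s h1 h2 hχ => ?_⟩
  have hτ := two_le_aCond q s
  have hball : ∀ z ∈ Metric.closedBall s δ, 1 - δ ≤ z.re ∧ z.re ≤ 3 ∧ (χ ≠ 1 ∨ 1 / 4 ≤ |z.im|) ∧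
      aCond q z ≤ 2 * aCond q s := by
    intro z hz
    rw [Metric.mem_closedBall, dist_eq_norm] at hz
    have hre := abs_le.mp ((Complex.abs_re_le_norm (z - s)).trans hz)
    have him := (Complex.abs_im_le_norm (z - s)).trans hz
    simp only [Complex.sub_re, Complex.sub_im] at hre him
    refine ⟨by linarith, by linarith, ?_, ?_⟩
    · refine hχ.imp_right fun h => ?_
      have := abs_sub_abs_le_abs_sub s.im z.im
      rw [abs_sub_comm] at this
      linarith
    · have := abs_sub_abs_le_abs_sub z.im s.im
      unfold aCond
      have hq : (0 : ℝ) ≤ q := Nat.cast_nonneg q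
      rw [mul_left_comm]
      refine mul_le_mul_of_nonneg_left ?_ hq
      linarith [abs_nonneg s.im]
  have hd : DiffContOnCl ℂ χ.LFunction (Metric.ball s δ) := by
    refine DifferentiableOn.diffContOnCl fun z hz => ?_
    rw [closure_ball s hδ.ne'] at hz
    refine (DirichletCharacter.differentiableAt_LFunction χ z ?_).differentiableWithinAt
    rcases (hball z hz).2.2.1 with h | h
    · exact Or.inr h
    · left; rintro rfl; norm_num at h
  have := Complex.norm_iteratedDeriv_le_of_forall_mem_sphere_norm_le j hδ hd
    (C := C * 2 * aCond q s ^ ε) ?_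
  · refine this.trans (le_of_eq ?_); ring
  · intro z hz
    obtain ⟨g1, g2, g3, g4⟩ := hball z (Metric.sphere_subset_closedBall hz)
    refine (hb q χ z g1 g2 g3).trans ?_
    rw [mul_assoc]
    refine mul_le_mul_of_nonneg_left ?_ hC.le
    calc aCond q z ^ (2 * δ) ≤ (2 * aCond q s) ^ (2 * δ) :=
          Real.rpow_le_rpow (by linarith [two_le_aCond q z]) g4 (by positivity)
      _ = 2 ^ (2 * δ) * aCond q s ^ (2 * δ) := Real.mul_rpow (by norm_num) (by linarith)
      _ ≤ 2 ^ (1 : ℝ) * aCond q s ^ ε := by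
          gcongr
          · norm_num
          · linarith
          · linarith
      _ = _ := by rw [Real.rpow_one]

open scoped ComplexOrder in
/-- Estermann's inequality. -/
lemma le_norm_residue_of_nonneg_coeff {G : ℂ → ℂ} (hG : Differentiable ℂ G) {a : ℕ → ℂ}
    (ha : 0 ≤ a) (ha1 : a 1 = 1) (hab : LSeries.abscissaOfAbsConv a < (2 : ℝ))
    (hGa : ∀ s : ℂ, 1 < s.re → G s = (s - 1) * LSeries a s)
    {B : ℝ} (hB1 : 1 ≤ B) (hB : ∀ z ∈ Metric.sphere (2 : ℂ) (4 / 3), ‖G z‖ ≤ B)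
    (hB' : ‖G 1‖ ≤ B) {η : ℝ} (hη : 0 < η) (hη4 : η ≤ 1 / 4)
    (hσ : 0 ≤ (G ((1 - η : ℝ) : ℂ)).re) :
    η / 4 * (192 * B) ^ (-(16 * η)) ≤ ‖G 1‖ := by
  set D := dslope G 1 with hD
  have hDd : Differentiable ℂ D := by
    rw [← differentiableOn_univ]
    exact (Complex.differentiableOn_dslope (by simp)).2 hG.differentiableOn
  have hDs : ∀ z, z ≠ 1 → D z = (G z - G 1) / (z - 1) := by
    intro z hz
    rw [hD, dslope_of_ne _ hz, slope_def_field]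
  have hDB : ∀ z ∈ Metric.sphere (2 : ℂ) (4 / 3), ‖D z‖ ≤ 6 * B := by
    intro z hz
    have h1 : 1 / 3 ≤ ‖z - 1‖ := by
      have h2 : ‖z - 2‖ = 4 / 3 := by simpa [dist_eq_norm] using hz
      have h3 : ‖z - 2‖ ≤ ‖z - 1‖ + 1 := by
        have := norm_sub_le (z - 1) 1
        rwa [norm_one, sub_sub, one_add_one_eq_two] at this
      linarith
    have hz1 : z ≠ 1 := by
      rintro rfl
      norm_num at h1
    rw [hDs z hz1, norm_div, div_le_iff₀ (by linarith)]
    have := norm_sub_le (G z) (G 1)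
    nlinarith [hB z hz]
  set F := LSeries a with hF
  set b : ℕ → ℂ := fun n =>
      (n.factorial : ℂ)⁻¹ * ((-1) ^ n * iteratedDeriv n F ((2 : ℝ) : ℂ)) with hb
  have hb0 : ∀ n, 0 ≤ (b n).re := fun n => by
    have h1 := LSeries.iteratedDeriv_alternating ha hab n
    have h2 : (0 : ℂ) ≤ (n.factorial : ℂ)⁻¹ := by
      rw [← Complex.ofReal_natCast, ← Complex.ofReal_inv, Complex.zero_le_real]
      positivity
    exact (Complex.le_def.1 (mul_nonneg h2 h1)).1
  have hb1 : 1 ≤ (b 0).re := by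
    have hsum : LSeriesSummable a ((2 : ℝ) : ℂ) :=
      LSeriesSummable_of_abscissaOfAbsConv_lt_re (by simpa using hab)
    have h1 : LSeries.term a ((2 : ℝ) : ℂ) 1 ≤ F ((2 : ℝ) : ℂ) :=
      hsum.le_tsum 1 fun n _ => LSeries.term_nonneg (ha n) 2
    have h2 := (Complex.le_def.1 h1).1
    simpa [hb, LSeries.term, ha1] using h2
  have hiter : ∀ n, iteratedDeriv n D 2 =
      iteratedDeriv n F ((2 : ℝ) : ℂ) - G 1 * ((-1) ^ n * n.factorial) := by
    intro n
    have hev : D =ᶠ[nhds 2] fun s => F s - G 1 * (s - 1)⁻¹ := by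
      have : {s : ℂ | 1 < s.re} ∈ nhds (2 : ℂ) :=
        (isOpen_lt continuous_const Complex.continuous_re).mem_nhds (by simp)
      filter_upwards [this] with s hs
      have hs1 : s ≠ 1 := by
        rintro rfl
        simp at hs
      have : s - 1 ≠ 0 := sub_ne_zero.2 hs1
      rw [hDs s hs1, hGa s hs]
      field_simp
    rw [hev.iteratedDeriv_eq n]
    have hFan : AnalyticAt ℂ F (2 : ℂ) :=
      LSeries_analyticOnNhd a 2 (by simpa using hab)
    have hinv : AnalyticAt ℂ (fun s : ℂ => (s - 1)⁻¹) 2 :=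
      (analyticAt_id.sub analyticAt_const).inv (by norm_num)
    rw [iteratedDeriv_fun_sub hFan.contDiffAt (contDiffAt_const.mul hinv.contDiffAt),
      iteratedDeriv_const_mul_field]
    have := iteratedDeriv_comp_sub_const n (fun s : ℂ => s⁻¹) 1
    rw [this]
    have h3 := congrFun (iter_deriv_inv' (𝕜 := ℂ) n) (2 - 1)
    simp only [Complex.ofReal_ofNat]
    rw [show (fun s : ℂ => s⁻¹) = Inv.inv from rfl, iteratedDeriv_eq_iterate (f := Inv.inv), h3]
    norm_num
  have hcoef : ∀ n, ‖b n - G 1‖ ≤ 6 * B * (3 / 4) ^ n := by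
    intro n
    have h1 := Complex.norm_iteratedDeriv_le_of_forall_mem_sphere_norm_le n (c := (2 : ℂ))
        (R := 4 / 3)
      (by norm_num) hDd.diffContOnCl hDB
    have h2 : b n - G 1 = (n.factorial : ℂ)⁻¹ * ((-1) ^ n * iteratedDeriv n D 2) := by
      have h3 : ((-1 : ℂ) ^ n) * (-1) ^ n = 1 := by
        rw [← mul_pow]
        simp
      have h4 : (n.factorial : ℂ) ≠ 0 := by exact_mod_cast n.factorial_ne_zero
      rw [hiter, hb]
      simp only
      field_simp
      linear_combination G 1 * (n.factorial : ℂ) * h3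
    rw [h2, norm_mul, norm_mul, norm_inv, norm_pow, norm_neg, norm_one, one_pow, one_mul,
      Complex.norm_natCast]
    have h5 : (0 : ℝ) < n.factorial := by exact_mod_cast n.factorial_pos
    rw [inv_mul_le_iff₀ h5]
    refine h1.trans (le_of_eq ?_)
    rw [div_pow, div_pow]
    field_simp
  have hsum := Complex.hasSum_taylorSeries_of_entire hDd (2 : ℂ) ((1 - η : ℝ) : ℂ)
  have hterm : ∀ n : ℕ, ((n.factorial : ℂ)⁻¹ • (((1 - η : ℝ) : ℂ) - 2) ^ n • iteratedDeriv n D 2) =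
      (((1 + η) ^ n : ℝ) : ℂ) * (b n - G 1) := by
    intro n
    have h4 : (n.factorial : ℂ) ≠ 0 := by exact_mod_cast n.factorial_ne_zero
    have h3 : ((-1 : ℂ) ^ n) * (-1) ^ n = 1 := by
      rw [← mul_pow]
      simp
    have h5 : (((1 - η : ℝ) : ℂ) - 2) ^ n = (-1) ^ n * (((1 + η) ^ n : ℝ) : ℂ) := by
      push_cast
      rw [← mul_pow]
      congr 1
      ring
    rw [h5, hiter, hb]
    simp only [smul_eq_mul]
    have h6 := inv_mul_cancel₀ h4
    linear_combination (-(((1 + η) ^ n : ℝ) : ℂ)) * G 1 * ((n.factorial : ℂ)⁻¹ * n.factorial) * h3 -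
      (((1 + η) ^ n : ℝ) : ℂ) * G 1 * h6
  simp only [hterm] at hsum
  have hre := Complex.hasSum_re hsum
  have hre' : ∀ n, ((((1 + η) ^ n : ℝ) : ℂ) * (b n - G 1)).re =
      (1 + η) ^ n * ((b n).re - (G 1).re) := by
    intro n
    rw [Complex.re_ofReal_mul, Complex.sub_re]
  simp only [hre'] at hre
  have hDσ : (D ((1 - η : ℝ) : ℂ)).re ≤ (G 1).re / η := by
    have hne : ((1 - η : ℝ) : ℂ) ≠ 1 := by
      intro h
      have := congrArg Complex.re h
      simp at this
      linarith
    rw [hDs _ hne]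
    have : (((1 - η : ℝ) : ℂ) - 1) = ((-η : ℝ) : ℂ) := by push_cast; ring
    rw [this, Complex.div_ofReal_re, Complex.sub_re, div_neg, ← neg_div]
    gcongr
    linarith
  set lam := (G 1).re with hlam
  set M : ℕ := ⌈16 * Real.log (192 * B)⌉₊ with hM
  have hlogpos : 0 < Real.log (192 * B) := Real.log_pos (by linarith)
  have hM1 : 16 * Real.log (192 * B) ≤ M := Nat.le_ceil _
  have hM2 : (M : ℝ) ≤ 16 * Real.log (192 * B) + 1 := (Nat.ceil_lt_add_one (by positivity)).le
  have hMpos : 0 < M := Nat.ceil_pos.2 (by positivity)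
  have hpowM : ((15 : ℝ) / 16) ^ M ≤ 1 / (192 * B) := by
    have h1 : (15 : ℝ) / 16 ≤ Real.exp (-(1 / 16)) := by
      have := Real.add_one_le_exp (-(1 / 16) : ℝ)
      linarith
    calc ((15 : ℝ) / 16) ^ M ≤ Real.exp (-(1 / 16)) ^ M := by gcongr
      _ = Real.exp (-(M / 16)) := by
          rw [← Real.exp_nat_mul]
          ring_nf
      _ ≤ Real.exp (-Real.log (192 * B)) := by
          gcongr
          linarith
      _ = 1 / (192 * B) := by rw [Real.exp_neg, Real.exp_log (by linarith), one_div]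
  have hsplit := hre.summable.sum_add_tsum_nat_add M
  rw [hre.tsum_eq] at hsplit
  have hgeo : HasSum (fun n : ℕ => 6 * B * (15 / 16 : ℝ) ^ (n + M))
      (6 * B * (16 * (15 / 16) ^ M)) := by
    have h := (hasSum_geometric_of_lt_one (r := (15 / 16 : ℝ)) (by norm_num)
        (by norm_num)).mul_right
      ((15 / 16 : ℝ) ^ M)
    have h' := h.mul_left (6 * B)
    rw [show (1 - (15 / 16) : ℝ)⁻¹ = 16 by norm_num] at h'
    simpa only [← pow_add] using h'
  have htail : |∑' n, (1 + η) ^ (n + M) * ((b (n + M)).re - lam)| ≤ 1 / 2 := by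
    have h1 : ‖∑' n, (1 + η) ^ (n + M) * ((b (n + M)).re - lam)‖ ≤
        6 * B * (16 * (15 / 16) ^ M) := by
      refine tsum_of_norm_bounded hgeo fun n => ?_
      rw [norm_mul, norm_pow, Real.norm_of_nonneg (by linarith), Real.norm_eq_abs, hlam,
        ← Complex.sub_re]
      calc (1 + η) ^ (n + M) * |(b (n + M) - G 1).re|
          ≤ (5 / 4) ^ (n + M) * (6 * B * (3 / 4) ^ (n + M)) := by
            gcongr
            · linarith
            · exact (Complex.abs_re_le_norm _).trans (hcoef _)
        _ = 6 * B * (15 / 16 : ℝ) ^ (n + M) := by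
            rw [mul_left_comm, ← mul_pow]
            norm_num
    rw [← Real.norm_eq_abs]
    refine h1.trans ?_
    calc 6 * B * (16 * (15 / 16) ^ M) ≤ 6 * B * (16 * (1 / (192 * B))) := by gcongr
      _ = 1 / 2 := by
          field_simp
          norm_num
  have hhead : 1 - lam * (((1 + η) ^ M - 1) / η) ≤
      ∑ n ∈ range M, (1 + η) ^ n * ((b n).re - lam) := by
    have h1 : ∑ n ∈ range M, (1 + η) ^ n * ((b n).re - lam) =
        ∑ n ∈ range M, (1 + η) ^ n * (b n).re - lam * (((1 + η) ^ M - 1) / η) := by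
      have := geom_sum_eq (x := 1 + η) (by linarith) M
      rw [add_sub_cancel_left] at this
      rw [← this, mul_sum, ← sum_sub_distrib]
      refine sum_congr rfl fun n _ => by ring
    rw [h1]
    have h2 : (1 + η) ^ 0 * (b 0).re ≤ ∑ n ∈ range M, (1 + η) ^ n * (b n).re :=
      single_le_sum (f := fun n => (1 + η) ^ n * (b n).re)
        (fun n _ => mul_nonneg (by positivity) (hb0 n)) (mem_range.2 hMpos)
    rw [pow_zero, one_mul] at h2
    linarith
  have hkey : 1 / 2 ≤ lam * (1 + η) ^ M / η := by
    have h1 := (abs_le.1 htail).1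
    have h2 : lam * (((1 + η) ^ M - 1) / η) = lam * (1 + η) ^ M / η - lam / η := by ring
    linarith
  have hpow : (1 + η) ^ M ≤ 2 * (192 * B) ^ (16 * η) := by
    calc (1 + η) ^ M ≤ Real.exp η ^ M := by
          gcongr
          linarith [Real.add_one_le_exp η]
      _ = Real.exp (M * η) := by rw [Real.exp_nat_mul]
      _ ≤ Real.exp (Real.log 2 + Real.log (192 * B) * (16 * η)) := by
          gcongr
          have := Real.log_two_gt_d9
          nlinarith
      _ = 2 * (192 * B) ^ (16 * η) := by
          rw [Real.exp_add, Real.exp_log (by norm_num), Real.rpow_def_of_pos (by linarith)]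
  rw [Real.rpow_neg (by linarith)]
  have hX : 0 < (192 * B) ^ (16 * η) := Real.rpow_pos_of_pos (by linarith) _
  rw [← div_eq_mul_inv, div_le_iff₀ hX]
  rw [le_div_iff₀ hη] at hkey
  have hlampos : 0 < lam := by
    by_contra h
    have : lam * (1 + η) ^ M ≤ 0 := mul_nonpos_of_nonpos_of_nonneg (not_lt.1 h) (by positivity)
    linarith
  have h1 : lam ≤ ‖G 1‖ := Complex.re_le_norm _
  nlinarith [mul_le_mul_of_nonneg_left hpow hlampos.le]

/-- A Dirichlet character as an arithmetic function. -/
noncomputable def charFun {q : ℕ} (χ : DirichletCharacter ℂ q) : ArithmeticFunction ℂ :=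
  toArithmeticFunction (χ ·)

lemma charFun_apply {q : ℕ} (χ : DirichletCharacter ℂ q) {n : ℕ} (hn : n ≠ 0) :
    charFun χ n = χ n := by
  simp [charFun, toArithmeticFunction, hn]

lemma charFun_one {q : ℕ} (χ : DirichletCharacter ℂ q) : charFun χ 1 = 1 := by
  simp [charFun_apply]

/-- The von Mangoldt function twisted by a Dirichlet character. -/
noncomputable def charLambda {q : ℕ} (χ : DirichletCharacter ℂ q) : ArithmeticFunction ℂ :=
  toArithmeticFunction (fun n => χ n * (vonMangoldt n : ℂ))

lemma charLambda_apply {q : ℕ} (χ : DirichletCharacter ℂ q) {n : ℕ} (hn : n ≠ 0) :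
    charLambda χ n = χ n * (vonMangoldt n : ℂ) := by
  simp [charLambda, toArithmeticFunction, hn]

lemma charFun_mul_log {q : ℕ} (χ : DirichletCharacter ℂ q) (n : ℕ) :
    charFun χ n * (Real.log n : ℂ) = (charLambda χ * charFun χ) n := by
  rcases eq_or_ne n 0 with rfl | hn
  · simp
  rw [charFun_apply χ hn, mul_apply]
  have h1 : ∀ x ∈ n.divisorsAntidiagonal, charLambda χ x.1 * charFun χ x.2 =
      χ n * (vonMangoldt x.1 : ℂ) := by
    intro x hx
    obtain ⟨hx1, -⟩ := Nat.mem_divisorsAntidiagonal.1 hx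
    have hx2 : x.1 ≠ 0 := by rintro h; simp [h] at hx1; exact hn hx1.symm
    have hx3 : x.2 ≠ 0 := by rintro h; simp [h] at hx1; exact hn hx1.symm
    rw [charFun_apply χ hx3, charLambda_apply χ hx2, ← hx1]
    push_cast
    rw [map_mul]
    ring
  rw [sum_congr rfl h1, ← mul_sum]
  congr 1
  rw [Nat.sum_divisorsAntidiagonal (f := fun i _ => (vonMangoldt i : ℂ)), ← vonMangoldt_sum]
  push_cast
  rfl

lemma mul_mul_log {f g b c : ArithmeticFunction ℂ}
    (hf : ∀ n : ℕ, f n * (Real.log n : ℂ) = (b * f) n)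
    (hg : ∀ n : ℕ, g n * (Real.log n : ℂ) = (c * g) n) (n : ℕ) :
    (f * g) n * (Real.log n : ℂ) = ((b + c) * (f * g)) n := by
  have h1 : (b + c) * (f * g) = b * f * g + f * (c * g) := by ring
  rw [h1, ArithmeticFunction.add_apply, mul_apply, mul_apply, mul_apply, sum_mul, ← sum_add_distrib]
  refine sum_congr rfl fun x hx => ?_
  obtain ⟨hx1, hn⟩ := Nat.mem_divisorsAntidiagonal.1 hx
  have hx2 : x.1 ≠ 0 := by rintro h; simp [h] at hx1; exact hn hx1.symm
  have hx3 : x.2 ≠ 0 := by rintro h; simp [h] at hx1; exact hn hx1.symm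
  rw [← hf, ← hg, ← hx1]
  rw [Nat.cast_mul, Real.log_mul (by exact_mod_cast hx2) (by exact_mod_cast hx3),
    Complex.ofReal_add]
  ring

open scoped ComplexOrder in
lemma nonneg_of_mul_log {a b : ArithmeticFunction ℂ} (ha1 : 0 ≤ a 1) (hb : ∀ n, 0 ≤ b n)
    (hb1 : b 1 = 0) (hab : ∀ n : ℕ, a n * (Real.log n : ℂ) = (b * a) n) (n : ℕ) : 0 ≤ a n := by
  induction n using Nat.strong_induction_on with
  | _ n ih =>
    rcases Nat.lt_or_ge n 2 with h | h
    · interval_cases n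
      · simp
      · exact ha1
    have hlog : 0 < Real.log n := Real.log_pos (by exact_mod_cast h)
    have h1 : 0 ≤ a n * (Real.log n : ℂ) := by
      rw [hab, mul_apply]
      refine sum_nonneg fun x hx => ?_
      obtain ⟨hx1, hn⟩ := Nat.mem_divisorsAntidiagonal.1 hx
      rcases eq_or_ne x.1 1 with h2 | h2
      · rw [h2, hb1, zero_mul]
      · have hx2 : x.1 ≠ 0 := by rintro h; simp [h] at hx1; exact hn hx1.symm
        have hx3 : x.2 ≠ 0 := by rintro h; simp [h] at hx1; exact hn hx1.symm
        refine mul_nonneg (hb _) (ih _ ?_)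
        have : 2 ≤ x.1 := by omega
        have : 0 < x.2 := by omega
        nlinarith
    have h2 : a n = a n * (Real.log n : ℂ) * ((Real.log n)⁻¹ : ℝ) := by
      rw [mul_assoc, ← Complex.ofReal_mul, mul_inv_cancel₀ hlog.ne', Complex.ofReal_one, mul_one]
    rw [h2]
    exact mul_nonneg h1 (Complex.zero_le_real.2 (by positivity))

/-- The coefficients of `ζ(s) L(s, ψ₁) L(s, ψ₂) L(s, ψ₁ψ₂)`. -/
noncomputable def biquadFun {q : ℕ} (ψ₁ ψ₂ : DirichletCharacter ℂ q) : ArithmeticFunction ℂ :=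
  (charFun (1 : DirichletCharacter ℂ 1) * charFun ψ₁) * (charFun ψ₂ * charFun (ψ₁ * ψ₂))

lemma biquadFun_one {q : ℕ} (ψ₁ ψ₂ : DirichletCharacter ℂ q) : biquadFun ψ₁ ψ₂ 1 = 1 := by
  simp [biquadFun, charFun_one]

open scoped ComplexOrder in
lemma one_add_char_nonneg {q : ℕ} {ψ : DirichletCharacter ℂ q} (hψ : ψ ^ 2 = 1) (a : ZMod q) :
    0 ≤ 1 + ψ a := by
  rcases MulChar.isQuadratic_iff_sq_eq_one.mpr hψ a with h | h | h
  · simp [h]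
  · rw [h]
    exact add_nonneg zero_le_one zero_le_one
  · simp [h]

open scoped ComplexOrder in
lemma biquadFun_nonneg {q : ℕ} {ψ₁ ψ₂ : DirichletCharacter ℂ q} (h₁ : ψ₁ ^ 2 = 1)
    (h₂ : ψ₂ ^ 2 = 1) (n : ℕ) : 0 ≤ biquadFun ψ₁ ψ₂ n := by
  refine nonneg_of_mul_log (b := charLambda (1 : DirichletCharacter ℂ 1) + charLambda ψ₁ +
    (charLambda ψ₂ + charLambda (ψ₁ * ψ₂))) ?_ (fun n => ?_) ?_ ?_ n
  · simp [biquadFun_one]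
  · rcases eq_or_ne n 0 with rfl | hn
    · simp
    simp only [ArithmeticFunction.add_apply, charLambda_apply _ hn, MulChar.mul_apply]
    have h3 : ((1 : DirichletCharacter ℂ 1) (n : ZMod 1)) = 1 :=
        MulChar.one_apply (isUnit_of_subsingleton _)
    have h4 : (1 + ψ₁ n) * (1 + ψ₂ n) * (vonMangoldt n : ℂ) =
      ((1 : DirichletCharacter ℂ 1) (n : ZMod 1)) * (vonMangoldt n : ℂ) +
          ψ₁ n * (vonMangoldt n : ℂ) +
        (ψ₂ n * (vonMangoldt n : ℂ) + ψ₁ n * ψ₂ n * (vonMangoldt n : ℂ)) := by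
      rw [h3]
      ring
    rw [← h4]
    exact mul_nonneg (mul_nonneg (one_add_char_nonneg h₁ _) (one_add_char_nonneg h₂ _))
      (Complex.zero_le_real.2 vonMangoldt_nonneg)
  · simp [charLambda_apply]
  · exact mul_mul_log (mul_mul_log (charFun_mul_log _) (charFun_mul_log _))
      (mul_mul_log (charFun_mul_log _) (charFun_mul_log _))

lemma LSeriesSummable_charFun {q : ℕ} (χ : DirichletCharacter ℂ q) {s : ℂ} (hs : 1 < s.re) :
    LSeriesSummable (charFun χ) s :=
  LSeriesSummable_of_bounded_of_one_lt_re (m := 1)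
    (fun n hn => by rw [charFun_apply χ hn]; exact χ.norm_le_one _) hs

lemma LSeries_charFun {q : ℕ} [NeZero q] (χ : DirichletCharacter ℂ q) {s : ℂ} (hs : 1 < s.re) :
    LSeries (charFun χ) s = χ.LFunction s := by
  rw [DirichletCharacter.LFunction_eq_LSeries χ hs]
  exact LSeries_congr (fun hn => charFun_apply χ hn) s

lemma LSeriesSummable_biquadFun {q : ℕ} (ψ₁ ψ₂ : DirichletCharacter ℂ q) {s : ℂ} (hs : 1 < s.re) :
    LSeriesSummable (biquadFun ψ₁ ψ₂) s :=
  LSeriesSummable_mul (LSeriesSummable_mul (LSeriesSummable_charFun _ hs)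
    (LSeriesSummable_charFun _ hs)) (LSeriesSummable_mul (LSeriesSummable_charFun _ hs)
    (LSeriesSummable_charFun _ hs))

lemma LSeries_biquadFun {q : ℕ} [NeZero q] (ψ₁ ψ₂ : DirichletCharacter ℂ q) {s : ℂ}
    (hs : 1 < s.re) : LSeries (biquadFun ψ₁ ψ₂) s =
      riemannZeta s * ψ₁.LFunction s * (ψ₂.LFunction s * (ψ₁ * ψ₂).LFunction s) := by
  have h := @LSeriesSummable_charFun
  rw [biquadFun, LSeries_mul' (LSeriesSummable_mul (h _ hs) (h _ hs))
    (LSeriesSummable_mul (h _ hs) (h _ hs)), LSeries_mul' (h _ hs) (h _ hs),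
    LSeries_mul' (h _ hs) (h _ hs), LSeries_charFun _ hs, LSeries_charFun _ hs,
    LSeries_charFun _ hs, LSeries_charFun _ hs, DirichletCharacter.LFunction_modOne_eq]

/-- The coefficients of `ζ(s) L(s, χ)`. -/
noncomputable def quadFun {q : ℕ} (χ : DirichletCharacter ℂ q) : ArithmeticFunction ℂ :=
  charFun (1 : DirichletCharacter ℂ 1) * charFun χ

lemma quadFun_one {q : ℕ} (χ : DirichletCharacter ℂ q) : quadFun χ 1 = 1 := by
  simp [quadFun, charFun_one]

open scoped ComplexOrder in
lemma quadFun_nonneg {q : ℕ} {χ : DirichletCharacter ℂ q} (h : χ ^ 2 = 1) (n : ℕ) :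
    0 ≤ quadFun χ n := by
  refine nonneg_of_mul_log (b := charLambda (1 : DirichletCharacter ℂ 1) + charLambda χ)
    ?_ (fun n => ?_) ?_ ?_ n
  · simp [quadFun_one]
  · rcases eq_or_ne n 0 with rfl | hn
    · simp
    simp only [ArithmeticFunction.add_apply, charLambda_apply _ hn]
    have h3 : ((1 : DirichletCharacter ℂ 1) (n : ZMod 1)) = 1 :=
        MulChar.one_apply (isUnit_of_subsingleton _)
    rw [h3, ← add_mul]
    exact mul_nonneg (one_add_char_nonneg h _) (Complex.zero_le_real.2 vonMangoldt_nonneg)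
  · simp [charLambda_apply]
  · exact mul_mul_log (charFun_mul_log _) (charFun_mul_log _)

lemma LSeriesSummable_quadFun {q : ℕ} (χ : DirichletCharacter ℂ q) {s : ℂ} (hs : 1 < s.re) :
    LSeriesSummable (quadFun χ) s :=
  LSeriesSummable_mul (LSeriesSummable_charFun _ hs) (LSeriesSummable_charFun _ hs)

lemma LSeries_quadFun {q : ℕ} [NeZero q] (χ : DirichletCharacter ℂ q) {s : ℂ}
    (hs : 1 < s.re) : LSeries (quadFun χ) s = riemannZeta s * χ.LFunction s := by
  have h := @LSeriesSummable_charFun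
  rw [quadFun, LSeries_mul' (h _ hs) (h _ hs), LSeries_charFun _ hs, LSeries_charFun _ hs,
    DirichletCharacter.LFunction_modOne_eq]

/-- `K ^ ω(N)` is at most `C N ^ ε`. -/
lemma prod_primeFactors_const_le {K ε : ℝ} (hK : 1 ≤ K) (hε : 0 < ε) :
    ∃ C : ℝ, 1 ≤ C ∧ ∀ N : ℕ, N ≠ 0 → ∏ _p ∈ N.primeFactors, K ≤ C * (N : ℝ) ^ ε := by
  obtain ⟨P, hP⟩ := exists_nat_ge (K ^ (1 / ε))
  refine ⟨K ^ P, one_le_pow₀ hK, fun N hN => ?_⟩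
  have h1 : ∀ p ∈ N.primeFactors, K ≤ (if p < P then K else 1) * (p : ℝ) ^ ε := by
    intro p hp
    have hp1 : (1 : ℝ) ≤ p := by exact_mod_cast (Nat.prime_of_mem_primeFactors hp).one_le
    split_ifs with h
    · exact le_mul_of_one_le_right (by linarith) (Real.one_le_rpow hp1 hε.le)
    · rw [one_mul]
      have h2 : K ^ (1 / ε) ≤ p := hP.trans (by exact_mod_cast not_lt.1 h)
      calc K = (K ^ (1 / ε)) ^ ε := by
            rw [← Real.rpow_mul (by linarith), one_div, inv_mul_cancel₀ hε.ne', Real.rpow_one]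
        _ ≤ _ := Real.rpow_le_rpow (by positivity) h2 hε.le
  calc ∏ _p ∈ N.primeFactors, K
      ≤ ∏ p ∈ N.primeFactors, ((if p < P then K else 1) * (p : ℝ) ^ ε) :=
        prod_le_prod (fun _ _ => by linarith) h1
    _ = K ^ #(N.primeFactors.filter (· < P)) * ((∏ p ∈ N.primeFactors, p : ℕ) : ℝ) ^ ε := by
        rw [prod_mul_distrib, prod_ite, prod_const, prod_const_one, mul_one, Nat.cast_prod,
          Real.finsetProd_rpow _ _ fun _ _ => by positivity]
    _ ≤ K ^ P * (N : ℝ) ^ ε := by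
        gcongr
        · calc #(N.primeFactors.filter (· < P)) ≤ #(range P) :=
              card_le_card fun p hp => mem_range.2 (mem_filter.1 hp).2
            _ = P := card_range P
        · exact_mod_cast Nat.le_of_dvd (Nat.pos_of_ne_zero hN) (Nat.prod_primeFactors_dvd N)

lemma im_char_eq_zero {q : ℕ} {χ : DirichletCharacter ℂ q} (hχ : χ ^ 2 = 1) (a : ZMod q) :
    (χ a).im = 0 := by
  rcases MulChar.isQuadratic_iff_sq_eq_one.mpr hχ a with h | h | h <;> simp [h]

lemma im_LFunction_eq_zero {q : ℕ} [NeZero q] {χ : DirichletCharacter ℂ q} (hχ : χ ^ 2 = 1)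
    {σ : ℝ} (hσ : 0 < σ) (h : σ ≠ 1 ∨ χ ≠ 1) : (χ.LFunction σ).im = 0 := by
  have hs1 : (σ : ℂ) ≠ 1 ∨ χ ≠ 1 := h.imp_left fun h h' => h (by exact_mod_cast h')
  have hcpow : ∀ (n : ℕ) (x : ℝ), ((n : ℂ) ^ (x : ℂ)) = (((n : ℝ) ^ x : ℝ) : ℂ) := fun n x => by
    rw [Complex.ofReal_cpow (by positivity), Complex.ofReal_natCast]
  have hbd : ∀ Y : ℕ, 1 ≤ Y → |(χ.LFunction σ).im| ≤
      σ * ((2 * q + ‖charMean χ‖) * (Y : ℝ) ^ (-σ) / σ) := by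
    intro Y hY
    have h1 := norm_LFunction_sub_partial_sum_le χ hY (s := σ) (by simpa using hσ) hs1
    refine le_trans ?_ (h1.trans (le_of_eq ?_))
    · refine le_trans (le_of_eq ?_) (Complex.abs_im_le_norm _)
      have h2 : (∑ n ∈ Icc 1 Y, χ n * (n : ℂ) ^ (-(σ : ℂ))).im = 0 := by
        rw [Complex.im_sum]
        refine sum_eq_zero fun n _ => ?_
        rw [← Complex.ofReal_neg, hcpow, Complex.im_mul_ofReal, im_char_eq_zero hχ, zero_mul]
      have h3 : (charMean χ).im = 0 := by
        rw [charMean, ← Complex.ofReal_natCast, Complex.div_ofReal_im, Complex.im_sum,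
          sum_eq_zero fun a _ => im_char_eq_zero hχ a, zero_div]
      have h4 : (charMean χ * (Y : ℂ) ^ (1 - (σ : ℂ)) / ((σ : ℂ) - 1)).im = 0 := by
        have e : (1 - (σ : ℂ)) = ((1 - σ : ℝ) : ℂ) := by push_cast; rfl
        have e' : ((σ : ℂ) - 1) = ((σ - 1 : ℝ) : ℂ) := by push_cast; rfl
        rw [e, e', hcpow, Complex.div_ofReal_im, Complex.im_mul_ofReal, h3, zero_mul, zero_div]
      rw [Complex.sub_im, Complex.sub_im, h2, h4, sub_zero, sub_zero]
    · rw [Complex.norm_real, Real.norm_of_nonneg hσ.le, Complex.ofReal_re]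
  have hlim : Filter.Tendsto (fun Y : ℕ => σ * ((2 * q + ‖charMean χ‖) * (Y : ℝ) ^ (-σ) / σ))
      Filter.atTop (nhds 0) := by
    have h1 := (tendsto_rpow_neg_atTop hσ).comp (tendsto_natCast_atTop_atTop (R := ℝ))
    have h2 := ((h1.const_mul (2 * q + ‖charMean χ‖)).div_const σ).const_mul σ
    simpa using h2
  have := ge_of_tendsto hlim (Filter.eventually_atTop.2 ⟨1, hbd⟩)
  exact abs_nonpos_iff.1 this

/-- The entire function `(s - 1) ζ(s)`. -/
noncomputable def zetaOne : ℂ → ℂ := DirichletCharacter.LFunctionTrivChar₁ 1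

lemma differentiable_zetaOne : Differentiable ℂ zetaOne :=
  DirichletCharacter.differentiable_LFunctionTrivChar₁ 1

lemma zetaOne_one : zetaOne 1 = 1 := by simp [zetaOne]

lemma zetaOne_apply {s : ℂ} (hs : s ≠ 1) : zetaOne s = (s - 1) * riemannZeta s := by
  simp [zetaOne, Function.update_of_ne hs, DirichletCharacter.LFunction_modOne_eq]

lemma im_zetaOne_eq_zero {σ : ℝ} (hσ : 0 < σ) (h : σ ≠ 1) : (zetaOne σ).im = 0 := by
  have hs1 : (σ : ℂ) ≠ 1 := fun h' => h (by exact_mod_cast h')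
  have e' : ((σ : ℂ) - 1) = ((σ - 1 : ℝ) : ℂ) := by push_cast; rfl
  have h1 := im_LFunction_eq_zero (χ := (1 : DirichletCharacter ℂ 1)) (by simp) hσ (.inl h)
  rw [DirichletCharacter.LFunction_modOne_eq] at h1
  rw [zetaOne_apply hs1, e', Complex.im_ofReal_mul, h1, mul_zero]

lemma exists_half_le_re_zetaOne :
    ∃ δ : ℝ, 0 < δ ∧ ∀ η : ℝ, 0 < η → η ≤ δ → 1 / 2 ≤ (zetaOne ((1 - η : ℝ) : ℂ)).re := by
  have hc : ContinuousAt (fun η : ℝ => (zetaOne ((1 - η : ℝ) : ℂ)).re) 0 := by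
    have := differentiable_zetaOne.continuous
    fun_prop
  have h0 : (1 / 2 : ℝ) < (fun η : ℝ => (zetaOne ((1 - η : ℝ) : ℂ)).re) 0 := by
    simp [zetaOne_one]
    norm_num
  obtain ⟨δ, hδ, h⟩ := Metric.eventually_nhds_iff.1 (hc.eventually (lt_mem_nhds h0))
  refine ⟨δ / 2, by linarith, fun η h1 h2 => (h ?_).le⟩
  rw [Real.dist_eq, sub_zero, abs_of_pos h1]
  linarith

lemma exists_norm_zetaOne_le : ∃ Z : ℝ, 1 ≤ Z ∧ ∀ s ∈ Metric.closedBall (2 : ℂ) (4 / 3),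
    ‖zetaOne s‖ ≤ Z := by
  obtain ⟨C, hC⟩ := (isCompact_closedBall (2 : ℂ) (4 / 3)).exists_bound_of_continuousOn
    differentiable_zetaOne.continuous.continuousOn
  exact ⟨max C 1, le_max_right _ _, fun s hs => (hC s hs).trans (le_max_left _ _)⟩

lemma norm_LFunction_le_of_mem_ball {q : ℕ} [NeZero q] {χ : DirichletCharacter ℂ q} (hχ : χ ≠ 1)
    {s : ℂ} (hs : s ∈ Metric.closedBall (2 : ℂ) (4 / 3)) : ‖χ.LFunction s‖ ≤ 17 * q := by
  rw [mem_closedBall_iff_norm] at hs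
  have hq : (1 : ℝ) ≤ q := by exact_mod_cast NeZero.one_le
  have h1 : 1 / 2 ≤ s.re := by
    have := (abs_le.1 ((Complex.abs_re_le_norm _).trans hs)).1
    simp at this
    linarith
  have h2 : ‖s‖ ≤ 4 := by
    have := norm_add_le (s - 2) 2
    simp at this
    linarith
  have := norm_LFunction_le_crude hχ h1
  nlinarith

open scoped ComplexOrder in
/-- Estermann's inequality for `ζ(s) H(s)`. -/
lemma le_norm_of_zeta_mul_nonneg_coeff {Z : ℝ} (hZ1 : 1 ≤ Z)
    (hZ : ∀ s ∈ Metric.closedBall (2 : ℂ) (4 / 3), ‖zetaOne s‖ ≤ Z)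
    {H : ℂ → ℂ} (hH : Differentiable ℂ H) {a : ArithmeticFunction ℂ}
    (ha : ∀ n, 0 ≤ a n) (ha1 : a 1 = 1) (hsum : ∀ s : ℂ, 1 < s.re → LSeriesSummable a s)
    (hHa : ∀ s : ℂ, 1 < s.re → LSeries a s = riemannZeta s * H s)
    {B : ℝ} (hB1 : 1 ≤ B) (hB : ∀ z ∈ Metric.closedBall (2 : ℂ) (4 / 3), ‖H z‖ ≤ B)
    {η : ℝ} (hη : 0 < η) (hη4 : η ≤ 1 / 4)
    (hσ : 0 ≤ (zetaOne ((1 - η : ℝ) : ℂ) * H ((1 - η : ℝ) : ℂ)).re) :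
    η / 4 * (192 * (Z * B)) ^ (-(16 * η)) ≤ ‖H 1‖ := by
  have hbd : ∀ z ∈ Metric.closedBall (2 : ℂ) (4 / 3), ‖zetaOne z * H z‖ ≤ Z * B := fun z hz => by
    rw [norm_mul]
    exact mul_le_mul (hZ z hz) (hB z hz) (norm_nonneg _) (by linarith)
  have h := le_norm_residue_of_nonneg_coeff (G := fun s => zetaOne s * H s)
    (differentiable_zetaOne.mul hH) (a := a) ha ha1 ?_ ?_ (B := Z * B) (by nlinarith)
    (fun z hz => hbd z (Metric.sphere_subset_closedBall hz))
    (hbd 1 (by rw [mem_closedBall_iff_norm]; norm_num)) hη hη4 hσ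
  · simpa [zetaOne_one] using h
  · refine lt_of_le_of_lt (LSeries.abscissaOfAbsConv_le_of_forall_lt_LSeriesSummable (x := 1)
      fun y hy => hsum _ (by simpa using hy)) ?_
    norm_cast
  · intro s hs
    have hs1 : s ≠ 1 := by
      rintro rfl
      simp at hs
    rw [hHa s hs, zetaOne_apply hs1, mul_assoc]

open scoped ComplexOrder in
lemma re_LFunction_two_pos {q : ℕ} [NeZero q] {χ : DirichletCharacter ℂ q} (hχ : χ ^ 2 = 1) :
    0 < (χ.LFunction 2).re := by
  have h1 : 0 < LSeries (quadFun χ) ((2 : ℝ) : ℂ) := by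
    refine LSeries.positive (fun n => quadFun_nonneg hχ n) (by simp [quadFun_one]) ?_
    refine lt_of_le_of_lt (LSeries.abscissaOfAbsConv_le_of_forall_lt_LSeriesSummable (x := 1)
      fun y hy => LSeriesSummable_quadFun χ (by simpa using hy)) ?_
    norm_cast
  rw [LSeries_quadFun χ (by norm_num)] at h1
  have h2 : riemannZeta ((2 : ℝ) : ℂ) = ((Real.pi ^ 2 / 6 : ℝ) : ℂ) := by
    rw [Complex.ofReal_ofNat, riemannZeta_two]
    push_cast
    rfl
  have h3 := (Complex.lt_def.1 h1).1
  rw [h2, Complex.re_ofReal_mul] at h3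
  simpa using (pos_iff_pos_of_mul_pos h3).1 (by positivity)

lemma exists_real_zero {q : ℕ} [NeZero q] {χ : DirichletCharacter ℂ q} (hχ1 : χ ≠ 1)
    (hχ : χ ^ 2 = 1) {σ : ℝ} (hσ : 0 < σ) (hσ1 : σ < 1) (h : (χ.LFunction σ).re < 0) :
    ∃ β : ℝ, σ < β ∧ β < 1 ∧ χ.LFunction β = 0 := by
  have hc : Continuous fun x : ℝ => (χ.LFunction x).re := by
    exact Complex.continuous_re.comp ((DirichletCharacter.differentiable_LFunction
      hχ1).continuous.comp Complex.continuous_ofReal)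
  have h2 := re_LFunction_two_pos hχ
  obtain ⟨β, hβ, hβ0⟩ := intermediate_value_Icc (by linarith : σ ≤ 2) hc.continuousOn
    (show (0 : ℝ) ∈ Set.Icc _ _ from ⟨h.le, by simpa using h2.le⟩)
  have hβ0' : χ.LFunction β = 0 :=
    Complex.ext hβ0 (im_LFunction_eq_zero hχ (by linarith [hβ.1]) (.inr hχ1))
  refine ⟨β, lt_of_le_of_ne hβ.1 ?_, ?_, hβ0'⟩
  · rintro rfl
    simp only at hβ0
    linarith
  · by_contra h1
    exact DirichletCharacter.LFunction_ne_zero_of_one_le_re χ (.inl hχ1)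
      (by simpa using h1) hβ0'

lemma norm_one_sub_char_mul_le {q p : ℕ} (χ : DirichletCharacter ℂ q) (hp : p.Prime) :
    ‖1 - χ p * (p : ℂ) ^ (-1 : ℂ)‖ ≤ 2 ∧ 2⁻¹ ≤ ‖1 - χ p * (p : ℂ) ^ (-1 : ℂ)‖ := by
  have h1 : ‖χ p * (p : ℂ) ^ (-1 : ℂ)‖ ≤ 1 / 2 := by
    rw [Complex.cpow_neg_one, norm_mul, norm_inv, Complex.norm_natCast]
    have h2 : (2 : ℝ) ≤ p := by exact_mod_cast hp.two_le
    calc ‖χ p‖ * (p : ℝ)⁻¹ ≤ 1 * 2⁻¹ := by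
          gcongr
          exact χ.norm_le_one _
      _ = 1 / 2 := by norm_num
  constructor
  · have := norm_sub_le 1 (χ p * (p : ℂ) ^ (-1 : ℂ))
    rw [norm_one] at this
    linarith
  · have := norm_sub_norm_le 1 (χ p * (p : ℂ) ^ (-1 : ℂ))
    rw [norm_one] at this
    linarith

lemma norm_LFunction_changeLevel_one {q N : ℕ} [NeZero q] [NeZero N] (hqN : q ∣ N)
    {χ : DirichletCharacter ℂ q} (hχ : χ ≠ 1) :
    ‖(DirichletCharacter.changeLevel hqN χ).LFunction 1‖ ≤
        ‖χ.LFunction 1‖ * ∏ _p ∈ N.primeFactors, 2 ∧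
      ‖χ.LFunction 1‖ ≤
        ‖(DirichletCharacter.changeLevel hqN χ).LFunction 1‖ * ∏ _p ∈ N.primeFactors, 2 := by
  rw [DirichletCharacter.LFunction_changeLevel hqN χ (.inl hχ), norm_mul, norm_prod]
  constructor
  · gcongr with p hp
    exact (norm_one_sub_char_mul_le χ (Nat.prime_of_mem_primeFactors hp)).1
  · rw [mul_assoc, ← prod_mul_distrib]
    refine le_mul_of_one_le_right (norm_nonneg _) (Finset.one_le_prod fun p hp => ?_)
    have := (norm_one_sub_char_mul_le χ (Nat.prime_of_mem_primeFactors hp)).2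
    linarith

lemma pow_changeLevel {q N : ℕ} (hqN : q ∣ N) {χ : DirichletCharacter ℂ q} (hχ : χ ^ 2 = 1) :
    (DirichletCharacter.changeLevel hqN χ) ^ 2 = 1 := by
  rw [← map_pow, hχ, map_one]

/-- The lower bound for `L(1, χ₂)` coming from a real zero of `L(s, χ₁)`. -/
lemma exists_le_norm_LFunction_one_of_zero {ε : ℝ} {q₁ : ℕ} [NeZero q₁]
    {χ₁ : DirichletCharacter ℂ q₁} (hχ₁ : χ₁ ≠ 1) (hχ₁' : χ₁ ^ 2 = 1) {η : ℝ} (hη : 0 < η)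
    (hη4 : η ≤ 1 / 4) (hηε : η ≤ ε / 192) (hzero : χ₁.LFunction ((1 - η : ℝ) : ℂ) = 0) :
    ∃ c : ℝ, 0 < c ∧ ∀ (q : ℕ) [NeZero q] (χ : DirichletCharacter ℂ q), χ ≠ 1 → χ ^ 2 = 1 →
      c * (q : ℝ) ^ (-ε) ≤ ‖χ.LFunction 1‖ := by
  obtain ⟨Z, hZ1, hZ⟩ := exists_norm_zetaOne_le
  obtain ⟨K, hK1, hK⟩ :=
    prod_primeFactors_const_le (K := 2) (ε := ε / 4) (by norm_num) (by linarith)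
  set δ := min (1 / 4) (ε / 16) with hδ
  have hδ0 : 0 < δ := lt_min (by norm_num) (by linarith)
  have hδε : 4 * δ ≤ ε / 4 := by
    have := min_le_right (1 / 4) (ε / 16)
    linarith
  obtain ⟨C, hC0, hC⟩ := norm_LFunction_le hδ0 (min_le_left _ _)
  have hL1 : χ₁.LFunction 1 ≠ 0 := DirichletCharacter.LFunction_apply_one_ne_zero hχ₁
  have hL1' : 0 < ‖χ₁.LFunction 1‖ := norm_pos_iff.2 hL1
  set W : ℝ := 192 * (Z * 17 ^ 3) with hW
  have hW0 : 0 < W := by positivity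
  set cA : ℝ := η / 4 * W ^ (-(16 * η)) / ((C * 2 ^ (2 * δ)) ^ 2 * K) with hcA
  set cB : ℝ := ‖χ₁.LFunction 1‖ / K ^ 2 with hcB
  have hK0 : 0 < K := by linarith
  have hcA0 : 0 < cA := by positivity
  have hcB0 : 0 < cB := by positivity
  have hq₁ : (1 : ℝ) ≤ q₁ := by exact_mod_cast NeZero.one_le
  refine ⟨min cA cB * (q₁ : ℝ) ^ (-ε), by positivity, fun q _ χ hχ hχ' => ?_⟩
  have hq : (1 : ℝ) ≤ q := by exact_mod_cast NeZero.one_le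
  set N := q₁ * q with hN
  have hNr : (1 : ℝ) ≤ (N : ℝ) := by exact_mod_cast NeZero.one_le
  have hN0 : (0 : ℝ) < N := by linarith
  have hNe : (N : ℝ) ^ (-ε) = (q₁ : ℝ) ^ (-ε) * (q : ℝ) ^ (-ε) := by
    rw [hN, Nat.cast_mul, Real.mul_rpow (by positivity) (by positivity)]
  rw [mul_assoc, ← hNe]
  set ψ₁ := DirichletCharacter.changeLevel (Dvd.intro q rfl : q₁ ∣ N) χ₁ with hψ₁
  set ψ₂ := DirichletCharacter.changeLevel (Dvd.intro_left q₁ rfl : q ∣ N) χ with hψ₂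
  have h1 : ψ₁ ≠ 1 := fun h => hχ₁ ((DirichletCharacter.changeLevel_eq_one_iff _).1 h)
  have h2 : ψ₂ ≠ 1 := fun h => hχ ((DirichletCharacter.changeLevel_eq_one_iff _).1 h)
  have h1' : ψ₁ ^ 2 = 1 := pow_changeLevel _ hχ₁'
  have h2' : ψ₂ ^ 2 = 1 := pow_changeLevel _ hχ'
  have hω : ∏ _p ∈ N.primeFactors, (2 : ℝ) ≤ K * (N : ℝ) ^ (ε / 4) := hK N (NeZero.ne N)
  have hψ₁' := norm_LFunction_changeLevel_one (Dvd.intro q rfl : q₁ ∣ N) hχ₁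
  have hψ₂' := norm_LFunction_changeLevel_one (Dvd.intro_left q₁ rfl : q ∣ N) hχ
  rw [← hψ₁] at hψ₁'
  rw [← hψ₂] at hψ₂'
  by_cases h3 : ψ₁ * ψ₂ = 1
  · have h4 : ψ₁ = ψ₂ := by
      calc ψ₁ = ψ₁ * ψ₂ ^ 2 := by rw [h2', mul_one]
        _ = ψ₁ * ψ₂ * ψ₂ := by rw [pow_two, mul_assoc]
        _ = ψ₂ := by rw [h3, one_mul]
    rw [h4] at hψ₁'
    have h5 : ‖χ₁.LFunction 1‖ ≤ ‖χ.LFunction 1‖ * (K * (N : ℝ) ^ (ε / 4)) ^ 2 := by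
      calc ‖χ₁.LFunction 1‖ ≤ ‖χ.LFunction 1‖ * (∏ _p ∈ N.primeFactors, 2) *
            (∏ _p ∈ N.primeFactors, 2) :=
          hψ₁'.2.trans (mul_le_mul_of_nonneg_right hψ₂'.1 (by positivity))
        _ = ‖χ.LFunction 1‖ * (∏ _p ∈ N.primeFactors, 2) ^ 2 := by ring
        _ ≤ _ := by gcongr
    calc min cA cB * (N : ℝ) ^ (-ε) ≤ cB * (N : ℝ) ^ (-(ε / 2)) := by
          gcongr
          · exact min_le_right _ _
          · linarith
      _ ≤ ‖χ.LFunction 1‖ * (K * (N : ℝ) ^ (ε / 4)) ^ 2 / K ^ 2 * (N : ℝ) ^ (-(ε / 2)) := by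
          rw [hcB]
          gcongr
      _ = ‖χ.LFunction 1‖ * ((N : ℝ) ^ (ε / 2) * (N : ℝ) ^ (-(ε / 2))) := by
          rw [mul_pow, ← Real.rpow_mul_natCast hN0.le]
          have : ε / 4 * (2 : ℕ) = ε / 2 := by push_cast; ring
          rw [this]
          field_simp
      _ = ‖χ.LFunction 1‖ := by rw [← Real.rpow_add hN0, add_neg_cancel, Real.rpow_zero, mul_one]
  · have hB : ∀ z ∈ Metric.closedBall (2 : ℂ) (4 / 3),
        ‖ψ₁.LFunction z * (ψ₂.LFunction z * (ψ₁ * ψ₂).LFunction z)‖ ≤ (17 * N) ^ 3 := by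
      intro z hz
      rw [norm_mul, norm_mul]
      have e1 := norm_LFunction_le_of_mem_ball h1 hz
      have e2 := norm_LFunction_le_of_mem_ball h2 hz
      have e3 := norm_LFunction_le_of_mem_ball h3 hz
      calc _ ≤ (17 * N : ℝ) * ((17 * N) * (17 * N)) := by gcongr
        _ = _ := by ring
    have hz0 : ψ₁.LFunction ((1 - η : ℝ) : ℂ) = 0 := by
      rw [hψ₁, DirichletCharacter.LFunction_changeLevel _ χ₁ (.inl hχ₁), hzero, zero_mul]
    have hE := le_norm_of_zeta_mul_nonneg_coeff hZ1 hZ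
      (H := fun s => ψ₁.LFunction s * (ψ₂.LFunction s * (ψ₁ * ψ₂).LFunction s))
      ((DirichletCharacter.differentiable_LFunction h1).mul
        ((DirichletCharacter.differentiable_LFunction h2).mul
          (DirichletCharacter.differentiable_LFunction h3)))
      (a := biquadFun ψ₁ ψ₂) (biquadFun_nonneg h1' h2') (biquadFun_one _ _)
      (fun s hs => LSeriesSummable_biquadFun _ _ hs)
      (fun s hs => by rw [LSeries_biquadFun _ _ hs, mul_assoc])
      (B := (17 * N) ^ 3) (one_le_pow₀ (by linarith)) hB hη hη4
      (by simp only [hz0, zero_mul, mul_zero, Complex.zero_re, le_refl])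
    have hτ : aCond N 1 = 2 * N := by
      simp [aCond, mul_comm]
    have hb : ∀ ψ : DirichletCharacter ℂ N, ψ ≠ 1 →
        ‖ψ.LFunction 1‖ ≤ C * 2 ^ (2 * δ) * (N : ℝ) ^ (2 * δ) := fun ψ hψ => by
      have := hC N ψ 1 (by simp; linarith) (by norm_num) (.inl hψ)
      rwa [hτ, Real.mul_rpow (by norm_num) hN0.le, ← mul_assoc] at this
    have hN1 : 192 * (Z * (17 * N) ^ 3) = W * (N : ℝ) ^ 3 := by rw [hW]; ring
    have hpow : ((N : ℝ) ^ 3) ^ (-(16 * η)) = (N : ℝ) ^ (-(48 * η)) := by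
      rw [← Real.rpow_natCast, ← Real.rpow_mul hN0.le]
      congr 1
      push_cast
      ring
    rw [hN1, Real.mul_rpow hW0.le (by positivity), hpow] at hE
    have hE2 : η / 4 * (W ^ (-(16 * η)) * (N : ℝ) ^ (-(48 * η))) ≤
        (C * 2 ^ (2 * δ)) ^ 2 * K * ‖χ.LFunction 1‖ * (N : ℝ) ^ (ε / 2) := by
      refine hE.trans ?_
      rw [norm_mul, norm_mul]
      calc _ ≤ (C * 2 ^ (2 * δ) * (N : ℝ) ^ (2 * δ)) *
            ((‖χ.LFunction 1‖ * (K * (N : ℝ) ^ (ε / 4))) *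
            (C * 2 ^ (2 * δ) * (N : ℝ) ^ (2 * δ))) := by
            gcongr
            · exact hb _ h1
            · exact hψ₂'.1.trans (by gcongr)
            · exact hb _ h3
        _ = (C * 2 ^ (2 * δ)) ^ 2 * K * ‖χ.LFunction 1‖ *
            ((N : ℝ) ^ (2 * δ) * (N : ℝ) ^ (2 * δ) * (N : ℝ) ^ (ε / 4)) := by ring
        _ ≤ _ := by
            rw [← Real.rpow_add hN0, ← Real.rpow_add hN0]
            gcongr
            linarith
    calc min cA cB * (N : ℝ) ^ (-ε) ≤ cA * ((N : ℝ) ^ (-(48 * η)) * (N : ℝ) ^ (-(ε / 2))) := by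
          rw [← Real.rpow_add hN0]
          gcongr
          · exact min_le_left _ _
          · linarith
      _ = η / 4 * (W ^ (-(16 * η)) * (N : ℝ) ^ (-(48 * η))) / ((C * 2 ^ (2 * δ)) ^ 2 * K) *
          (N : ℝ) ^ (-(ε / 2)) := by
          rw [hcA]
          ring
      _ ≤ (C * 2 ^ (2 * δ)) ^ 2 * K * ‖χ.LFunction 1‖ * (N : ℝ) ^ (ε / 2) /
          ((C * 2 ^ (2 * δ)) ^ 2 * K) * (N : ℝ) ^ (-(ε / 2)) := by gcongr
      _ = ‖χ.LFunction 1‖ * ((N : ℝ) ^ (ε / 2) * (N : ℝ) ^ (-(ε / 2))) := by field_simp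
      _ = ‖χ.LFunction 1‖ := by rw [← Real.rpow_add hN0, add_neg_cancel, Real.rpow_zero, mul_one]

/-- Siegel's theorem. -/
theorem exists_le_norm_LFunction_one {ε : ℝ} (hε : 0 < ε) :
    ∃ c : ℝ, 0 < c ∧ ∀ (q : ℕ) [NeZero q] (χ : DirichletCharacter ℂ q), χ ≠ 1 → χ ^ 2 = 1 →
      c * (q : ℝ) ^ (-ε) ≤ ‖χ.LFunction 1‖ := by
  obtain ⟨δ, hδ, hδz⟩ := exists_half_le_re_zetaOne
  set η := min δ (min (1 / 4) (ε / 192)) with hη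
  have hη0 : 0 < η := lt_min hδ (lt_min (by norm_num) (by linarith))
  have hη4 : η ≤ 1 / 4 := (min_le_right _ _).trans (min_le_left _ _)
  have hηε : η ≤ ε / 192 := (min_le_right _ _).trans (min_le_right _ _)
  have hηδ : η ≤ δ := min_le_left _ _
  by_cases hneg : ∃ (q₁ : ℕ) (_ : NeZero q₁) (χ₁ : DirichletCharacter ℂ q₁), χ₁ ≠ 1 ∧ χ₁ ^ 2 = 1 ∧
      (χ₁.LFunction ((1 - η : ℝ) : ℂ)).re < 0
  · obtain ⟨q₁, _, χ₁, h1, h2, h3⟩ := hneg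
    obtain ⟨β, hβ1, hβ2, hβ0⟩ := exists_real_zero h1 h2 (by linarith) (by linarith) h3
    exact exists_le_norm_LFunction_one_of_zero h1 h2 (η := 1 - β) (by linarith) (by linarith)
      (by linarith) (by rw [sub_sub_cancel]; exact hβ0)
  · push Not at hneg
    obtain ⟨Z, hZ1, hZ⟩ := exists_norm_zetaOne_le
    refine ⟨η / 4 * (192 * (Z * 17)) ^ (-(16 * η)), by positivity, fun q _ χ hχ hχ' => ?_⟩
    have hq : (1 : ℝ) ≤ q := by exact_mod_cast NeZero.one_le
    have h1 := le_norm_of_zeta_mul_nonneg_coeff hZ1 hZ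
      (DirichletCharacter.differentiable_LFunction hχ) (a := quadFun χ) (quadFun_nonneg hχ')
      (quadFun_one _) (fun s hs => LSeriesSummable_quadFun _ hs) (fun s hs => LSeries_quadFun _ hs)
      (B := 17 * q) (by linarith) (fun z hz => norm_LFunction_le_of_mem_ball hχ hz) hη0 hη4
      (by
        rw [Complex.mul_re, im_zetaOne_eq_zero (by linarith) (by linarith), zero_mul, sub_zero]
        exact mul_nonneg (by linarith [hδz η hη0 hηδ]) (hneg q _ χ hχ hχ'))
    refine le_trans ?_ h1
    rw [mul_assoc]
    gcongr
    rw [show 192 * (Z * (17 * q)) = 192 * (Z * 17) * (q : ℝ) by ring,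
      Real.mul_rpow (x := 192 * (Z * 17)) (y := q) (by positivity) (by linarith)]
    gcongr
    linarith

lemma exists_norm_LFunction_le_div : ∃ Z : ℝ, 1 ≤ Z ∧ ∀ (q : ℕ) [NeZero q]
    (χ : DirichletCharacter ℂ q) (s : ℂ), 1 < s.re → s.re ≤ 2 →
      ‖χ.LFunction s‖ ≤ Z / (s.re - 1) := by
  obtain ⟨Z, hZ1, hZ⟩ := exists_norm_zetaOne_le
  refine ⟨Z, hZ1, fun q _ χ s hs hs2 => ?_⟩
  have hs' : 1 < ((s.re : ℂ)).re := by simpa using hs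
  have h1 : ‖χ.LFunction s‖ ≤ ‖riemannZeta (s.re : ℂ)‖ := by
    have hz : LSeriesHasSum 1 (s.re : ℂ) (riemannZeta (s.re : ℂ)) := LSeriesHasSum_one hs'
    have hz' : HasSum (fun n => (LSeries.term 1 (s.re : ℂ) n).re) (riemannZeta (s.re : ℂ)).re :=
      Complex.hasSum_re hz
    rw [DirichletCharacter.LFunction_eq_LSeries χ hs]
    refine (tsum_of_norm_bounded hz' fun n => ?_).trans (Complex.re_le_norm _)
    rcases eq_or_ne n 0 with rfl | hn
    · simp
    · rw [LSeries.norm_term_eq, if_neg hn, LSeries.term_of_ne_zero hn, Pi.one_apply,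
        ← Complex.ofReal_natCast, ← Complex.ofReal_cpow (by positivity), ← Complex.ofReal_one,
        ← Complex.ofReal_div, Complex.ofReal_re]
      gcongr
      exact χ.norm_le_one _
  have h2 := hZ (s.re : ℂ) (by
    rw [mem_closedBall_iff_norm, ← Complex.ofReal_ofNat, ← Complex.ofReal_sub, Complex.norm_real,
      Real.norm_eq_abs, abs_le]
    constructor <;> linarith)
  have hne : (s.re : ℂ) ≠ 1 := by
    intro h
    rw [h] at hs'
    simp at hs'
  rw [zetaOne_apply hne, norm_mul, ← Complex.ofReal_one, ← Complex.ofReal_sub, Complex.norm_real,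
    Real.norm_of_nonneg (by linarith)] at h2
  rw [le_div_iff₀ (by linarith), mul_comm]
  exact (mul_le_mul_of_nonneg_left h1 (by linarith)).trans h2

/-- The `3-4-1` inequality with explicit bounds for two of the factors. -/
lemma le_norm_pow_four {q : ℕ} [NeZero q] (χ : DirichletCharacter ℂ q) {Z M x t : ℝ}
    (hZ : ∀ s : ℂ, 1 < s.re → s.re ≤ 2 → ‖(1 : DirichletCharacter ℂ q).LFunction s‖ ≤
        Z / (s.re - 1))
    (hx : 0 < x) (hx1 : x ≤ 1) (hM0 : 0 < M)
    (hM : ‖(χ ^ 2).LFunction (1 + x + 2 * Complex.I * t)‖ ≤ M) :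
    x ^ 3 / (Z ^ 3 * M) ≤ ‖χ.LFunction (1 + x + Complex.I * t)‖ ^ 4 := by
  have h := DirichletCharacter.norm_LFunction_product_ge_one χ hx t
  have h1 := hZ (1 + x) (by simpa using hx) (by simp; linarith)
  rw [show ((1 : ℂ) + x).re - 1 = x by simp] at h1
  rw [norm_mul, norm_mul, norm_pow, norm_pow] at h
  have hZ0 : 0 < Z := by
    have h0 : 0 < ‖(1 : DirichletCharacter ℂ q).LFunction (1 + x)‖ := by
      rw [norm_pos_iff]
      intro h0
      have h0' : DirichletCharacter.LFunctionTrivChar q (1 + x) = 0 := h0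
      rw [h0'] at h
      simp at h
      linarith
    have := h0.trans_le h1
    by_contra hZ'
    have : Z / x ≤ 0 := div_nonpos_of_nonpos_of_nonneg (not_lt.1 hZ') hx.le
    linarith
  rw [div_le_iff₀ (by positivity)]
  have h2 : 1 ≤ (Z / x) ^ 3 * ‖χ.LFunction (1 + x + Complex.I * t)‖ ^ 4 * M := by
    refine le_trans h ?_
    gcongr
  rw [div_pow] at h2
  have hx3 : 0 < x ^ 3 := by positivity
  calc x ^ 3 = x ^ 3 * 1 := by ring
    _ ≤ x ^ 3 * (Z ^ 3 / x ^ 3 * ‖χ.LFunction (1 + x + Complex.I * t)‖ ^ 4 * M) := by gcongr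
    _ = _ := by field_simp

lemma norm_sub_le_of_deriv_le {f : ℂ → ℂ} {s : Set ℂ} (hs : Convex ℝ s)
    (hf : ∀ z ∈ s, DifferentiableAt ℂ f z) {D : ℝ} (hD : ∀ z ∈ s, ‖deriv f z‖ ≤ D) {a b : ℂ}
    (ha : a ∈ s) (hb : b ∈ s) : ‖f a‖ - D * ‖b - a‖ ≤ ‖f b‖ := by
  have h := hs.norm_image_sub_le_of_norm_deriv_le hf hD ha hb
  have := norm_sub_norm_le (f a) (f b)
  rw [norm_sub_rev] at this
  linarith

lemma inv_norm_LFunction_le_of_bounds {q : ℕ} [NeZero q] (χ : DirichletCharacter ℂ q)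
    {Z M D t : ℝ}
    (hZ : ∀ s : ℂ, 1 < s.re → s.re ≤ 2 → ‖(1 : DirichletCharacter ℂ q).LFunction s‖ ≤
        Z / (s.re - 1))
    (hZ1 : 1 ≤ Z) (hM1 : 1 ≤ M) (hD1 : 1 ≤ D)
    (hM : ∀ x : ℝ, 0 < x → x ≤ 1 → ‖(χ ^ 2).LFunction (1 + x + 2 * Complex.I * t)‖ ≤ M)
    (hD : ∀ x : ℝ, 0 < x → x ≤ 1 → ‖deriv χ.LFunction (1 + x + Complex.I * t)‖ ≤ D)
    {x : ℝ} (hx : 0 < x) (hx1 : x ≤ 1) :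
    ‖χ.LFunction (1 + x + Complex.I * t)‖⁻¹ ≤ 16 * (Z ^ 3 * M) * D ^ 3 := by
  set v := (Z ^ 3 * M) ^ (1 / 4 : ℝ) with hv
  have hZM : 1 ≤ Z ^ 3 * M := one_le_mul_of_one_le_of_one_le (one_le_pow₀ hZ1) hM1
  have hv1 : 1 ≤ v := Real.one_le_rpow hZM (by norm_num)
  have hv4 : v ^ 4 = Z ^ 3 * M := by
    rw [hv, ← Real.rpow_mul_natCast (by linarith)]
    norm_num
  have hv0 : 0 < v := by linarith
  have hD0 : 0 < D := by linarith
  set w := 1 / (2 * v * D) with hw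
  have hw0 : 0 < w := by positivity
  have hw1 : w ≤ 1 := by
    rw [hw, div_le_one (by positivity)]
    nlinarith
  have hlow : ∀ y : ℝ, w ^ 4 ≤ y → y ≤ 1 → w ^ 3 / v ≤ ‖χ.LFunction (1 + y + Complex.I * t)‖ := by
    intro y hy hy1
    have hy0 : 0 < y := lt_of_lt_of_le (by positivity) hy
    have h1 := le_norm_pow_four χ hZ hy0 hy1 (by linarith) (hM y hy0 hy1)
    refine le_of_pow_le_pow_left₀ (n := 4) (by norm_num) (norm_nonneg _) (le_trans ?_ h1)
    rw [div_pow, hv4]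
    gcongr
    calc (w ^ 3) ^ 4 = (w ^ 4) ^ 3 := by ring
      _ ≤ y ^ 3 := by gcongr
  have hmain : w ^ 3 / (2 * v) ≤ ‖χ.LFunction (1 + x + Complex.I * t)‖ := by
    rcases le_total (w ^ 4) x with h | h
    · refine le_trans ?_ (hlow x h hx1)
      gcongr
      linarith
    · have hw4 : w ^ 4 ≤ 1 := pow_le_one₀ hw0.le hw1
      have h1 := hlow (w ^ 4) le_rfl hw4
      set S : Set ℂ := {z | 1 < z.re} ∩ ({z | z.re ≤ 2} ∩ {z | z.im = t}) with hS
      have hSc : Convex ℝ S := by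
        refine (convex_halfSpace_re_gt 1).inter ((convex_halfSpace_re_le 2).inter ?_)
        exact convex_hyperplane (f := Complex.im) (IsLinearMap.mk (fun _ _ => rfl)
          (fun c z => by simp)) t
      have hmem : ∀ y : ℝ, 0 < y → y ≤ 1 → (1 + y + Complex.I * t : ℂ) ∈ S := by
        intro y h1 h2
        refine ⟨by simpa using h1, ?_, by simp⟩
        simp
        linarith
      have h2 := norm_sub_le_of_deriv_le hSc (f := χ.LFunction) (fun z hz =>
        χ.differentiableAt_LFunction z (.inl (by rintro rfl; simpa using hz.1)))
        (D := D) (fun z hz => by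
          have h3 := hD (z.re - 1) (by linarith [show 1 < z.re from hz.1])
            (by linarith [show z.re ≤ 2 from hz.2.1])
          have h4 : (1 + ((z.re - 1 : ℝ) : ℂ) + Complex.I * t : ℂ) = z := by
            apply Complex.ext
            · simp
            · simpa using hz.2.2.symm
          rwa [h4] at h3) (hmem (w ^ 4) (by positivity) hw4) (hmem x hx hx1)
      have h3 : ‖(1 + x + Complex.I * t : ℂ) - (1 + ((w ^ 4 : ℝ) : ℂ) + Complex.I * t)‖ ≤
          w ^ 4 := by
        have : (1 + x + Complex.I * t : ℂ) - (1 + ((w ^ 4 : ℝ) : ℂ) + Complex.I * t) =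
            ((x - w ^ 4 : ℝ) : ℂ) := by push_cast; ring
        rw [this, Complex.norm_real, Real.norm_eq_abs, abs_le]
        constructor <;> linarith
      have h4 : D * w ^ 4 = w ^ 3 / (2 * v) := by
        have : D * w = 1 / (2 * v) := by
          rw [hw]
          field_simp
        calc D * w ^ 4 = D * w * w ^ 3 := by ring
          _ = _ := by rw [this]; ring
      have h5 : w ^ 3 / v = 2 * (w ^ 3 / (2 * v)) := by field_simp
      have h6 := mul_le_mul_of_nonneg_left h3 hD0.le
      linarith
  have hval : w ^ 3 / (2 * v) = (16 * (Z ^ 3 * M) * D ^ 3)⁻¹ := by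
    rw [hw, ← hv4]
    field_simp
    norm_num
  rw [hval] at hmain
  exact inv_le_of_inv_le₀ (by positivity) hmain

lemma norm_LFunctionTrivChar_le_of_small {q : ℕ} [NeZero q] {Z : ℝ}
    (hZ : ∀ s ∈ Metric.closedBall (2 : ℂ) (4 / 3), ‖zetaOne s‖ ≤ Z) {x t : ℝ} (hx : 0 < x)
    (hx1 : x ≤ 1) (ht : |t| ≤ 1 / 4) (ht0 : t ≠ 0) :
    ‖(1 : DirichletCharacter ℂ q).LFunction (1 + x + 2 * Complex.I * t)‖ ≤
      (∏ _p ∈ q.primeFactors, 2) * (Z / |t|) := by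
  set s : ℂ := 1 + x + 2 * Complex.I * t with hs
  have hre : s.re = 1 + x := by simp [hs]
  have him : s.im = 2 * t := by simp [hs]
  have hne : s ≠ 1 := by
    intro h
    rw [h] at him
    simp at him
    exact ht0 him
  have h1 := DirichletCharacter.LFunctionTrivChar_eq_mul_riemannZeta (N := q) hne
  rw [DirichletCharacter.LFunctionTrivChar] at h1
  rw [h1, norm_mul, norm_prod]
  have ht' : 0 < |t| := abs_pos.2 ht0
  gcongr with p hp
  · have hp := (Nat.prime_of_mem_primeFactors hp)
    have h2 : ‖(p : ℂ) ^ (-s)‖ ≤ 1 := by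
      rw [Complex.norm_natCast_cpow_of_pos hp.pos]
      refine Real.rpow_le_one_of_one_le_of_nonpos (by exact_mod_cast hp.one_le) ?_
      rw [Complex.neg_re, hre]
      linarith
    have := norm_sub_le 1 ((p : ℂ) ^ (-s))
    rw [norm_one] at this
    linarith
  · have hmem : s ∈ Metric.closedBall (2 : ℂ) (4 / 3) := by
      rw [mem_closedBall_iff_norm]
      refine le_of_pow_le_pow_left₀ (n := 2) (by norm_num) (by norm_num) ?_
      rw [← Complex.normSq_eq_norm_sq, Complex.normSq_apply]
      simp only [Complex.sub_re, Complex.sub_im, hre, him, Complex.re_ofNat, Complex.im_ofNat]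
      have := abs_le.1 ht
      nlinarith
    have h2 := hZ s hmem
    rw [zetaOne_apply hne, norm_mul] at h2
    have h3 : |t| ≤ ‖s - 1‖ := by
      refine le_trans ?_ (Complex.abs_im_le_norm _)
      rw [Complex.sub_im, him, Complex.one_im, sub_zero, abs_mul, abs_two]
      linarith
    rw [le_div_iff₀ ht', mul_comm]
    exact (mul_le_mul_of_nonneg_right h3 (norm_nonneg _)).trans h2

set_option maxHeartbeats 1000000 in
/-- The reciprocal of a Dirichlet `L`-function is small to the right of the line `re s = 1`. -/
lemma inv_norm_LFunction_le {ε : ℝ} (hε : 0 < ε) :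
    ∃ C : ℝ, 0 < C ∧ ∀ (q : ℕ) [NeZero q] (χ : DirichletCharacter ℂ q) (s : ℂ),
      1 < s.re → s.re ≤ 2 → (χ ≠ 1 ∨ 1 / 2 ≤ |s.im|) →
        ‖χ.LFunction s‖⁻¹ ≤ C * aCond q s ^ ε := by
  set e := min (1 / 2) (ε / 6) with he
  have he0 : 0 < e := lt_min (by norm_num) (by linarith)
  have he1 : e ≤ 1 / 2 := min_le_left _ _
  have he6 : 6 * e ≤ ε := by
    have := min_le_right (1 / 2) (ε / 6)
    linarith
  obtain ⟨CD', hCD'0, hCD'⟩ := norm_iteratedDeriv_LFunction_le 1 he0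
  obtain ⟨CM', hCM'0, hCM'⟩ := norm_LFunction_le (δ := e / 2) (by linarith) (by linarith)
  obtain ⟨Z1, hZ11, hZ1⟩ := exists_norm_LFunction_le_div
  obtain ⟨Z2, hZ21, hZ2⟩ := exists_norm_zetaOne_le
  obtain ⟨K, hK1, hK⟩ := prod_primeFactors_const_le (K := 2) (ε := e) (by norm_num) he0
  obtain ⟨c, hc0, hc⟩ := exists_le_norm_LFunction_one he0
  set CD := max CD' 1 with hCD
  set CM := max CM' 1 with hCM
  have hCD1 : 1 ≤ CD := le_max_right _ _
  have hCM1 : 1 ≤ CM := le_max_right _ _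
  set c₁ := min 1 (c / (8 * CD)) with hc₁
  have hc₁0 : 0 < c₁ := lt_min one_pos (by positivity)
  have hc₁1 : c₁ ≤ 1 := min_le_left _ _
  have hc₁c : 8 * CD * c₁ ≤ c := by
    have := min_le_right 1 (c / (8 * CD))
    rwa [← hc₁, le_div_iff₀ (by positivity), mul_comm] at this
  refine ⟨32 * Z1 ^ 3 * CM * CD ^ 3 + 16 * Z1 ^ 3 * (K * Z2 / c₁) * CD ^ 3 + 2 / c + Z1 / c₁,
    by positivity, fun q _ χ s hs hs2 h => ?_⟩
  have hq1 : (1 : ℝ) ≤ q := by exact_mod_cast NeZero.one_le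
  set τ := aCond q s with hτ
  have hτ2 : 2 ≤ τ := two_le_aCond q s
  have hτ0 : 0 < τ := by linarith
  set X := τ ^ e with hX
  have hX1 : 1 ≤ X := Real.one_le_rpow (by linarith) he0.le
  have hqτ : (q : ℝ) ≤ τ := by
    rw [hτ, aCond]
    exact le_mul_of_one_le_right (by linarith) (by linarith [abs_nonneg s.im])
  have hqX : (q : ℝ) ^ e ≤ X := Real.rpow_le_rpow (by linarith) hqτ he0.le
  have hτ_mono : ∀ z : ℂ, |z.im| ≤ 2 * |s.im| + 2 → aCond q z ≤ 2 * τ := by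
    intro z hz
    rw [hτ, aCond, aCond, mul_left_comm]
    exact mul_le_mul_of_nonneg_left (by linarith) (by linarith)
  have hX6 : X ^ 6 ≤ τ ^ ε := by
    rw [hX, ← Real.rpow_mul_natCast hτ0.le]
    exact Real.rpow_le_rpow_of_exponent_le (by linarith) (by push_cast; linarith)
  have hX6' : ∀ n ≤ 6, X ^ n ≤ τ ^ ε := fun n hn => (pow_le_pow_right₀ hX1 hn).trans hX6
  set x := s.re - 1 with hx
  set t := s.im with ht
  have hx0 : 0 < x := by linarith
  have hx1 : x ≤ 1 := by linarith
  have hs' : s = 1 + x + Complex.I * t := by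
    apply Complex.ext <;> simp [hx, ht]
  suffices hsuf : ‖χ.LFunction s‖⁻¹ ≤ 32 * Z1 ^ 3 * CM * CD ^ 3 * X ^ 4 ∨
      ‖χ.LFunction s‖⁻¹ ≤ 16 * Z1 ^ 3 * (K * Z2 / c₁) * CD ^ 3 * X ^ 6 ∨
      ‖χ.LFunction s‖⁻¹ ≤ 2 / c * X ^ 1 ∨ ‖χ.LFunction s‖⁻¹ ≤ Z1 / c₁ * X ^ 2 by
    have hτε : 0 ≤ τ ^ ε := by positivity
    have p1 : 0 ≤ 32 * Z1 ^ 3 * CM * CD ^ 3 := by positivity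
    have p2 : 0 ≤ 16 * Z1 ^ 3 * (K * Z2 / c₁) * CD ^ 3 := by positivity
    have p3 : 0 ≤ 2 / c := by positivity
    have p4 : 0 ≤ Z1 / c₁ := by positivity
    have m1 := mul_le_mul_of_nonneg_left (hX6' 4 (by norm_num)) p1
    have m2 := mul_le_mul_of_nonneg_left (hX6' 6 (by norm_num)) p2
    have m3 := mul_le_mul_of_nonneg_left (hX6' 1 (by norm_num)) p3
    have m4 := mul_le_mul_of_nonneg_left (hX6' 2 (by norm_num)) p4
    have n1 := mul_nonneg p1 hτε
    have n2 := mul_nonneg p2 hτε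
    have n3 := mul_nonneg p3 hτε
    have n4 := mul_nonneg p4 hτε
    rw [add_mul, add_mul, add_mul]
    rcases hsuf with h | h | h | h <;> linarith
  have hZ1' := hZ1 q (1 : DirichletCharacter ℂ q)
  have hD : ∀ y : ℝ, 0 < y → y ≤ 1 → ‖deriv χ.LFunction (1 + y + Complex.I * t)‖ ≤ CD * X := by
    intro y hy hy1
    have h1 := hCD' q χ (1 + y + Complex.I * t) (by simp; linarith) (by simp; linarith)
      (h.imp_right fun h => by simpa using h)
    rw [iteratedDeriv_one] at h1
    refine h1.trans ?_
    have h2 : aCond q (1 + y + Complex.I * t) = τ := by simp [hτ, aCond, ht]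
    rw [h2]
    gcongr
    exact le_max_left _ _
  have hMgen : (χ ^ 2 ≠ 1 ∨ 1 / 4 ≤ |2 * t|) → ‖χ.LFunction s‖⁻¹ ≤
      32 * Z1 ^ 3 * CM * CD ^ 3 * X ^ 4 := by
    intro h'
    have hM : ∀ y : ℝ, 0 < y → y ≤ 1 → ‖(χ ^ 2).LFunction (1 + y + 2 * Complex.I * t)‖ ≤
        2 * CM * X := by
      intro y hy hy1
      have h1 := hCM' q (χ ^ 2) (1 + y + 2 * Complex.I * t) (by simp; linarith) (by simp; linarith)
        (h'.imp_right fun h => by simpa using h)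
      refine h1.trans ?_
      have h2 : aCond q (1 + y + 2 * Complex.I * t) ≤ 2 * τ := by
        refine hτ_mono _ ?_
        simp [abs_mul, ht]
      have h20 : 0 ≤ aCond q (1 + y + 2 * Complex.I * t) := by
        linarith [two_le_aCond q (1 + y + 2 * Complex.I * t)]
      calc CM' * aCond q (1 + y + 2 * Complex.I * t) ^ (2 * (e / 2)) ≤
            CM * (2 * τ) ^ (2 * (e / 2)) := by
            gcongr
            exact le_max_left _ _
        _ = CM * (2 ^ e * X) := by
            rw [mul_div_cancel₀ _ (by norm_num), Real.mul_rpow (by norm_num) hτ0.le]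
        _ ≤ CM * (2 ^ (1 : ℝ) * X) := by
            gcongr
            · norm_num
            · linarith
        _ = 2 * CM * X := by
            rw [Real.rpow_one]
            ring
    have h1 := inv_norm_LFunction_le_of_bounds χ hZ1' hZ11 (M := 2 * CM * X) (by nlinarith)
      (D := CD * X) (by nlinarith) hM hD hx0 hx1
    rw [← hs'] at h1
    refine h1.trans (le_of_eq ?_)
    ring
  by_cases hχ2 : χ ^ 2 ≠ 1
  · exact .inl (hMgen (.inl hχ2))
  rw [not_not] at hχ2
  by_cases ht4 : 1 / 4 ≤ |t|
  · refine .inl (hMgen (.inr ?_))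
    rw [abs_mul, abs_two]
    linarith
  have hχ1 : χ ≠ 1 := by
    rcases h with h | h
    · exact h
    · exact absurd (by linarith) ht4
  push Not at ht4
  set T := c₁ / X ^ 2 with hT
  have hT0 : 0 < T := by positivity
  by_cases htT : T ≤ |t|
  · have htpos : 0 < |t| := hT0.trans_le htT
    right; left
    have hM : ∀ y : ℝ, 0 < y → y ≤ 1 →
        ‖(χ ^ 2).LFunction (1 + y + 2 * Complex.I * t)‖ ≤ K * Z2 / c₁ * X ^ 3 := by
      intro y hy hy1
      rw [hχ2]
      refine (norm_LFunctionTrivChar_le_of_small hZ2 hy hy1 ht4.le (abs_pos.1 htpos)).trans ?_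
      calc (∏ _p ∈ q.primeFactors, 2) * (Z2 / |t|) ≤ (K * (q : ℝ) ^ e) * (Z2 / T) := by
            gcongr
            exact hK q (NeZero.ne q)
        _ ≤ (K * X) * (Z2 / T) := by gcongr
        _ = K * Z2 / c₁ * X ^ 3 := by
            rw [hT]
            field_simp
    have hKZ : 1 ≤ K * Z2 / c₁ := by
      rw [le_div_iff₀ hc₁0]
      nlinarith
    have h1 := inv_norm_LFunction_le_of_bounds χ hZ1' hZ11 (M := K * Z2 / c₁ * X ^ 3)
      (one_le_mul_of_one_le_of_one_le hKZ (one_le_pow₀ hX1))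
      (D := CD * X) (by nlinarith) hM hD hx0 hx1
    rw [← hs'] at h1
    refine h1.trans (le_of_eq ?_)
    ring
  push Not at htT
  by_cases hxT : x ≤ T
  · right; right; left
    set S : Set ℂ := {z | 1 ≤ z.re} ∩ ({z | z.re ≤ 2} ∩ {z | |z.im| ≤ 1 / 4}) with hS
    have hSc : Convex ℝ S := by
      refine (convex_halfSpace_re_ge 1).inter ((convex_halfSpace_re_le 2).inter ?_)
      have : {z : ℂ | |z.im| ≤ 1 / 4} = {z | -(1 / 4) ≤ z.im} ∩ {z | z.im ≤ 1 / 4} := by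
        ext z
        simp [abs_le]
      rw [this]
      exact (convex_halfSpace_im_ge _).inter (convex_halfSpace_im_le _)
    have h2 := norm_sub_le_of_deriv_le hSc (f := χ.LFunction) (fun z _ =>
      χ.differentiableAt_LFunction z (.inr hχ1)) (D := 2 * CD * X) (fun z hz => by
        have h1 := hCD' q χ z hz.1 hz.2.1 (.inl hχ1)
        rw [iteratedDeriv_one] at h1
        have h2 : aCond q z ≤ 2 * τ := by
          have h3 : |z.im| ≤ 1 / 4 := hz.2.2
          exact hτ_mono z (by linarith [abs_nonneg s.im])
        have h20 : 0 ≤ aCond q z := by linarith [two_le_aCond q z]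
        refine h1.trans ?_
        calc CD' * aCond q z ^ e ≤ CD * (2 * τ) ^ e := by
              gcongr
              exact le_max_left _ _
          _ = CD * (2 ^ e * X) := by rw [Real.mul_rpow (by norm_num) hτ0.le]
          _ ≤ CD * (2 ^ (1 : ℝ) * X) := by
              gcongr
              · norm_num
              · linarith
          _ = 2 * CD * X := by
              rw [Real.rpow_one]
              ring) (a := 1) (b := s) (by simp [hS])
      ⟨hs.le, hs2, ht4.le⟩
    have h3 : ‖s - 1‖ ≤ 2 * T := by
      have := Complex.norm_le_abs_re_add_abs_im (s - 1)
      rw [Complex.sub_re, Complex.sub_im, Complex.one_re, Complex.one_im, sub_zero,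
        abs_of_pos hx0] at this
      linarith
    have h4 := hc q χ hχ1 hχ2
    have h5 : c / X ≤ c * (q : ℝ) ^ (-e) := by
      rw [Real.rpow_neg (by linarith), ← div_eq_mul_inv]
      gcongr
    have h6 : 2 * CD * X * ‖s - 1‖ ≤ c / (2 * X) := by
      calc 2 * CD * X * ‖s - 1‖ ≤ 2 * CD * X * (2 * T) := by gcongr
        _ = 8 * CD * c₁ / (2 * X) := by
            rw [hT]
            field_simp
            norm_num
        _ ≤ c / (2 * X) := by gcongr
    have h7 : c / X = 2 * (c / (2 * X)) := by field_simp
    have h8 : c / (2 * X) ≤ ‖χ.LFunction s‖ := by linarith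
    have h9 : 2 / c * X ^ 1 = (c / (2 * X))⁻¹ := by
      rw [inv_div, pow_one]
      ring
    rw [h9]
    exact inv_anti₀ (by positivity) h8
  · right; right; right
    push Not at hxT
    have h1 := le_norm_pow_four χ hZ1' hx0 hx1 (M := Z1 / x) (by positivity) (t := t) (by
      have := hZ1 q (χ ^ 2) (1 + x + 2 * Complex.I * t) (by simpa using hx0) (by simp; linarith)
      simpa using this)
    rw [← hs'] at h1
    have h2 : x / Z1 ≤ ‖χ.LFunction s‖ := by
      refine le_of_pow_le_pow_left₀ (n := 4) (by norm_num) (norm_nonneg _)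
        (le_trans (le_of_eq ?_) h1)
      field_simp
    have h3 : T / Z1 ≤ ‖χ.LFunction s‖ := le_trans (by gcongr) h2
    have h9 : Z1 / c₁ * X ^ 2 = (T / Z1)⁻¹ := by
      rw [inv_div, hT]
      field_simp
    rw [h9]
    exact inv_anti₀ (by positivity) h3

lemma norm_inv_one_sub_cpow_le {p : ℕ} (hp : 2 ≤ p) {s : ℂ} (hs : 1 / 2 < s.re) :
    ‖(1 - (p : ℂ) ^ (-s))⁻¹‖ ≤ 4 := by
  have h1 : ‖(p : ℂ) ^ (-s)‖ ≤ 3 / 4 := by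
    rw [Complex.norm_natCast_cpow_of_pos (by omega), Complex.neg_re]
    calc (p : ℝ) ^ (-s.re) ≤ (p : ℝ) ^ (-(1 / 2) : ℝ) :=
          Real.rpow_le_rpow_of_exponent_le (by exact_mod_cast (by omega : 1 ≤ p)) (by linarith)
      _ ≤ 2 ^ (-(1 / 2) : ℝ) :=
          Real.rpow_le_rpow_of_nonpos (by norm_num) (by exact_mod_cast hp) (by norm_num)
      _ ≤ 3 / 4 := by
          rw [Real.rpow_neg (by norm_num), ← Real.sqrt_eq_rpow]
          refine inv_le_of_inv_le₀ (by norm_num) ?_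
          exact Real.le_sqrt_of_sq_le (by norm_num)
  have h2 := norm_sub_norm_le 1 ((p : ℂ) ^ (-s))
  rw [norm_one] at h2
  rw [norm_inv]
  exact inv_le_of_inv_le₀ (by norm_num) (by norm_num; linarith)

lemma norm_iteratedDeriv_inv_LFunctionTrivChar_le (k : ℕ) :
    ∃ C : ℝ, 0 < C ∧ ∀ (q : ℕ) [NeZero q] (s : ℂ), 1 < s.re → s.re ≤ 2 → |s.im| ≤ 1 / 2 →
      ‖iteratedDeriv k (fun z => ((1 : DirichletCharacter ℂ q).LFunction z)⁻¹) s‖ ≤ C * q := by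
  set S : Set ℂ := Set.Icc 1 2 ×ℂ Set.Icc (-(1 / 2)) (1 / 2) with hS
  have hSc : IsCompact S := isCompact_Icc.reProdIm isCompact_Icc
  set U : Set ℂ := {z | zetaOne z ≠ 0} ∩ {z | 1 / 2 < z.re} with hU
  have hUo : IsOpen U :=
    (isOpen_ne_fun differentiable_zetaOne.continuous continuous_const).inter
      (isOpen_lt continuous_const Complex.continuous_re)
  have hSU : S ⊆ U := by
    intro z hz
    have hz1 : 1 ≤ z.re := hz.1.1
    refine ⟨?_, by rw [Set.mem_ofPred_eq]; linarith⟩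
    rw [Set.mem_ofPred_eq]
    by_cases h : z = 1
    · rw [h, zetaOne_one]
      exact one_ne_zero
    · rw [zetaOne_apply h]
      exact mul_ne_zero (sub_ne_zero.2 h) (riemannZeta_ne_zero_of_one_le_re hz1)
  obtain ⟨r, hr, hrU⟩ := hSc.exists_cthickening_subset_open hUo hSU
  set W : ℂ → ℂ := fun z => (z - 1) / zetaOne z with hW
  have hWd : ∀ z ∈ U, DifferentiableAt ℂ W z := fun z hz =>
    DifferentiableAt.div (by fun_prop) (differentiable_zetaOne z) hz.1
  obtain ⟨C₁, hC₁⟩ := (hSc.cthickening (r := r)).exists_bound_of_continuousOn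
    (f := W) fun z hz => (hWd z (hrU hz)).continuousAt.continuousWithinAt
  obtain ⟨K, hK1, hK⟩ := prod_primeFactors_const_le (K := 4) (ε := 1) (by norm_num) one_pos
  refine ⟨k.factorial * (max C₁ 1 * K) / r ^ k, by positivity, fun q _ s hs hs2 ht => ?_⟩
  set E : ℂ → ℂ := fun z => ∏ p ∈ q.primeFactors, (1 - (p : ℂ) ^ (-z))⁻¹ with hE
  have hEd : ∀ z ∈ U, DifferentiableAt ℂ E z := by
    intro z hz
    refine DifferentiableAt.fun_finsetProd fun p hp => ?_
    have hp := Nat.prime_of_mem_primeFactors hp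
    have hpc : (p : ℂ) ≠ 0 := by exact_mod_cast hp.ne_zero
    refine DifferentiableAt.inv ?_ ?_
    · exact (differentiableAt_const _).sub
        (differentiableAt_id.neg.const_cpow (.inl hpc))
    · intro h
      have h1 : ‖(p : ℂ) ^ (-z)‖ = 1 := by
        rw [← sub_eq_zero.1 h, norm_one]
      rw [Complex.norm_natCast_cpow_of_pos hp.pos] at h1
      have hz2 : 1 / 2 < z.re := hz.2
      have := Real.rpow_lt_one_of_one_lt_of_neg (x := (p : ℝ)) (z := (-z).re)
        (by exact_mod_cast hp.one_lt) (by rw [Complex.neg_re]; linarith)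
      linarith
  have hEb : ∀ z ∈ U, ‖E z‖ ≤ K * q := by
    intro z hz
    rw [hE, norm_prod]
    refine (Finset.prod_le_prod (fun _ _ => norm_nonneg _) fun p hp =>
      norm_inv_one_sub_cpow_le (Nat.prime_of_mem_primeFactors hp).two_le hz.2).trans ?_
    simpa using hK q (NeZero.ne q)
  have heq : (fun z => ((1 : DirichletCharacter ℂ q).LFunction z)⁻¹) =ᶠ[nhds s]
      fun z => W z * E z := by
    filter_upwards [(isOpen_lt continuous_const Complex.continuous_re).mem_nhds hs] with z hz
    have hz1 : z ≠ 1 := by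
      rintro rfl
      simp at hz
    have h1 := DirichletCharacter.LFunctionTrivChar_eq_mul_riemannZeta (N := q) hz1
    rw [DirichletCharacter.LFunctionTrivChar] at h1
    simp only [h1, hW, hE, zetaOne_apply hz1]
    rw [mul_inv, prod_inv_distrib, div_mul_cancel_left₀ (sub_ne_zero.2 hz1), mul_comm]
  rw [heq.iteratedDeriv_eq]
  have hsS : s ∈ S := ⟨⟨hs.le, hs2⟩, abs_le.1 ht⟩
  have hsub : Metric.closedBall s r ⊆ U :=
    (Metric.closedBall_subset_cthickening hsS r).trans hrU
  have hd : DiffContOnCl ℂ (fun z => W z * E z) (Metric.ball s r) := by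
    refine DifferentiableOn.diffContOnCl fun z hz => ?_
    rw [closure_ball s hr.ne'] at hz
    exact ((hWd z (hsub hz)).mul (hEd z (hsub hz))).differentiableWithinAt
  refine (Complex.norm_iteratedDeriv_le_of_forall_mem_sphere_norm_le k hr hd
    (C := max C₁ 1 * (K * q)) fun z hz => ?_).trans (le_of_eq (by ring))
  have hz' := Metric.sphere_subset_closedBall hz
  rw [norm_mul]
  exact mul_le_mul ((hC₁ z (Metric.closedBall_subset_cthickening hsS r hz')).trans
    (le_max_left _ _)) (hEb z (hsub hz')) (norm_nonneg _) (by positivity)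

lemma LFunction_ne_zero_of_one_lt_re {q : ℕ} [NeZero q] (χ : DirichletCharacter ℂ q) {s : ℂ}
    (hs : 1 < s.re) : χ.LFunction s ≠ 0 :=
  χ.LFunction_ne_zero_of_one_le_re (.inr (by rintro rfl; simp at hs)) hs.le

lemma differentiableAt_LFunction_of_one_lt_re {q : ℕ} [NeZero q] (χ : DirichletCharacter ℂ q)
    {s : ℂ} (hs : 1 < s.re) : DifferentiableAt ℂ χ.LFunction s :=
  χ.differentiableAt_LFunction s (.inl (by rintro rfl; simp at hs))

lemma contDiffAt_LFunction {q : ℕ} [NeZero q] (χ : DirichletCharacter ℂ q) {s : ℂ}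
    (hs : 1 < s.re) {n : ℕ} : ContDiffAt ℂ n χ.LFunction s := by
  have hd : DifferentiableOn ℂ χ.LFunction {z | 1 < z.re} := fun z hz =>
    (differentiableAt_LFunction_of_one_lt_re χ hz).differentiableWithinAt
  exact (hd.analyticAt ((isOpen_lt continuous_const Complex.continuous_re).mem_nhds hs)).contDiffAt

lemma norm_iteratedDeriv_inv_LFunction_le (k : ℕ) {ε : ℝ} (hε : 0 < ε) :
    ∃ C : ℝ, 0 < C ∧ ∀ (q : ℕ) [NeZero q] (χ : DirichletCharacter ℂ q) (s : ℂ),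
      1 < s.re → s.re ≤ 2 → (χ ≠ 1 ∨ 1 / 2 ≤ |s.im|) →
        ‖iteratedDeriv k (fun z => (χ.LFunction z)⁻¹) s‖ ≤ C * aCond q s ^ ε := by
  induction k using Nat.strong_induction_on generalizing ε with
  | _ k ih =>
  rcases Nat.eq_zero_or_pos k with rfl | hk
  · obtain ⟨C, hC, h⟩ := inv_norm_LFunction_le hε
    refine ⟨C, hC, fun q _ χ s h1 h2 h3 => ?_⟩
    rw [iteratedDeriv_zero, norm_inv]
    exact h q χ s h1 h2 h3
  have hε3 : 0 < ε / 3 := by linarith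
  obtain ⟨C₀, hC₀, h₀⟩ := inv_norm_LFunction_le hε3
  choose! C₁ hC₁ h₁ using fun i (hi : i < k) => ih i hi hε3
  choose C₂ hC₂ h₂ using fun j => norm_iteratedDeriv_LFunction_le j hε3
  refine ⟨C₀ * ∑ i ∈ range k, k.choose i * C₁ i * C₂ (k - i),
    mul_pos hC₀ (sum_pos (fun i hi => ?_) ⟨0, by simpa using hk⟩), fun q _ χ s hs hs2 hχ => ?_⟩
  · have hi := mem_range.1 hi
    have := Nat.choose_pos hi.le
    have := hC₁ i hi
    have := hC₂ (k - i)
    positivity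
  set G : ℂ → ℂ := fun z => (χ.LFunction z)⁻¹ with hG
  have hL0 := LFunction_ne_zero_of_one_lt_re χ hs
  have hGL : iteratedDeriv k (G * χ.LFunction) s = 0 := by
    have heq : G * χ.LFunction =ᶠ[nhds s] fun _ => 1 := by
      filter_upwards [(isOpen_lt continuous_const Complex.continuous_re).mem_nhds hs] with z hz
      exact inv_mul_cancel₀ (LFunction_ne_zero_of_one_lt_re χ hz)
    rw [heq.iteratedDeriv_eq, iteratedDeriv_const, if_neg hk.ne']
  have hGd : ContDiffAt ℂ k G s := (contDiffAt_LFunction χ hs).inv hL0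
  rw [iteratedDeriv_mul hGd (contDiffAt_LFunction χ hs),
    sum_range_succ, Nat.choose_self, Nat.sub_self, iteratedDeriv_zero, Nat.cast_one, one_mul] at hGL
  have hsolve : iteratedDeriv k G s = -(χ.LFunction s)⁻¹ * ∑ i ∈ range k,
      k.choose i * iteratedDeriv i G s * iteratedDeriv (k - i) χ.LFunction s := by
    rw [eq_neg_of_add_eq_zero_left hGL]
    field_simp
  have hτ : 0 < aCond q s := by linarith [two_le_aCond q s]
  set X := aCond q s ^ (ε / 3) with hX
  have hX3 : aCond q s ^ ε = X * (X * X) := by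
    rw [hX, ← Real.rpow_add hτ, ← Real.rpow_add hτ]
    ring_nf
  rw [hsolve, norm_mul, norm_neg, norm_inv, hX3, mul_mul_mul_comm]
  refine mul_le_mul (h₀ q χ s hs hs2 hχ) ?_ (norm_nonneg _) (by positivity)
  refine (norm_sum_le _ _).trans ?_
  rw [sum_mul]
  refine sum_le_sum fun i hi => ?_
  have hi := mem_range.1 hi
  rw [norm_mul, norm_mul, Complex.norm_natCast]
  have e1 := h₁ i hi q χ s hs hs2 hχ
  have e2 := h₂ (k - i) q χ s hs.le hs2 hχ
  have := hC₁ i hi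
  calc _ ≤ (k.choose i : ℝ) * (C₁ i * X) * (C₂ (k - i) * X) := by gcongr
    _ = _ := by ring

theorem norm_iteratedDeriv_inv_LFunction_le_mul_sqrt (k : ℕ) :
    ∃ C : ℝ, 0 < C ∧ ∀ (q : ℕ) [NeZero q] (χ : DirichletCharacter ℂ q) (s : ℂ),
      1 < s.re → s.re ≤ 2 →
        ‖iteratedDeriv k (fun z => (χ.LFunction z)⁻¹) s‖ ≤ C * q * (|s.im| + 2) ^ (1 / 2 : ℝ) := by
  obtain ⟨C₁, hC₁, h₁⟩ := norm_iteratedDeriv_inv_LFunctionTrivChar_le k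
  obtain ⟨C₂, hC₂, h₂⟩ := norm_iteratedDeriv_inv_LFunction_le k (ε := 1 / 2) (by norm_num)
  refine ⟨C₁ + C₂, by positivity, fun q _ χ s hs hs2 => ?_⟩
  have hq1 : (1 : ℝ) ≤ q := by exact_mod_cast NeZero.one_le
  have ht := abs_nonneg s.im
  have hT : 1 ≤ (|s.im| + 2) ^ (1 / 2 : ℝ) := Real.one_le_rpow (by linarith) (by norm_num)
  rw [add_mul, add_mul]
  by_cases h : χ ≠ 1 ∨ 1 / 2 ≤ |s.im|
  · have e1 := h₂ q χ s hs hs2 h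
    rw [aCond, Real.mul_rpow (by linarith) (by linarith)] at e1
    have e2 : (q : ℝ) ^ (1 / 2 : ℝ) ≤ q := Real.rpow_le_self_of_one_le hq1 (by norm_num)
    have e3 : C₂ * ((q : ℝ) ^ (1 / 2 : ℝ) * (|s.im| + 2) ^ (1 / 2 : ℝ)) ≤
        C₂ * q * (|s.im| + 2) ^ (1 / 2 : ℝ) := by
      rw [mul_assoc]
      gcongr
    have e4 : 0 ≤ C₁ * q * (|s.im| + 2) ^ (1 / 2 : ℝ) := by positivity
    linarith
  · push Not at h
    obtain ⟨rfl, h⟩ := h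
    have e1 := h₁ q s hs hs2 h.le
    have e3 : C₁ * q ≤ C₁ * q * (|s.im| + 2) ^ (1 / 2 : ℝ) :=
      le_mul_of_one_le_right (by positivity) hT
    have e4 : 0 ≤ C₂ * q * (|s.im| + 2) ^ (1 / 2 : ℝ) := by positivity
    linarith

/-- The kernel `(1 - x)₊` used for smoothed sums. -/
noncomputable def fejerWeight (x : ℝ) : ℂ := ((max (1 - x) 0 : ℝ) : ℂ)

lemma hasMellin_fejerWeight {s : ℂ} (hs : 0 < s.re) :
    HasMellin fejerWeight s (1 / s - 1 / (s + 1)) := by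
  have h1 := hasMellin_one_Ioc hs
  have h2 := hasMellin_cpow_Ioc 1 (s := s) (by simp; linarith)
  have h3 := hasMellin_sub h1.1 h2.1
  rw [h1.2, h2.2] at h3
  have heq : Set.EqOn (fun t => (Set.Ioc (0 : ℝ) 1).indicator (fun _ => (1 : ℂ)) t -
      (Set.Ioc (0 : ℝ) 1).indicator (fun t : ℝ => (t : ℂ) ^ (1 : ℂ)) t) fejerWeight
          (Set.Ioi 0) := by
    intro t ht
    rw [Set.mem_Ioi] at ht
    simp only [fejerWeight]
    by_cases h : t ≤ 1
    · have hm : t ∈ Set.Ioc (0 : ℝ) 1 := ⟨ht, h⟩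
      rw [Set.indicator_of_mem hm, Set.indicator_of_mem hm,
        max_eq_left (by linarith), Complex.cpow_one]
      push_cast
      rfl
    · rw [Set.indicator_of_notMem (fun h' => h h'.2), Set.indicator_of_notMem (fun h' => h h'.2),
        max_eq_right (by linarith)]
      simp
  refine ⟨?_, ?_⟩
  · refine h3.1.congr_fun (fun t ht => ?_) measurableSet_Ioi
    simp only [heq ht]
  · rw [← h3.2, mellin, mellin]
    refine MeasureTheory.setIntegral_congr_fun measurableSet_Ioi fun t ht => ?_
    simp only [heq ht]

lemma norm_mellin_fejerWeight_le {c : ℝ} (hc : 1 ≤ c) (t : ℝ) :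
    ‖mellin fejerWeight (c + t * Complex.I)‖ ≤ (1 + t ^ 2)⁻¹ := by
  set s : ℂ := c + t * Complex.I with hs
  have hre : s.re = c := by simp [hs]
  have him : s.im = t := by simp [hs]
  have hs0 : s ≠ 0 := fun h => by rw [h] at hre; simp at hre; linarith
  have hs1 : s + 1 ≠ 0 := fun h => by
    have := congrArg Complex.re h
    rw [Complex.add_re, hre] at this
    simp at this
    linarith
  rw [(hasMellin_fejerWeight (s := s) (by linarith)).2]
  have h1 : 1 / s - 1 / (s + 1) = (s * (s + 1))⁻¹ := by
    field_simp
    ring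
  rw [h1, norm_inv]
  refine inv_anti₀ (by positivity) ?_
  have h2 : ‖s‖ ≤ ‖s + 1‖ := by
    refine le_of_pow_le_pow_left₀ (n := 2) (by norm_num) (norm_nonneg _) ?_
    rw [← Complex.normSq_eq_norm_sq, ← Complex.normSq_eq_norm_sq, Complex.normSq_apply,
      Complex.normSq_apply, Complex.add_re s, Complex.add_im s, hre, him]
    simp
    nlinarith
  calc 1 + t ^ 2 ≤ ‖s‖ ^ 2 := by
        rw [← Complex.normSq_eq_norm_sq, Complex.normSq_apply, hre, him]
        nlinarith
    _ = ‖s‖ * ‖s‖ := sq _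
    _ ≤ ‖s‖ * ‖s + 1‖ := by gcongr
    _ = _ := (norm_mul _ _).symm

lemma continuous_mellin_fejerWeight {c : ℝ} (hc : 1 ≤ c) :
    Continuous fun t : ℝ => mellin fejerWeight (c + t * Complex.I) := by
  have h : (fun t : ℝ => mellin fejerWeight (c + t * Complex.I)) =
      fun t : ℝ => 1 / (c + t * Complex.I) - 1 / (c + t * Complex.I + 1) := by
    ext t
    exact (hasMellin_fejerWeight (by simp; linarith)).2
  rw [h]
  refine (Continuous.div continuous_const (by fun_prop) fun t h => ?_).sub
    (Continuous.div continuous_const (by fun_prop) fun t h => ?_)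
  all_goals
    have := congrArg Complex.re h
    simp at this
    linarith

lemma integrable_mellin_fejerWeight {c : ℝ} (hc : 1 ≤ c) :
    MeasureTheory.Integrable fun t : ℝ => mellin fejerWeight (c + t * Complex.I) :=
  integrable_inv_one_add_sq.mono' (continuous_mellin_fejerWeight hc).aestronglyMeasurable
    (.of_forall (norm_mellin_fejerWeight_le hc))

lemma integral_cpow_mul_mellin_fejerWeight {c : ℝ} (hc : 1 ≤ c) {x : ℝ} (hx : 0 < x) :
    ∫ t : ℝ, (x : ℂ) ^ (-(c + t * Complex.I)) * mellin fejerWeight (c + t * Complex.I) =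
      2 * Real.pi * fejerWeight x := by
  have h := mellinInv_mellin_eq c fejerWeight hx
    (hasMellin_fejerWeight (s := c) (by simp; linarith)).1 (integrable_mellin_fejerWeight hc)
    (by unfold fejerWeight; fun_prop)
  rw [mellinInv, Complex.real_smul] at h
  simp only [smul_eq_mul] at h
  have hpi : (2 * Real.pi : ℂ) * ((1 / (2 * Real.pi) : ℝ) : ℂ) = 1 := by
    have := Real.pi_ne_zero
    push_cast
    field_simp
  rw [← h, ← mul_assoc, hpi, one_mul]

lemma integrable_sqrt_mul_inv_one_add_sq :
    MeasureTheory.Integrable fun t : ℝ => (|t| + 2) ^ (1 / 2 : ℝ) * (1 + t ^ 2)⁻¹ := by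
  have h := (integrable_rpow_neg_one_add_norm_sq (E := ℝ) (μ := MeasureTheory.volume)
    (r := 3 / 2) (by simp; norm_num)).const_mul 2
  refine h.mono' ?_ (.of_forall fun t => ?_)
  · refine Continuous.aestronglyMeasurable ?_
    refine Continuous.mul ?_ ?_
    · exact Continuous.rpow_const (by fun_prop) fun t => .inr (by norm_num)
    · exact Continuous.inv₀ (by fun_prop) fun t => by positivity
  · have h0 : 0 < 1 + t ^ 2 := by positivity
    rw [Real.norm_of_nonneg (by positivity), Real.norm_eq_abs, sq_abs]
    have h1 : (|t| + 2) ^ (1 / 2 : ℝ) ≤ 2 * (1 + t ^ 2) ^ (1 / 4 : ℝ) := by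
      refine le_of_pow_le_pow_left₀ (n := 4) (by norm_num) (by positivity) ?_
      rw [mul_pow, ← Real.rpow_mul_natCast (by positivity), ← Real.rpow_mul_natCast h0.le]
      norm_num
      rw [show |t| + 2 = |t| + 2 from rfl]
      nlinarith [sq_abs t, sq_nonneg (|t| - 2), sq_nonneg (|t| - 1)]
    calc _ ≤ 2 * (1 + t ^ 2) ^ (1 / 4 : ℝ) * (1 + t ^ 2)⁻¹ := by gcongr
      _ = 2 * ((1 + t ^ 2) ^ (1 / 4 : ℝ) * (1 + t ^ 2) ^ (-1 : ℝ)) := by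
          rw [Real.rpow_neg_one, mul_assoc]
      _ = _ := by
          rw [← Real.rpow_add h0]
          norm_num

/-- A bound for smoothed sums from a bound for the Dirichlet series on a vertical line. -/
theorem exists_norm_sum_mul_fejerWeight_le :
    ∃ C : ℝ, 0 < C ∧ ∀ (b : ℕ → ℂ) (c M : ℝ) (N : ℕ), 1 ≤ c → 1 ≤ N → LSeriesSummable b c →
      (∀ t : ℝ, ‖LSeries b (c + t * Complex.I)‖ ≤ M * (|t| + 2) ^ (1 / 2 : ℝ)) →
      ‖∑ n ∈ Icc 1 N, b n * fejerWeight (n / N)‖ ≤ C * M * (N : ℝ) ^ c := by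
  set I := ∫ t : ℝ, (|t| + 2) ^ (1 / 2 : ℝ) * (1 + t ^ 2)⁻¹ with hI
  have hI0 : 0 ≤ I := MeasureTheory.integral_nonneg fun t => by positivity
  refine ⟨I + 1, by linarith, fun b c M N hc hN hsum hM => ?_⟩
  have hM0 : 0 ≤ M := by
    have := (norm_nonneg _).trans (hM 0)
    exact nonneg_of_mul_nonneg_left this (by positivity)
  have hN0 : (0 : ℝ) < N := by exact_mod_cast hN
  have hNc : (N : ℂ) ≠ 0 := by exact_mod_cast hN0.ne'
  set K : ℝ → ℂ := fun t => mellin fejerWeight (c + t * Complex.I) with hK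
  set F : ℕ → ℝ → ℂ := fun n t => LSeries.term b (c + t * Complex.I) n *
    ((N : ℂ) ^ (c + t * Complex.I) * K t) with hF
  have hNn : ∀ t : ℝ, ‖(N : ℂ) ^ (c + t * Complex.I)‖ = (N : ℝ) ^ c := fun t => by
    rw [Complex.norm_natCast_cpow_of_pos (by omega)]
    simp
  have hFnorm : ∀ n t, ‖F n t‖ = ‖LSeries.term b c n‖ * (N : ℝ) ^ c * ‖K t‖ := by
    intro n t
    rw [hF]
    simp only
    rw [norm_mul, norm_mul, hNn, LSeries.norm_term_eq, LSeries.norm_term_eq]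
    simp [mul_assoc]
  have hKi := integrable_mellin_fejerWeight hc
  have hFi : ∀ n, MeasureTheory.Integrable (F n) := by
    intro n
    refine (hKi.norm.const_mul (‖LSeries.term b c n‖ * (N : ℝ) ^ c)).mono' ?_
      (.of_forall fun t => (hFnorm n t).le)
    refine Continuous.aestronglyMeasurable ?_
    refine Continuous.mul ?_ (Continuous.mul ?_ (continuous_mellin_fejerWeight hc))
    · rcases eq_or_ne n 0 with rfl | hn
      · simp only [LSeries.term_zero]
        exact continuous_const
      · simp only [LSeries.term_of_ne_zero hn]
        have hn' : (n : ℂ) ≠ 0 := by exact_mod_cast hn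
        exact continuous_const.div (Continuous.const_cpow (by fun_prop) (.inl hn'))
          fun t => by simp [Complex.cpow_eq_zero_iff, hn']
    · exact Continuous.const_cpow (by fun_prop) (.inl hNc)
  have hFs : Summable fun n => ∫ t, ‖F n t‖ := by
    simp only [hFnorm, MeasureTheory.integral_const_mul]
    exact (hsum.norm.mul_right _).mul_right _
  have hmain := MeasureTheory.hasSum_integral_of_summable_integral_norm hFi hFs
  have hint : ∀ n, ∫ t, F n t =
      if n ∈ Icc 1 N then 2 * Real.pi * (b n * fejerWeight (n / N)) else 0 := by
    intro n
    rcases Nat.eq_zero_or_pos n with rfl | hn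
    · simp [hF]
    have hn0 : (0 : ℝ) < n := by exact_mod_cast hn
    have h1 : ∫ t, F n t = 2 * Real.pi * (b n * fejerWeight (n / N)) := by
      rw [mul_left_comm, ← integral_cpow_mul_mellin_fejerWeight hc (x := n / N) (by positivity),
        ← MeasureTheory.integral_const_mul]
      congr 1
      ext t
      simp only [hF, LSeries.term_of_ne_zero hn.ne', hK]
      have h2 : (((n / N : ℝ)) : ℂ) ^ (-(c + t * Complex.I)) =
          (N : ℂ) ^ (c + t * Complex.I) / (n : ℂ) ^ (c + t * Complex.I) := by
        have h3 : ((n / N : ℝ) : ℂ) = ((n : ℝ) : ℂ) * (((N : ℝ)⁻¹ : ℝ) : ℂ) := by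
          push_cast
          rw [div_eq_mul_inv]
        rw [Complex.cpow_neg, h3, Complex.mul_cpow_ofReal_nonneg hn0.le (by positivity),
          Complex.ofReal_inv,
          Complex.inv_cpow _ _
              (by rw [Complex.ofReal_natCast, Complex.natCast_arg]; exact Real.pi_ne_zero.symm),
              mul_inv, inv_inv,
          Complex.ofReal_natCast, Complex.ofReal_natCast, mul_comm, div_eq_mul_inv]
      rw [h2]
      ring
    rw [h1]
    split_ifs with h
    · rfl
    · have : 1 ≤ (n : ℝ) / N := by
        rw [le_div_iff₀ hN0, one_mul]
        rw [mem_Icc] at h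
        exact_mod_cast (by omega : N ≤ n)
      rw [fejerWeight, max_eq_right (by linarith)]
      simp
  have htsum : ∀ t : ℝ, ∑' n, F n t =
      LSeries b (c + t * Complex.I) * ((N : ℂ) ^ (c + t * Complex.I) * K t) := by
    intro t
    simp only [hF]
    rw [tsum_mul_right, LSeries]
  have hval : 2 * Real.pi * ∑ n ∈ Icc 1 N, b n * fejerWeight (n / N) =
      ∫ t : ℝ, LSeries b (c + t * Complex.I) * ((N : ℂ) ^ (c + t * Complex.I) * K t) := by
    simp only [hint, htsum] at hmain
    rw [← hmain.tsum_eq, tsum_eq_sum (s := Icc 1 N) (fun n hn => by rw [if_neg hn]), mul_sum]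
    exact sum_congr rfl fun n hn => by rw [if_pos hn]
  have hbound : ‖∫ t : ℝ, LSeries b (c + t * Complex.I) * ((N : ℂ) ^ (c + t * Complex.I) * K t)‖ ≤
      M * (N : ℝ) ^ c * I := by
    rw [hI, ← MeasureTheory.integral_const_mul]
    refine MeasureTheory.norm_integral_le_of_norm_le
      (integrable_sqrt_mul_inv_one_add_sq.const_mul _) (.of_forall fun t => ?_)
    rw [norm_mul, norm_mul, hNn]
    calc _ ≤ M * (|t| + 2) ^ (1 / 2 : ℝ) * ((N : ℝ) ^ c * (1 + t ^ 2)⁻¹) := by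
          gcongr
          · exact hM t
          · exact norm_mellin_fejerWeight_le hc t
      _ = _ := by ring
  rw [← hval, norm_mul] at hbound
  have h2pi : 1 ≤ ‖(2 * Real.pi : ℂ)‖ := by
    rw [norm_mul, Complex.norm_real, Real.norm_of_nonneg Real.pi_pos.le]
    simp
    linarith [Real.pi_gt_three]
  calc _ ≤ M * (N : ℝ) ^ c * I := (le_mul_of_one_le_left (norm_nonneg _) h2pi).trans hbound
    _ ≤ M * (N : ℝ) ^ c * (I + 1) := by gcongr; linarith
    _ = _ := by ring

/-- Summation by parts: a sum with weights of bounded variation. -/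
lemma norm_sum_mul_le_of_norm_sum_le {w b : ℕ → ℂ} {R N : ℕ} (hRN : R < N) {B : ℝ}
    (hB : ∀ n, R < n → n ≤ N → ‖∑ i ∈ Ioc R n, b i‖ ≤ B) :
    ‖∑ i ∈ Ioc R N, w i * b i‖ ≤ B * (‖w N‖ + ∑ i ∈ Ico (R + 1) N, ‖w (i + 1) - w i‖) := by
  have key : ∀ n, R + 1 ≤ n → n ≤ N → ‖∑ i ∈ Ioc R n, w i * b i - w n * ∑ i ∈ Ioc R n, b i‖ ≤
      B * ∑ i ∈ Ico (R + 1) n, ‖w (i + 1) - w i‖ := by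
    intro n hn
    induction n, hn using Nat.le_induction with
    | base =>
      intro _
      simp
    | succ n hn ih =>
      intro hnN
      have h1 := ih (by omega)
      have h2 := hB n (by omega) (by omega)
      rw [sum_Ioc_succ_top (by omega), sum_Ioc_succ_top (by omega), sum_Ico_succ_top hn]
      have h3 : ∑ i ∈ Ioc R n, w i * b i + w (n + 1) * b (n + 1) -
          w (n + 1) * (∑ i ∈ Ioc R n, b i + b (n + 1)) =
          (∑ i ∈ Ioc R n, w i * b i - w n * ∑ i ∈ Ioc R n, b i) -
            (w (n + 1) - w n) * ∑ i ∈ Ioc R n, b i := by ring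
      rw [h3, mul_add]
      refine (norm_sub_le _ _).trans (add_le_add h1 ?_)
      rw [norm_mul, mul_comm]
      gcongr
  have h1 := key N hRN le_rfl
  have h2 := norm_sub_norm_le (∑ i ∈ Ioc R N, w i * b i) (w N * ∑ i ∈ Ioc R N, b i)
  have h3 : ‖w N * ∑ i ∈ Ioc R N, b i‖ ≤ B * ‖w N‖ := by
    rw [norm_mul, mul_comm]
    exact mul_le_mul_of_nonneg_right (hB N hRN le_rfl) (norm_nonneg _)
  rw [mul_add]
  linarith

lemma norm_sum_mul_le_of_antitone {w : ℕ → ℝ} {b : ℕ → ℂ} {R N : ℕ} (hRN : R < N) {B : ℝ}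
    (hB : ∀ n, R < n → n ≤ N → ‖∑ i ∈ Ioc R n, b i‖ ≤ B)
    (hw : ∀ n, R < n → w (n + 1) ≤ w n) (hwN : 0 ≤ w N) :
    ‖∑ i ∈ Ioc R N, (w i : ℂ) * b i‖ ≤ B * w (R + 1) := by
  refine (norm_sum_mul_le_of_norm_sum_le (w := fun i => (w i : ℂ)) hRN hB).trans (le_of_eq ?_)
  congr 1
  have h1 : ∑ i ∈ Ico (R + 1) N, ‖(w (i + 1) : ℂ) - w i‖ =
      ∑ i ∈ Ico (R + 1) N, (w i - w (i + 1)) := by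
    refine sum_congr rfl fun i hi => ?_
    rw [← Complex.ofReal_sub, Complex.norm_real, Real.norm_eq_abs, abs_sub_comm, abs_of_nonneg]
    linarith [hw i (by have := (mem_Ico.1 hi).1; omega)]
  have h2 := sum_Ico_sub w (show R + 1 ≤ N from hRN)
  have h3 : ∑ i ∈ Ico (R + 1) N, (w i - w (i + 1)) = w (R + 1) - w N := by
    rw [← neg_inj, ← sum_neg_distrib, neg_sub, ← h2]
    exact sum_congr rfl fun i _ => by ring
  rw [h1, h3, Complex.norm_real, Real.norm_of_nonneg hwN]
  ring

/-- The coefficients `μ(n) χ(n) (log n) ^ k`. -/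
noncomputable def moebiusCharLog {q : ℕ} (χ : DirichletCharacter ℂ q) (k n : ℕ) : ℂ :=
  (Real.log n : ℂ) ^ k * (χ n * ArithmeticFunction.moebius n)

lemma norm_moebiusCharLog_le {q : ℕ} (χ : DirichletCharacter ℂ q) (k n : ℕ) :
    ‖moebiusCharLog χ k n‖ ≤ Real.log n ^ k := by
  have h1 : ‖(ArithmeticFunction.moebius n : ℂ)‖ ≤ 1 := by
    rw [Complex.norm_intCast]
    exact_mod_cast abs_moebius_le_one
  have h0 : 0 ≤ Real.log n := Real.log_natCast_nonneg n
  rw [moebiusCharLog, norm_mul, norm_pow, Complex.norm_real, Real.norm_of_nonneg h0, norm_mul]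
  exact mul_le_of_le_one_right (by positivity)
    (mul_le_one₀ (χ.norm_le_one _) (norm_nonneg _) h1)

lemma logMul_iterate_eq (a : ℕ → ℂ) (k n : ℕ) :
    LSeries.logMul^[k] a n = (Real.log n : ℂ) ^ k * a n := by
  induction k generalizing a with
  | zero => simp
  | succ k ih =>
    rw [Function.iterate_succ_apply, ih, LSeries.logMul, pow_succ, ← Complex.natCast_log]
    ring

lemma LSeries_moebiusCharLog {q : ℕ} [NeZero q] (χ : DirichletCharacter ℂ q) (k : ℕ) {s : ℂ}
    (hs : 1 < s.re) : LSeriesSummable (moebiusCharLog χ k) s ∧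
      ‖LSeries (moebiusCharLog χ k) s‖ = ‖iteratedDeriv k (fun z => (χ.LFunction z)⁻¹) s‖ := by
  set a : ℕ → ℂ := (fun n : ℕ => χ n) * (fun n : ℕ => (ArithmeticFunction.moebius n : ℂ)) with ha
  have hab : LSeries.abscissaOfAbsConv a ≤ 1 := by
    refine LSeries.abscissaOfAbsConv_le_of_le_const ⟨1, fun n _ => ?_⟩
    simpa [moebiusCharLog, ha] using norm_moebiusCharLog_le χ 0 n
  have hlt : ∀ z : ℂ, 1 < z.re → LSeries.abscissaOfAbsConv a < z.re := fun z hz =>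
    hab.trans_lt (by exact_mod_cast hz)
  have heq : LSeries.logMul^[k] a = moebiusCharLog χ k := by
    ext n
    rw [logMul_iterate_eq]
    rfl
  have h1 := LSeries_iteratedDeriv k (hlt s hs)
  rw [heq] at h1
  constructor
  · rw [← heq]
    refine LSeriesSummable_of_abscissaOfAbsConv_lt_re ?_
    rw [LSeries.absicssaOfAbsConv_logPowMul]
    exact hlt s hs
  · have h2 : (fun z => (χ.LFunction z)⁻¹) =ᶠ[nhds s] LSeries a := by
      filter_upwards [(isOpen_lt continuous_const Complex.continuous_re).mem_nhds hs] with z hz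
      rw [χ.LFunction_eq_LSeries hz]
      exact inv_eq_of_mul_eq_one_right (DirichletCharacter.LSeries.mul_mu_eq_one χ hz)
    rw [h2.iteratedDeriv_eq, h1, norm_mul, norm_pow, norm_neg, norm_one, one_pow, one_mul]

lemma exists_norm_sum_moebiusCharLog_mul_fejerWeight_le (k : ℕ) :
    ∃ C : ℝ, 0 < C ∧ ∀ (q : ℕ) [NeZero q] (χ : DirichletCharacter ℂ q) (N : ℕ), 3 ≤ N →
      ‖∑ n ∈ Icc 1 N, moebiusCharLog χ k n * fejerWeight (n / N)‖ ≤ C * q * N := by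
  obtain ⟨C₁, hC₁, h₁⟩ := exists_norm_sum_mul_fejerWeight_le
  obtain ⟨C₂, hC₂, h₂⟩ := norm_iteratedDeriv_inv_LFunction_le_mul_sqrt k
  refine ⟨C₁ * C₂ * Real.exp 1, by positivity, fun q _ χ N hN => ?_⟩
  have hN3 : (3 : ℝ) ≤ N := by exact_mod_cast hN
  have hlog : 1 < Real.log N := by
    rw [Real.lt_log_iff_exp_lt (by linarith)]
    linarith [Real.exp_one_lt_d9]
  set c : ℝ := 1 + 1 / Real.log N with hc
  have hc1 : 1 < c := by
    have : 0 < 1 / Real.log N := by positivity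
    linarith
  have hc2 : c ≤ 2 := by
    have : 1 / Real.log N ≤ 1 := by
      rw [div_le_one (by linarith)]
      exact hlog.le
    linarith
  refine (h₁ (moebiusCharLog χ k) c (C₂ * q) N hc1.le (by omega)
    (LSeries_moebiusCharLog χ k (by simpa using hc1)).1 fun t => ?_).trans (le_of_eq ?_)
  · rw [(LSeries_moebiusCharLog χ k (by simpa using hc1)).2]
    simpa using h₂ q χ (c + t * Complex.I) (by simpa using hc1) (by simpa using hc2)
  · have : (N : ℝ) ^ c = N * Real.exp 1 := by
      rw [hc, Real.rpow_add (by linarith), Real.rpow_one, Real.rpow_def_of_pos (by linarith)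
        (1 / _),
        mul_one_div_cancel (by linarith)]
    rw [this]
    ring

lemma natCast_mul_sum_mul_fejerWeight (b : ℕ → ℂ) {N : ℕ} (hN : 1 ≤ N) :
    (N : ℂ) * ∑ n ∈ Icc 1 N, b n * fejerWeight (n / N) = ∑ n ∈ Icc 1 N, b n * ((N : ℂ) - n) := by
  have hN0 : (0 : ℝ) < N := by exact_mod_cast hN
  have hNc : (N : ℂ) ≠ 0 := by exact_mod_cast hN0.ne'
  rw [mul_sum]
  refine sum_congr rfl fun n hn => ?_
  have : (n : ℝ) / N ≤ 1 := by
    rw [div_le_one hN0]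
    exact_mod_cast (mem_Icc.1 hn).2
  rw [fejerWeight, max_eq_left (by linarith)]
  push_cast
  field_simp

lemma Icc_one_eq_Ioc_zero (N : ℕ) : Icc 1 N = Ioc 0 N := by
  ext n
  simp [Nat.succ_le_iff]

/-- Passing from smoothed sums to sharp sums. -/
lemma norm_sum_le_of_norm_sum_mul_fejerWeight_le {b : ℕ → ℂ} {D B : ℝ} {N H : ℕ} (hN : 3 ≤ N)
    (hD : ∀ n : ℕ, 3 ≤ n → ‖∑ i ∈ Icc 1 n, b i * fejerWeight (i / n)‖ ≤ D * n)
    (hB : ∀ n ≤ 2 * N, ‖b n‖ ≤ B) (hH : 1 ≤ H) (hHN : H ≤ N) :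
    ‖∑ n ∈ Icc 1 N, b n‖ ≤ 5 * D * (N / H) * N + H * B := by
  have hH0 : (0 : ℝ) < H := by exact_mod_cast hH
  have hN0 : (0 : ℝ) < N := by exact_mod_cast (by omega : 0 < N)
  have hHN' : (H : ℝ) ≤ N := by exact_mod_cast hHN
  have hD0 : 0 ≤ D := by
    have := (norm_nonneg _).trans (hD 3 le_rfl)
    push_cast at this
    linarith
  have hT : ∀ n : ℕ, 3 ≤ n → ‖∑ i ∈ Icc 1 n, b i * ((n : ℂ) - i)‖ ≤ D * n ^ 2 := by
    intro n hn
    rw [← natCast_mul_sum_mul_fejerWeight b (by omega), norm_mul, Complex.norm_natCast]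
    calc (n : ℝ) * _ ≤ n * (D * n) := by
          gcongr
          exact hD n hn
      _ = _ := by ring
  have h1 := hT N hN
  have h2 := hT (N + H) (by omega)
  have h2' : D * ((N + H : ℕ) : ℝ) ^ 2 ≤ D * (2 * N) ^ 2 := by
    gcongr
    push_cast
    linarith
  have h3 : ‖∑ n ∈ Ioc N (N + H), b n * (((N + H : ℕ) : ℂ) - n)‖ ≤ H * (B * H) := by
    calc _ ≤ ∑ n ∈ Ioc N (N + H), B * H := by
          refine norm_sum_le_of_le _ fun n hn => ?_
          rw [mem_Ioc] at hn
          rw [norm_mul]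
          have hb := hB n (by omega)
          gcongr
          · exact (norm_nonneg _).trans hb
          · rw [← Nat.cast_sub hn.2, Complex.norm_natCast]
            exact_mod_cast (by omega : N + H - n ≤ H)
      _ = _ := by simp
  have h4 : (H : ℂ) * ∑ n ∈ Icc 1 N, b n = ∑ i ∈ Icc 1 (N + H), b i * (((N + H : ℕ) : ℂ) - i) -
      ∑ i ∈ Icc 1 N, b i * ((N : ℂ) - i) - ∑ n ∈ Ioc N (N + H), b n * (((N + H : ℕ) : ℂ) - n) := by
    rw [Icc_one_eq_Ioc_zero, Icc_one_eq_Ioc_zero, ← sum_Ioc_consecutive _ (Nat.zero_le N)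
      (Nat.le_add_right N H), sub_right_comm, add_sub_cancel_right, ← sum_sub_distrib, mul_sum]
    refine sum_congr rfl fun n _ => ?_
    push_cast
    ring
  have h5 : H * ‖∑ n ∈ Icc 1 N, b n‖ ≤ 5 * D * N ^ 2 + H * (B * H) := by
    have e1 := congrArg norm h4
    rw [norm_mul, Complex.norm_natCast] at e1
    rw [e1]
    have e2 := norm_sub_le (∑ i ∈ Icc 1 (N + H), b i * (((N + H : ℕ) : ℂ) - i) -
      ∑ i ∈ Icc 1 N, b i * ((N : ℂ) - i)) (∑ n ∈ Ioc N (N + H), b n * (((N + H : ℕ) : ℂ) - n))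
    have e3 := norm_sub_le (∑ i ∈ Icc 1 (N + H), b i * (((N + H : ℕ) : ℂ) - i))
      (∑ i ∈ Icc 1 N, b i * ((N : ℂ) - i))
    linarith
  rw [← mul_le_mul_iff_right₀ hH0]
  refine h5.trans (le_of_eq ?_)
  field_simp

lemma one_lt_log_of_three_le {N : ℕ} (hN : 3 ≤ N) : 1 < Real.log N := by
  have hN3 : (3 : ℝ) ≤ N := by exact_mod_cast hN
  rw [Real.lt_log_iff_exp_lt (by linarith)]
  linarith [Real.exp_one_lt_d9]

lemma log_pow_le_factorial_mul {N : ℕ} (hN : 1 ≤ N) (m : ℕ) :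
    Real.log N ^ m ≤ m.factorial * N := by
  have hN0 : (0 : ℝ) < N := by exact_mod_cast hN
  have h := Real.pow_div_factorial_le_exp (Real.log N) (Real.log_natCast_nonneg N) m
  rwa [Real.exp_log hN0, div_le_iff₀ (by positivity), mul_comm] at h

lemma exists_norm_sum_moebiusCharLog_le (m : ℕ) :
    ∃ C : ℝ, 0 < C ∧ ∀ (q : ℕ) [NeZero q] (χ : DirichletCharacter ℂ q) (N : ℕ), 3 ≤ N →
      ‖∑ n ∈ Icc 1 N, moebiusCharLog χ (2 * m) n‖ ≤ C * q * N * Real.log N ^ m := by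
  obtain ⟨C, hC, h⟩ := exists_norm_sum_moebiusCharLog_mul_fejerWeight_le (2 * m)
  refine ⟨5 * C + (1 + m.factorial) * 4 ^ m, by positivity, fun q _ χ N hN => ?_⟩
  have hq1 : (1 : ℝ) ≤ q := by exact_mod_cast NeZero.one_le
  have hN0 : (0 : ℝ) < N := by exact_mod_cast (by omega : 0 < N)
  have hN3 : (3 : ℝ) ≤ N := by exact_mod_cast hN
  set L := Real.log N with hL
  have hL1 : 1 < L := one_lt_log_of_three_le hN
  have hLm : 1 ≤ L ^ m := one_le_pow₀ hL1.le
  set H := ⌈(N : ℝ) / L ^ m⌉₊ with hH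
  have hH1 : 1 ≤ H := Nat.ceil_pos.2 (by positivity)
  have hHN : H ≤ N := Nat.ceil_le.2 (div_le_self hN0.le hLm)
  have hH0 : (0 : ℝ) < H := by exact_mod_cast hH1
  have hB : ∀ n ≤ 2 * N, ‖moebiusCharLog χ (2 * m) n‖ ≤ (2 * L) ^ (2 * m) := by
    intro n hn
    refine (norm_moebiusCharLog_le χ (2 * m) n).trans ?_
    rcases Nat.eq_zero_or_pos n with rfl | hn0
    · rw [Nat.cast_zero, Real.log_zero]
      exact pow_le_pow_left₀ le_rfl (by linarith) _
    refine pow_le_pow_left₀ (Real.log_natCast_nonneg n) ?_ _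
    have h1 : (n : ℝ) ≤ N ^ 2 := by
      have : (n : ℝ) ≤ 2 * N := by exact_mod_cast hn
      nlinarith
    have h2 := Real.log_le_log (by exact_mod_cast hn0) h1
    rwa [Real.log_pow, Nat.cast_ofNat] at h2
  have h1 := norm_sum_le_of_norm_sum_mul_fejerWeight_le hN (fun n hn => h q χ n hn) hB hH1 hHN
  have h2 : (N : ℝ) / H ≤ L ^ m := by
    rw [div_le_iff₀ hH0, mul_comm, ← div_le_iff₀ (by positivity)]
    exact Nat.le_ceil _
  have h3 : (H : ℝ) ≤ (1 + m.factorial) * (N / L ^ m) := by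
    have e1 := (Nat.ceil_lt_add_one (show 0 ≤ (N : ℝ) / L ^ m by positivity)).le
    have e2 : 1 ≤ m.factorial * (N / L ^ m) := by
      rw [mul_div_assoc', le_div_iff₀ (by positivity), one_mul]
      exact log_pow_le_factorial_mul (by omega) m
    rw [← hH] at e1
    linarith
  calc _ ≤ 5 * (C * q) * (N / H) * N + H * (2 * L) ^ (2 * m) := h1
    _ ≤ 5 * (C * q) * L ^ m * N + (1 + m.factorial) * (N / L ^ m) * (2 * L) ^ (2 * m) := by gcongr
    _ = 5 * C * q * N * L ^ m + (1 + m.factorial) * 4 ^ m * 1 * N * L ^ m := by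
        have : (2 * L) ^ (2 * m) = 4 ^ m * (L ^ m * L ^ m) := by
          rw [pow_mul, mul_pow, mul_pow, ← mul_pow L L, ← sq]
          norm_num
        rw [this]
        field_simp
    _ ≤ 5 * C * q * N * L ^ m + (1 + m.factorial) * 4 ^ m * q * N * L ^ m := by gcongr
    _ = _ := by ring

/-- The Siegel-Walfisz bound for the Möbius function twisted by a Dirichlet character. -/
theorem exists_norm_sum_char_mul_moebius_le (m : ℕ) :
    ∃ C : ℝ, 0 < C ∧ ∀ (q : ℕ) [NeZero q] (χ : DirichletCharacter ℂ q) (N : ℕ), 2 ≤ N →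
      ‖∑ n ∈ Icc 1 N, χ n * (ArithmeticFunction.moebius n : ℂ)‖ ≤ C * q * (N / Real.log N ^ m) := by
  obtain ⟨C, hC, h⟩ := exists_norm_sum_moebiusCharLog_le m
  refine ⟨3 ^ m + (2 * m).factorial + 2 * C * 4 ^ m, by positivity, fun q _ χ N hN => ?_⟩
  have hq1 : (1 : ℝ) ≤ q := by exact_mod_cast NeZero.one_le
  have hN0 : (0 : ℝ) < N := by exact_mod_cast (by omega : 0 < N)
  have hN2 : (2 : ℝ) ≤ N := by exact_mod_cast hN
  set L := Real.log N with hL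
  have hL0 : 0 < L := Real.log_pos (by linarith)
  have htriv : ∀ R : ℕ, ‖∑ n ∈ Icc 1 R, χ n * (ArithmeticFunction.moebius n : ℂ)‖ ≤ R := by
    intro R
    calc _ ≤ ∑ n ∈ Icc 1 R, (1 : ℝ) := norm_sum_le_of_le _ fun n _ => by
          simpa [moebiusCharLog] using norm_moebiusCharLog_le χ 0 n
      _ = R := by simp
  have hX0 : 0 ≤ (N : ℝ) / L ^ m := by positivity
  have hX : (N : ℝ) / L ^ m ≤ q * (N / L ^ m) := le_mul_of_one_le_left hX0 hq1
  by_cases hN9 : N < 9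
  · have h1 : L ≤ 3 := by
      have e1 : (N : ℝ) ≤ 8 := by exact_mod_cast (by omega : N ≤ 8)
      have e2 := Real.log_le_log hN0 e1
      have e3 : Real.log 8 = 3 * Real.log 2 := by
        rw [show (8 : ℝ) = 2 ^ 3 by norm_num, Real.log_pow]
        norm_num
      linarith [Real.log_two_lt_d9]
    have h2 : (N : ℝ) ≤ 3 ^ m * (N / L ^ m) := by
      rw [mul_div_assoc', le_div_iff₀ (by positivity), mul_comm]
      gcongr
    calc _ ≤ (N : ℝ) := htriv N
      _ ≤ 3 ^ m * (N / L ^ m) := h2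
      _ ≤ 3 ^ m * (q * (N / L ^ m)) := by gcongr
      _ ≤ (3 ^ m + (2 * m).factorial + 2 * C * 4 ^ m) * (q * (N / L ^ m)) := by
          gcongr
          have : 0 ≤ 2 * C * 4 ^ m := by positivity
          have : (0 : ℝ) ≤ (2 * m).factorial := by positivity
          linarith
      _ = _ := by ring
  push Not at hN9
  set R := Nat.sqrt N with hR
  have hR3 : 3 ≤ R := Nat.le_sqrt.2 hN9
  have hR2 : R * R ≤ N := Nat.sqrt_le N
  have hRN : R < N := by nlinarith
  have hlog : L / 2 ≤ Real.log ((R + 1 : ℕ) : ℝ) := by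
    have e1 : (N : ℝ) ≤ ((R + 1 : ℕ) : ℝ) ^ 2 := by
      rw [sq]
      exact_mod_cast (Nat.lt_succ_sqrt N).le
    have e2 := Real.log_le_log hN0 e1
    rw [Real.log_pow, Nat.cast_ofNat, ← hL] at e2
    linarith
  have h1 : (R : ℝ) ≤ (2 * m).factorial * (N / L ^ m) := by
    rw [mul_div_assoc', le_div_iff₀ (by positivity)]
    refine le_of_pow_le_pow_left₀ (n := 2) (by norm_num) (by positivity) ?_
    have e1 := log_pow_le_factorial_mul (N := N) (by omega) (2 * m)
    have e2 : (R : ℝ) * R ≤ N := by exact_mod_cast hR2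
    have e3 : (1 : ℝ) ≤ (2 * m).factorial := by exact_mod_cast Nat.factorial_pos _
    calc ((R : ℝ) * L ^ m) ^ 2 = (R * R) * L ^ (2 * m) := by ring
      _ ≤ N * ((2 * m).factorial * N) := by gcongr
      _ ≤ N * ((2 * m).factorial * N) * (2 * m).factorial :=
            le_mul_of_one_le_right (by positivity) e3
      _ = _ := by ring
  have h2 : ∀ n, R < n → n ≤ N → ‖∑ i ∈ Ioc R n, moebiusCharLog χ (2 * m) i‖ ≤
      2 * (C * q * N * L ^ m) := by
    have e1 : ∀ n, 3 ≤ n → n ≤ N → ‖∑ i ∈ Ioc 0 n, moebiusCharLog χ (2 * m) i‖ ≤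
        C * q * N * L ^ m := by
      intro n hn hnN
      rw [← Icc_one_eq_Ioc_zero]
      refine (h q χ n hn).trans ?_
      have f1 : (n : ℝ) ≤ N := by exact_mod_cast hnN
      have f0 : (0 : ℝ) < n := by exact_mod_cast (by omega : 0 < n)
      have f2 := Real.log_natCast_nonneg n
      have f3 : Real.log n ≤ L := Real.log_le_log f0 f1
      gcongr
    intro n hn hnN
    have e2 := sum_Ioc_consecutive (moebiusCharLog χ (2 * m)) (Nat.zero_le R) hn.le
    rw [← eq_sub_iff_add_eq'] at e2
    rw [e2]
    have := norm_sub_le (∑ i ∈ Ioc 0 n, moebiusCharLog χ (2 * m) i)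
      (∑ i ∈ Ioc 0 R, moebiusCharLog χ (2 * m) i)
    have := e1 n (by omega) hnN
    have := e1 R hR3 hRN.le
    linarith
  have hlogpos : ∀ n : ℕ, R < n → 0 < Real.log n := fun n hn =>
    Real.log_pos (by exact_mod_cast (by omega : 1 < n))
  have h3 := norm_sum_mul_le_of_antitone (w := fun n => (Real.log n ^ (2 * m))⁻¹) hRN h2
    (fun n hn => by
      have e0 := hlogpos n hn
      have e1 : (0 : ℝ) < n := by exact_mod_cast (by omega : 0 < n)
      push_cast
      gcongr
      linarith) (by have := hlogpos N hRN; positivity)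
  have h4 : ∑ i ∈ Ioc R N, (((Real.log i ^ (2 * m))⁻¹ : ℝ) : ℂ) * moebiusCharLog χ (2 * m) i =
      ∑ i ∈ Ioc R N, χ i * (ArithmeticFunction.moebius i : ℂ) := by
    refine sum_congr rfl fun i hi => ?_
    have e0 : (Real.log i : ℂ) ≠ 0 := by exact_mod_cast (hlogpos i (mem_Ioc.1 hi).1).ne'
    rw [moebiusCharLog, Complex.ofReal_inv, Complex.ofReal_pow,
      inv_mul_cancel_left₀ (pow_ne_zero _ e0)]
  rw [h4] at h3
  have h5 : 2 * (C * q * N * L ^ m) * (Real.log ((R + 1 : ℕ) : ℝ) ^ (2 * m))⁻¹ ≤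
      2 * C * 4 ^ m * (q * (N / L ^ m)) := by
    calc _ ≤ 2 * (C * q * N * L ^ m) * ((L / 2) ^ (2 * m))⁻¹ := by gcongr
      _ = _ := by
        have : (L / 2) ^ (2 * m) = L ^ m * L ^ m / 4 ^ m := by
          rw [pow_mul, div_pow, div_pow, ← mul_pow L L, ← sq]
          norm_num
        rw [this]
        field_simp
  rw [Icc_one_eq_Ioc_zero, ← sum_Ioc_consecutive _ (Nat.zero_le R) hRN.le, ← Icc_one_eq_Ioc_zero]
  refine (norm_add_le _ _).trans ?_
  have h6 := htriv R
  have h7 : ((2 * m).factorial : ℝ) * (N / L ^ m) ≤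
      (2 * m).factorial * (q * (N / L ^ m)) := by gcongr
  have h8 : 0 ≤ (3 : ℝ) ^ m * (q * (N / L ^ m)) := by positivity
  rw [mul_assoc, add_mul, add_mul]
  linarith

/-- A version of the Siegel-Walfisz bound uniform in the length of the sum. -/
lemma exists_norm_sum_char_mul_moebius_le_of_le (m : ℕ) :
    ∃ C : ℝ, 0 < C ∧ ∀ (q : ℕ) [NeZero q] (χ : DirichletCharacter ℂ q) (N M : ℕ), 2 ≤ N → M ≤ N →
      ‖∑ n ∈ Icc 1 M, χ n * (ArithmeticFunction.moebius n : ℂ)‖ ≤ C * q * (N / Real.log N ^ m) := by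
  obtain ⟨C, hC, h⟩ := exists_norm_sum_char_mul_moebius_le m
  refine ⟨(2 * m).factorial + C * 2 ^ m + 1, by positivity, fun q _ χ N M hN hMN => ?_⟩
  have hq1 : (1 : ℝ) ≤ q := by exact_mod_cast NeZero.one_le
  have hN0 : (0 : ℝ) < N := by exact_mod_cast (by omega : 0 < N)
  have hN2 : (2 : ℝ) ≤ N := by exact_mod_cast hN
  have hMN' : (M : ℝ) ≤ N := by exact_mod_cast hMN
  set L := Real.log N with hL
  have hL0 : 0 < L := Real.log_pos (by linarith)
  have hX0 : 0 ≤ (N : ℝ) / L ^ m := by positivity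
  have htriv : ‖∑ n ∈ Icc 1 M, χ n * (ArithmeticFunction.moebius n : ℂ)‖ ≤ M := by
    calc _ ≤ ∑ n ∈ Icc 1 M, (1 : ℝ) := norm_sum_le_of_le _ fun n _ => by
          simpa [moebiusCharLog] using norm_moebiusCharLog_le χ 0 n
      _ = M := by simp
  have p1 : 0 ≤ ((2 * m).factorial : ℝ) * (q * (N / L ^ m)) := by positivity
  have p2 : 0 ≤ C * 2 ^ m * (q * (N / L ^ m)) := by positivity
  have p3 : 0 ≤ 1 * (q * (N / L ^ m)) := by positivity
  rw [mul_assoc, add_mul, add_mul]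
  have hsmall : M * M ≤ N → (M : ℝ) ≤ (2 * m).factorial * (q * (N / L ^ m)) := by
    intro hMM
    calc (M : ℝ) ≤ (2 * m).factorial * (N / L ^ m) := by
          rw [mul_div_assoc', le_div_iff₀ (by positivity)]
          refine le_of_pow_le_pow_left₀ (n := 2) (by norm_num) (by positivity) ?_
          have e1 := log_pow_le_factorial_mul (N := N) (by omega) (2 * m)
          have e2 : (M : ℝ) * M ≤ N := by exact_mod_cast hMM
          have e3 : (1 : ℝ) ≤ (2 * m).factorial := by exact_mod_cast Nat.factorial_pos _
          calc ((M : ℝ) * L ^ m) ^ 2 = (M * M) * L ^ (2 * m) := by ring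
            _ ≤ N * ((2 * m).factorial * N) := by gcongr
            _ ≤ N * ((2 * m).factorial * N) * (2 * m).factorial :=
                le_mul_of_one_le_right (by positivity) e3
            _ = _ := by ring
      _ ≤ _ := by
          gcongr
          exact le_mul_of_one_le_left hX0 hq1
  by_cases hMM : M * M ≤ N
  · linarith [hsmall hMM]
  · have hM2 : 2 ≤ M := by
      by_contra! hM
      have : M * M ≤ 1 * 1 := Nat.mul_le_mul (by omega) (by omega)
      omega
    have hM0 : (0 : ℝ) < M := by exact_mod_cast (by omega : 0 < M)
    have hlog : L / 2 ≤ Real.log M := by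
      have e1 : (N : ℝ) ≤ (M : ℝ) ^ 2 := by
        rw [sq]
        exact_mod_cast (by omega : N ≤ M * M)
      have e2 := Real.log_le_log hN0 e1
      rw [Real.log_pow, Nat.cast_ofNat, ← hL] at e2
      linarith
    have h1 := h q χ M hM2
    have h2 : C * q * (M / Real.log M ^ m) ≤ C * 2 ^ m * (q * (N / L ^ m)) := by
      calc C * q * (M / Real.log M ^ m) ≤ C * q * (N / (L / 2) ^ m) := by gcongr
        _ = _ := by
          rw [div_pow]
          field_simp
    linarith

lemma ite_isUnit_eq_sum_char {q : ℕ} [NeZero q] (f : ZMod q → ℂ) (b : ZMod q) :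
    (if IsUnit b then f b else 0) = ∑ χ : DirichletCharacter ℂ q,
      ((q.totient : ℂ)⁻¹ * ∑ a : (ZMod q)ˣ, f a * χ (a : ZMod q)⁻¹) * χ b := by
  have hφ : (q.totient : ℂ) ≠ 0 := by
    exact_mod_cast (Nat.totient_pos.2 (NeZero.pos q)).ne'
  have h1 : ∑ χ : DirichletCharacter ℂ q,
      ((q.totient : ℂ)⁻¹ * ∑ a : (ZMod q)ˣ, f a * χ (a : ZMod q)⁻¹) * χ b =
      (q.totient : ℂ)⁻¹ * ∑ a : (ZMod q)ˣ, f a *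
          (if (a : ZMod q) = b then (q.totient : ℂ) else 0) := by
    simp_rw [mul_assoc, ← mul_sum, sum_mul]
    rw [sum_comm]
    congr 1
    refine sum_congr rfl fun a _ => ?_
    rw [← DirichletCharacter.sum_char_inv_mul_char_eq ℂ a.isUnit b, mul_sum]
    exact sum_congr rfl fun χ _ => by ring
  rw [h1]
  split_ifs with hb
  · obtain ⟨u, rfl⟩ := hb
    rw [sum_eq_single u]
    · rw [if_pos rfl]
      field_simp
    · intro a _ ha
      rw [if_neg (fun h => ha (Units.ext h)), mul_zero]
    · simp
  · rw [sum_eq_zero, mul_zero]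
    intro a _
    rw [if_neg, mul_zero]
    rintro rfl
    exact hb a.isUnit

lemma norm_sum_moebius_mul_le_of_coprime {q : ℕ} [NeZero q] {f : ZMod q → ℂ} (hf : ∀ a, ‖f a‖ ≤ 1)
    {M : ℕ} {B : ℝ}
    (hB : ∀ χ : DirichletCharacter ℂ q, ‖∑ n ∈ Icc 1 M, χ n * (ArithmeticFunction.moebius n : ℂ)‖
      ≤ B) :
    ‖∑ n ∈ Icc 1 M with n.Coprime q, (ArithmeticFunction.moebius n : ℂ) * f n‖ ≤ q * B := by
  have hφ0 : (0 : ℝ) < q.totient := by exact_mod_cast Nat.totient_pos.2 (NeZero.pos q)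
  have hB0 : 0 ≤ B := (norm_nonneg _).trans (hB 1)
  set c : DirichletCharacter ℂ q → ℂ := fun χ =>
    (q.totient : ℂ)⁻¹ * ∑ a : (ZMod q)ˣ, f a * χ (a : ZMod q)⁻¹ with hc
  have hcb : ∀ χ, ‖c χ‖ ≤ 1 := by
    intro χ
    have h1 : ‖∑ a : (ZMod q)ˣ, f a * χ (a : ZMod q)⁻¹‖ ≤ q.totient := by
      calc _ ≤ ∑ _a : (ZMod q)ˣ, (1 : ℝ) := norm_sum_le_of_le _ fun a _ => by
            rw [norm_mul]
            exact mul_le_one₀ (hf _) (norm_nonneg _) (χ.norm_le_one _)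
        _ = _ := by simp [ZMod.card_units_eq_totient]
    rw [hc]
    simp only
    rw [norm_mul, norm_inv, Complex.norm_natCast, inv_mul_le_iff₀ hφ0, mul_one]
    exact h1
  have h1 : ∑ n ∈ Icc 1 M with n.Coprime q, (ArithmeticFunction.moebius n : ℂ) * f n =
      ∑ χ : DirichletCharacter ℂ q, c χ * ∑ n ∈ Icc 1 M, χ n *
          (ArithmeticFunction.moebius n : ℂ) := by
    rw [sum_filter]
    simp_rw [mul_sum]
    rw [sum_comm]
    refine sum_congr rfl fun n _ => ?_
    have h2 := ite_isUnit_eq_sum_char f (n : ZMod q)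
    simp only [ZMod.isUnit_iff_coprime] at h2
    calc _ = (ArithmeticFunction.moebius n : ℂ) * (if n.Coprime q then f n else 0) := by
          split_ifs <;> simp
      _ = _ := by
          rw [h2, mul_sum]
          exact sum_congr rfl fun χ _ => by
            simp only [hc]
            ring
  rw [h1]
  calc _ ≤ ∑ _χ : DirichletCharacter ℂ q, B := norm_sum_le_of_le _ fun χ _ => by
        rw [norm_mul]
        exact (mul_le_of_le_one_left (norm_nonneg _) (hcb χ)).trans (hB χ)
    _ = q.totient * B := by
        rw [sum_const, card_univ, ← Nat.card_eq_fintype_card,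
          DirichletCharacter.card_eq_totient_of_hasEnoughRootsOfUnity, nsmul_eq_mul]
    _ ≤ q * B := by
        gcongr
        exact Nat.totient_le q

lemma moebius_mul_eq_ite (d m : ℕ) : ArithmeticFunction.moebius (d * m) =
    if d.Coprime m then ArithmeticFunction.moebius d * ArithmeticFunction.moebius m else 0 := by
  split_ifs with h
  · exact isMultiplicative_moebius.map_mul_of_coprime h
  · refine moebius_eq_zero_of_not_squarefree fun hs => h ?_
    exact Nat.coprime_of_squarefree_mul hs

lemma sum_moebius_mul_eq_sum_divisors {q : ℕ} (hq : q ≠ 0) (f : ℕ → ℂ) (M : ℕ) :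
    ∑ n ∈ Icc 1 M, (ArithmeticFunction.moebius n : ℂ) * f n =
      ∑ d ∈ q.divisors, (ArithmeticFunction.moebius d : ℂ) *
        ∑ m ∈ Icc 1 (M / d) with m.Coprime q, (ArithmeticFunction.moebius m : ℂ) * f (d * m) := by
  rw [← sum_fiberwise_of_maps_to (s := Icc 1 M) (t := q.divisors) (g := fun n => n.gcd q)
    (fun n _ => Nat.mem_divisors.2 ⟨Nat.gcd_dvd_right n q, hq⟩)]
  refine sum_congr rfl fun d hd => ?_
  have hdq := (Nat.mem_divisors.1 hd).1
  have hd0 : 0 < d := Nat.pos_of_mem_divisors hd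
  obtain ⟨e, rfl⟩ := hdq
  have h1 : ∑ n ∈ Icc 1 M with n.gcd (d * e) = d, (ArithmeticFunction.moebius n : ℂ) * f n =
      ∑ m ∈ Icc 1 (M / d) with m.Coprime e,
          (ArithmeticFunction.moebius (d * m) : ℂ) * f (d * m) := by
    symm
    refine sum_nbij' (fun m => d * m) (fun n => n / d) ?_ ?_ ?_ ?_ ?_
    · intro m hm
      simp only [mem_filter, mem_Icc] at hm ⊢
      refine ⟨⟨Nat.mul_pos hd0 hm.1.1, ?_⟩, ?_⟩
      · rw [mul_comm]
        exact (Nat.le_div_iff_mul_le hd0).1 hm.1.2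
      · rw [Nat.gcd_mul_left, hm.2, mul_one]
    · intro n hn
      simp only [mem_filter, mem_Icc] at hn ⊢
      obtain ⟨k, rfl⟩ : d ∣ n := by
        conv_lhs => rw [← hn.2]
        exact Nat.gcd_dvd_left _ _
      rw [Nat.mul_div_cancel_left _ hd0]
      have h2 := hn.2
      rw [Nat.gcd_mul_left] at h2
      refine ⟨⟨Nat.pos_of_mul_pos_left hn.1.1, ?_⟩, Nat.eq_of_mul_eq_mul_left hd0
        (by rw [h2, mul_one])⟩
      rw [Nat.le_div_iff_mul_le hd0, mul_comm]
      exact hn.1.2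
    · intro m _
      exact Nat.mul_div_cancel_left _ hd0
    · intro n hn
      simp only [mem_filter] at hn
      refine Nat.mul_div_cancel' ?_
      conv_lhs => rw [← hn.2]
      exact Nat.gcd_dvd_left _ _
    · intro m _
      rfl
  rw [h1, mul_sum, sum_filter, sum_filter]
  refine sum_congr rfl fun m _ => ?_
  have h2 : m.Coprime (d * e) ↔ d.Coprime m ∧ m.Coprime e := by
    rw [Nat.coprime_mul_iff_right, Nat.coprime_comm]
  rw [if_congr h2 rfl rfl, moebius_mul_eq_ite]
  split_ifs <;> first | tauto | (push_cast; ring)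

/-- Sums of the Möbius function against a periodic function. -/
theorem exists_norm_sum_moebius_mul_periodic_le (m : ℕ) :
    ∃ C : ℝ, 0 < C ∧ ∀ (q : ℕ) [NeZero q] (f : ZMod q → ℂ), (∀ a, ‖f a‖ ≤ 1) → ∀ (N M : ℕ),
      2 ≤ N → M ≤ N → ‖∑ n ∈ Icc 1 M, (ArithmeticFunction.moebius n : ℂ) * f n‖ ≤
        C * q ^ 3 * (N / Real.log N ^ m) := by
  obtain ⟨C, hC, h⟩ := exists_norm_sum_char_mul_moebius_le_of_le m
  refine ⟨C, hC, fun q _ f hf N M hN hMN => ?_⟩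
  have hB0 : 0 ≤ C * q * (N / Real.log N ^ m) :=
    (norm_nonneg _).trans (h q 1 N M hN hMN)
  rw [sum_moebius_mul_eq_sum_divisors (NeZero.ne q) (fun n => f n)]
  calc _ ≤ ∑ d ∈ q.divisors, q * (C * q * (N / Real.log N ^ m)) := by
        refine norm_sum_le_of_le _ fun d _ => ?_
        have h1 : ‖(ArithmeticFunction.moebius d : ℂ)‖ ≤ 1 := by
          rw [Complex.norm_intCast]
          exact_mod_cast abs_moebius_le_one
        rw [norm_mul]
        refine (mul_le_of_le_one_left (norm_nonneg _) h1).trans ?_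
        have h2 := norm_sum_moebius_mul_le_of_coprime (f := fun a : ZMod q => f ((d : ZMod q) * a))
            (fun a => hf _)
          (M := M / d) (fun χ => h q χ N (M / d) hN ((Nat.div_le_self M d).trans hMN))
        simpa using h2
    _ = (q.divisors.card : ℝ) * (q * (C * q * (N / Real.log N ^ m))) := by simp
    _ ≤ (q : ℝ) * (q * (C * q * (N / Real.log N ^ m))) := by
        gcongr
        exact_mod_cast Nat.card_divisors_le_self q
    _ = _ := by ring

/-- The additive character `x ↦ exp (2πix)`. -/
noncomputable def additiveChar (x : ℝ) : ℂ := Complex.exp (Complex.I * (2 * Real.pi * x : ℝ))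

theorem additiveChar_add (x y : ℝ) : additiveChar (x + y) = additiveChar x * additiveChar y := by
  unfold additiveChar
  rw [← Complex.exp_add]
  congr 1
  push_cast
  ring

theorem norm_additiveChar (x : ℝ) : ‖additiveChar x‖ = 1 := by
  unfold additiveChar
  rw [mul_comm]
  exact Complex.norm_exp_ofReal_mul_I _

theorem additiveChar_intCast (k : ℤ) : additiveChar k = 1 := by
  unfold additiveChar
  rw [Complex.exp_eq_one_iff]
  exact ⟨k, by push_cast; ring⟩

theorem additiveChar_neg (x : ℝ) : additiveChar (-x) = starRingEnd ℂ (additiveChar x) := by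
  unfold additiveChar
  rw [← Complex.exp_conj, map_mul, Complex.conj_I, Complex.conj_ofReal]
  congr 1
  push_cast
  ring

theorem norm_additiveChar_sub_le (x y : ℝ) :
    ‖additiveChar x - additiveChar y‖ ≤ 2 * Real.pi * |x - y| := by
  have h1 : additiveChar x - additiveChar y = additiveChar y * (additiveChar (x - y) - 1) := by
    rw [mul_sub, ← additiveChar_add]
    simp
  rw [h1, norm_mul, norm_additiveChar, one_mul]
  refine (Real.norm_exp_I_mul_ofReal_sub_one_le (x := 2 * Real.pi * (x - y))).trans ?_
  rw [Real.norm_eq_abs, abs_mul, abs_of_pos Real.two_pi_pos]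

theorem additiveChar_rational_periodic {q : ℕ} [NeZero q] (a : ℤ) (n : ℕ) :
    additiveChar (n * (a / q : ℝ)) = additiveChar ((n : ZMod q).val * (a / q : ℝ)) := by
  have hq : (q : ℝ) ≠ 0 := Nat.cast_ne_zero.2 (NeZero.ne q)
  have h1 : (n : ℝ) * (a / q : ℝ) = (n : ZMod q).val * (a / q : ℝ) + ((n / q : ℕ) * a : ℤ) := by
    rw [ZMod.val_natCast]
    have h2 : (n : ℝ) = (n % q : ℕ) + q * (n / q : ℕ) := by
      exact_mod_cast (Nat.mod_add_div n q).symm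
    conv_lhs => rw [h2]
    generalize n / q = k
    push_cast
    field_simp
  rw [h1, additiveChar_add, additiveChar_intCast, mul_one]

/-- Davenport's estimate near rationals with small denominators. -/
theorem exists_norm_sum_moebius_mul_additiveChar_near_rational_le (m : ℕ) :
    ∃ C : ℝ, 0 < C ∧ ∀ (q : ℕ) [NeZero q] (a : ℤ) (β : ℝ) (N : ℕ), 2 ≤ N →
      ‖∑ n ∈ Icc 1 N, (ArithmeticFunction.moebius n : ℂ) * additiveChar (n * (a / q + β))‖ ≤
        C * q ^ 3 * (1 + 2 * Real.pi * |β| * N) * (N / Real.log N ^ m) := by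
  obtain ⟨C, hC, h⟩ := exists_norm_sum_moebius_mul_periodic_le m
  refine ⟨C, hC, fun q _ a β N hN => ?_⟩
  have hB (M : ℕ) (hM : M ≤ N) : ‖∑ n ∈ Ioc 0 M,
      (ArithmeticFunction.moebius n : ℂ) * additiveChar (n * (a / q : ℝ))‖ ≤
        C * q ^ 3 * (N / Real.log N ^ m) := by
    rw [← Icc_one_eq_Ioc_zero]
    have h1 := h q (fun z => additiveChar (z.val * (a / q : ℝ)))
      (fun z => (norm_additiveChar _).le) N M hN hM
    simpa only [← additiveChar_rational_periodic] using h1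
  have hB0 := (norm_nonneg _).trans (hB N le_rfl)
  have h1 := norm_sum_mul_le_of_norm_sum_le (w := fun n => additiveChar (n * β)) (R := 0) (N := N)
    (by omega) (fun M _ hM => hB M hM)
  rw [Icc_one_eq_Ioc_zero]
  calc _ = ‖∑ n ∈ Ioc 0 N, additiveChar (n * β) *
        ((ArithmeticFunction.moebius n : ℂ) * additiveChar (n * (a / q : ℝ)))‖ := by
        congr 1
        refine sum_congr rfl fun n _ => ?_
        rw [mul_add, additiveChar_add]
        ring
    _ ≤ _ := h1
    _ ≤ C * q ^ 3 * (N / Real.log N ^ m) * (1 + ∑ i ∈ Ico (0 + 1) N, 2 * Real.pi * |β|) := by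
        rw [norm_additiveChar]
        gcongr with i _
        refine (norm_additiveChar_sub_le _ _).trans (le_of_eq ?_)
        congr 2
        push_cast
        ring
    _ ≤ C * q ^ 3 * (N / Real.log N ^ m) * (1 + 2 * Real.pi * |β| * N) := by
        rw [sum_const, Nat.card_Ico, nsmul_eq_mul, mul_comm (_ : ℝ) (2 * Real.pi * |β|)]
        gcongr
        omega
    _ = _ := by ring

theorem sum_inv_natCast_le_one_add_log (n : ℕ) :
    ∑ k ∈ Icc 1 n, (1 / k : ℝ) ≤ 1 + Real.log n := by
  have h := harmonic_le_one_add_log n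
  rw [harmonic_eq_sum_Icc] at h
  push_cast at h
  simpa only [one_div] using h

theorem additiveChar_natCast_mul (n : ℕ) (x : ℝ) : additiveChar (n * x) = additiveChar x ^ n := by
  unfold additiveChar
  rw [← Complex.exp_nat_mul]
  congr 1
  push_cast
  ring

theorem additiveChar_fract (x : ℝ) : additiveChar (Int.fract x) = additiveChar x := by
  conv_rhs => rw [← Int.floor_add_fract x, additiveChar_add, additiveChar_intCast, one_mul]

theorem four_mul_le_norm_additiveChar_sub_one {t : ℝ} (ht : 0 ≤ t) (ht' : t ≤ 1 / 2) :
    4 * t ≤ ‖additiveChar t - 1‖ := by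
  unfold additiveChar
  rw [Complex.norm_exp_I_mul_ofReal_sub_one, Real.norm_eq_abs]
  have h1 := Real.mul_le_sin (x := 2 * Real.pi * t / 2) (by positivity)
    (by nlinarith [Real.pi_pos])
  have h2 : 2 / Real.pi * (2 * Real.pi * t / 2) = 2 * t := by
    field_simp
  rw [h2] at h1
  refine le_trans ?_ (le_abs_self _)
  linarith

theorem four_mul_min_le_norm_additiveChar_sub_one {t : ℝ} (ht : 0 ≤ t) (ht' : t ≤ 1) :
    4 * min t (1 - t) ≤ ‖additiveChar t - 1‖ := by
  rcases le_total t (1 / 2) with h | h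
  · rw [min_eq_left (by linarith)]
    exact four_mul_le_norm_additiveChar_sub_one ht h
  · rw [min_eq_right (by linarith)]
    have h1 := four_mul_le_norm_additiveChar_sub_one (t := 1 - t) (by linarith) (by linarith)
    have h2 : additiveChar (1 - t) - 1 = starRingEnd ℂ (additiveChar t - 1) := by
      have h3 : additiveChar 1 = 1 := by simpa using additiveChar_intCast 1
      rw [sub_eq_add_neg 1 t, additiveChar_add, additiveChar_neg, h3, one_mul, map_sub, map_one]
    rwa [h2, RCLike.norm_conj] at h1

theorem norm_sum_additiveChar_le_card (R Y : ℕ) (x : ℝ) :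
    ‖∑ h ∈ Ioc R Y, additiveChar (h * x)‖ ≤ Y := by
  refine (norm_sum_le_of_le (f := fun h : ℕ => additiveChar (h * x)) (n := fun _ => 1) _
    (fun h _ => (norm_additiveChar _).le)).trans ?_
  simp

/-- The geometric sum bound, in terms of the distance to the nearest integer. -/
theorem norm_sum_additiveChar_le_inv (R Y : ℕ) {x s : ℝ} (hs : 0 < s) (h1 : s ≤ Int.fract x)
    (h2 : s ≤ 1 - Int.fract x) : ‖∑ h ∈ Ioc R Y, additiveChar (h * x)‖ ≤ 1 / (2 * s) := by
  have h3 : 4 * s ≤ ‖additiveChar x - 1‖ := by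
    rw [← additiveChar_fract]
    refine le_trans ?_ (four_mul_min_le_norm_additiveChar_sub_one (Int.fract_nonneg x)
      (Int.fract_lt_one x).le)
    gcongr
    exact le_min h1 h2
  have h4 : 0 < ‖additiveChar x - 1‖ := by linarith
  rcases lt_or_ge Y R with h | h
  · rw [Ioc_eq_empty_of_le h.le, sum_empty, norm_zero]
    positivity
  have h5 : (∑ h ∈ Ioc R Y, additiveChar (h * x)) * (additiveChar x - 1) =
      additiveChar x ^ (Y + 1) - additiveChar x ^ (R + 1) := by
    rw [← geom_sum_Ico_mul _ (Nat.succ_le_succ h)]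
    simp only [additiveChar_natCast_mul, Nat.succ_eq_add_one, Ico_add_one_add_one_eq_Ioc]
  have h6 : ‖∑ h ∈ Ioc R Y, additiveChar (h * x)‖ * ‖additiveChar x - 1‖ ≤ 2 := by
    rw [← norm_mul, h5]
    refine (norm_sub_le _ _).trans ?_
    rw [norm_pow, norm_pow, norm_additiveChar]
    norm_num
  calc _ ≤ 2 / ‖additiveChar x - 1‖ := (le_div_iff₀ h4).2 h6
    _ ≤ 2 / (4 * s) := by gcongr
    _ = _ := by
      field_simp
      norm_num

/-- A bound for geometric sums whose frequency has fractional part in `[r / q, (r + 1) / q)`. -/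
noncomputable def geomSumMajorant (X : ℝ) (q r : ℕ) : ℝ :=
  (if r = 0 then X else q / (2 * r)) +
    (if q - 1 - r = 0 then X else q / (2 * (q - 1 - r : ℕ)))

theorem geomSumMajorant_nonneg {X : ℝ} (hX : 0 ≤ X) (q r : ℕ) : 0 ≤ geomSumMajorant X q r := by
  unfold geomSumMajorant
  split_ifs <;> positivity

theorem norm_sum_additiveChar_le_geomSumMajorant (R : ℕ) {Y q : ℕ} {X : ℝ} (hX : Y ≤ X)
    (hq : 0 < q) (x : ℝ) :
    ‖∑ h ∈ Ioc R Y, additiveChar (h * x)‖ ≤ geomSumMajorant X q ⌊q * Int.fract x⌋₊ := by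
  have hq' : (0 : ℝ) < q := Nat.cast_pos.2 hq
  have ht := Int.fract_nonneg x
  have ht' := Int.fract_lt_one x
  set t := Int.fract x with htx
  set r := ⌊q * t⌋₊ with hr
  have hr1 : (r : ℝ) ≤ q * t := Nat.floor_le (by positivity)
  have hr2 : q * t < r + 1 := Nat.lt_floor_add_one _
  have hrq : r < q := by
    have : (r : ℝ) < q := hr1.trans_lt (by nlinarith)
    exact_mod_cast this
  unfold geomSumMajorant
  have hY := (norm_sum_additiveChar_le_card R Y x).trans hX
  have hX0 : 0 ≤ X := (Nat.cast_nonneg _).trans hX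
  split_ifs with h1 h2 h2
  · linarith
  · exact hY.trans (le_add_of_nonneg_right (by positivity))
  · exact hY.trans (le_add_of_nonneg_left (by positivity))
  · have hs1 : (0 : ℝ) < r / q := by
      have : (0 : ℝ) < r := by exact_mod_cast Nat.pos_of_ne_zero h1
      positivity
    have hs2 : (0 : ℝ) < (q - 1 - r : ℕ) / q := by
      have : (0 : ℝ) < (q - 1 - r : ℕ) := by exact_mod_cast Nat.pos_of_ne_zero h2
      positivity
    have e1 : (r : ℝ) / q ≤ t := by
      rw [div_le_iff₀ hq']
      linarith
    have e2 : ((q - 1 - r : ℕ) : ℝ) / q ≤ 1 - t := by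
      rw [div_le_iff₀ hq', Nat.sub_sub, Nat.cast_sub (by omega)]
      push_cast
      linarith
    rcases le_total ((r : ℝ) / q) ((q - 1 - r : ℕ) / q) with h3 | h3
    · refine (norm_sum_additiveChar_le_inv R Y hs1 e1 (h3.trans e2)).trans ?_
      refine le_trans (le_of_eq ?_) (le_add_of_nonneg_right (by positivity))
      field_simp
    · refine (norm_sum_additiveChar_le_inv R Y hs2 (h3.trans e1) e2).trans ?_
      refine le_trans (le_of_eq ?_) (le_add_of_nonneg_left (by positivity))
      field_simp

theorem sum_geomSumMajorant_le {X : ℝ} {q : ℕ} (hq : 0 < q) :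
    ∑ r ∈ range q, geomSumMajorant X q r ≤ 2 * X + q * (1 + Real.log q) := by
  unfold geomSumMajorant
  rw [sum_add_distrib,
    sum_range_reflect (fun r : ℕ => if r = 0 then X else (q : ℝ) / (2 * (r : ℕ))) q]
  have h1 : ∑ r ∈ range q, (if r = 0 then X else (q : ℝ) / (2 * (r : ℕ))) ≤
      X + q / 2 * (1 + Real.log q) := by
    obtain ⟨p, rfl⟩ := Nat.exists_eq_succ_of_ne_zero hq.ne'
    rw [sum_range_succ']
    have h2 : ∑ k ∈ range p, (if k + 1 = 0 then X else ((p + 1 : ℕ) : ℝ) / (2 * ((k + 1 : ℕ) : ℝ)))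
        = (p + 1 : ℕ) / 2 * ∑ k ∈ Icc 1 p, (1 / k : ℝ) := by
      rw [mul_sum, ← Ico_add_one_right_eq_Icc, sum_Ico_eq_sum_range]
      refine sum_congr (by simp) fun k _ => ?_
      rw [if_neg (by omega), add_comm 1 k]
      field_simp
    rw [Nat.succ_eq_add_one, h2, if_pos rfl, add_comm]
    gcongr
    refine (sum_inv_natCast_le_one_add_log p).trans ?_
    rcases Nat.eq_zero_or_pos p with rfl | hp
    · simp
    · gcongr
      omega
  linarith

/-- The multiples `i θ` with `i` in a block of length `q` are well spaced modulo one. -/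
theorem card_filter_floor_fract_le_three {q : ℕ} (hq : 0 < q) {a : ℤ} (ha : IsCoprime a q) {θ : ℝ}
    (hθ : |θ - a / q| ≤ 1 / q ^ 2) (j r : ℕ) :
    #{i ∈ range q | ⌊q * Int.fract ((j + i : ℕ) * θ)⌋₊ = r} ≤ 3 := by
  rcases Finset.eq_empty_or_nonempty {i ∈ range q | ⌊q * Int.fract ((j + i : ℕ) * θ)⌋₊ = r}
    with h | ⟨l, hl⟩
  · rw [h]
    simp
  have hq' : (0 : ℝ) < q := Nat.cast_pos.2 hq
  simp only [mem_filter, mem_range] at hl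
  have : NeZero q := ⟨hq.ne'⟩
  have hunit : IsUnit (a : ZMod q) := by
    obtain ⟨u, v, huv⟩ := ha
    refine IsUnit.of_mul_eq_one (u : ZMod q) ?_
    have := congrArg (Int.cast : ℤ → ZMod q) huv
    push_cast at this
    rw [ZMod.natCast_self, mul_zero, add_zero] at this
    rw [mul_comm, this]
  have hmaps (i : ℕ) (hi : i ∈
      ({i ∈ range q | ⌊q * Int.fract ((j + i : ℕ) * θ)⌋₊ = r} : Finset ℕ)) :
      ((((i : ℤ) - l) * a : ℤ) : ZMod q) ∈ ({-1, 0, 1} : Finset (ZMod q)) := by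
    simp only [mem_filter, mem_range] at hi
    have hfl (i : ℕ) : ⌊q * Int.fract ((j + i : ℕ) * θ)⌋₊ = r →
        (r : ℝ) ≤ q * Int.fract ((j + i : ℕ) * θ) ∧ q * Int.fract ((j + i : ℕ) * θ) < r + 1 := by
      rintro rfl
      exact ⟨Nat.floor_le (mul_nonneg hq'.le (Int.fract_nonneg _)), Nat.lt_floor_add_one _⟩
    obtain ⟨h1, h2⟩ := hfl i hi.2
    obtain ⟨h3, h4⟩ := hfl l hl.2
    set k : ℤ := ((i : ℤ) - l) * a - q * (⌊(j + i : ℕ) * θ⌋ - ⌊(j + l : ℕ) * θ⌋) with hk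
    have h5 : (k : ℝ) = q * Int.fract ((j + i : ℕ) * θ) - q * Int.fract ((j + l : ℕ) * θ) -
        q * (((i : ℝ) - l) * (θ - a / q)) := by
      rw [hk, Int.fract, Int.fract]
      push_cast
      field_simp
      ring
    have h6 : |(i : ℝ) - l| < q := by
      have e1 : (i : ℝ) < q := by exact_mod_cast hi.1
      have e2 : (l : ℝ) < q := by exact_mod_cast hl.1
      have e3 : (0 : ℝ) ≤ i := Nat.cast_nonneg _
      have e4 : (0 : ℝ) ≤ l := Nat.cast_nonneg _
      rw [abs_lt]
      constructor <;> linarith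
    have h7 : |q * (((i : ℝ) - l) * (θ - a / q))| ≤ 1 := by
      rw [abs_mul, abs_mul, abs_of_pos hq']
      calc (q : ℝ) * (|(i : ℝ) - l| * |θ - a / q|) ≤ q * (q * (1 / q ^ 2)) := by gcongr
        _ = 1 := by field_simp
    have h8 : |(k : ℝ)| < 2 := by
      rw [abs_le] at h7
      rw [h5, abs_lt]
      constructor <;> linarith
    have h9 : |k| < 2 := by exact_mod_cast h8
    rw [abs_lt] at h9
    have h10 : ((((i : ℤ) - l) * a : ℤ) : ZMod q) = (k : ZMod q) := by
      rw [hk]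
      push_cast
      simp
    rw [h10]
    have h11 : k = -1 ∨ k = 0 ∨ k = 1 := by omega
    rcases h11 with h | h | h <;> simp [h]
  have hinj : Set.InjOn (fun i : ℕ => ((((i : ℤ) - l) * a : ℤ) : ZMod q))
      ({i ∈ range q | ⌊q * Int.fract ((j + i : ℕ) * θ)⌋₊ = r} : Finset ℕ) := by
    intro i hi i' hi' h
    simp only [coe_filter, mem_range, Set.mem_ofPred_eq] at hi hi'
    push_cast at h
    have h1 : (i : ZMod q) = i' := by simpa using hunit.mul_right_cancel h
    have h2 := (ZMod.natCast_eq_natCast_iff' _ _ _).1 h1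
    rwa [Nat.mod_eq_of_lt hi.1, Nat.mod_eq_of_lt hi'.1] at h2
  exact (card_le_card_of_injOn _ hmaps hinj).trans card_le_three

theorem sum_range_geomSumMajorant_le {q : ℕ} (hq : 0 < q) {a : ℤ} (ha : IsCoprime a q) {θ : ℝ}
    (hθ : |θ - a / q| ≤ 1 / q ^ 2) {X : ℝ} (hX : 0 ≤ X) (j : ℕ) :
    ∑ i ∈ range q, geomSumMajorant X q ⌊q * Int.fract ((j + i : ℕ) * θ)⌋₊ ≤
      3 * (2 * X + q * (1 + Real.log q)) := by
  have hq' : (0 : ℝ) < q := Nat.cast_pos.2 hq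
  have hmaps (i : ℕ) (_ : i ∈ range q) : ⌊q * Int.fract ((j + i : ℕ) * θ)⌋₊ ∈ range q := by
    rw [mem_range, Nat.floor_lt (mul_nonneg hq'.le (Int.fract_nonneg _))]
    have := Int.fract_lt_one ((j + i : ℕ) * θ)
    nlinarith
  rw [← sum_fiberwise_of_maps_to hmaps]
  calc _ ≤ ∑ r ∈ range q, 3 * geomSumMajorant X q r := by
        refine sum_le_sum fun r _ => ?_
        rw [sum_congr rfl (g := fun _ => geomSumMajorant X q r)
          (fun i hi => by rw [(mem_filter.1 hi).2]), sum_const, nsmul_eq_mul]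
        gcongr
        · exact geomSumMajorant_nonneg hX q r
        · exact_mod_cast card_filter_floor_fract_le_three hq ha hθ j r
    _ ≤ _ := by
        rw [← mul_sum]
        gcongr
        exact sum_geomSumMajorant_le hq

theorem sum_range_geomSumMajorant_le_of_block {q : ℕ} (hq : 0 < q) {a : ℤ} (ha : IsCoprime a q)
    {θ : ℝ} (hθ : |θ - a / q| ≤ 1 / q ^ 2) {X : ℝ} (hX : 0 ≤ X) (k : ℕ) :
    ∑ i ∈ range k, geomSumMajorant X q ⌊q * Int.fract (i * θ)⌋₊ ≤
      (k / q + 1) * (3 * (2 * X + q * (1 + Real.log q))) := by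
  have hblocks (b : ℕ) : ∑ i ∈ range (q * b), geomSumMajorant X q ⌊q * Int.fract (i * θ)⌋₊ ≤
      b * (3 * (2 * X + q * (1 + Real.log q))) := by
    induction b with
    | zero => simp
    | succ b ih =>
      rw [mul_add, mul_one, sum_range_add]
      have := sum_range_geomSumMajorant_le hq ha hθ hX (q * b)
      push_cast at ih this ⊢
      linarith
  calc _ ≤ ∑ i ∈ range (q * (k / q + 1)), geomSumMajorant X q ⌊q * Int.fract (i * θ)⌋₊ := by
        refine sum_le_sum_of_subset_of_nonneg ?_ fun _ _ _ => geomSumMajorant_nonneg hX q _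
        rw [range_subset_range]
        exact (Nat.lt_mul_div_succ k hq).le
    _ ≤ _ := hblocks _
    _ ≤ _ := by
        have h1 : (0 : ℝ) ≤ Real.log q := Real.log_natCast_nonneg q
        push_cast
        gcongr
        exact Nat.cast_div_le

theorem norm_sum_natCast_mul_additiveChar_le (R : ℕ) {Y q : ℕ} {X : ℝ} (hX : Y ≤ X) (hq : 0 < q)
    (x : ℝ) : ‖∑ h ∈ Ioc R Y, (h : ℂ) * additiveChar (h * x)‖ ≤
      2 * X * geomSumMajorant X q ⌊q * Int.fract x⌋₊ := by
  have hX0 : 0 ≤ X := (Nat.cast_nonneg _).trans hX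
  have hM := geomSumMajorant_nonneg hX0 q ⌊q * Int.fract x⌋₊
  rcases le_or_gt Y R with h | h
  · rw [Ioc_eq_empty_of_le h, sum_empty, norm_zero]
    positivity
  refine (norm_sum_mul_le_of_norm_sum_le (w := fun n => (n : ℂ)) h
    (fun n _ hn => norm_sum_additiveChar_le_geomSumMajorant R
      (le_trans (Nat.cast_le.2 hn) hX) hq x)).trans ?_
  rw [mul_comm]
  gcongr
  have h1 : ∑ i ∈ Ico (R + 1) Y, ‖((i + 1 : ℕ) : ℂ) - i‖ ≤ X := by
    simp only [Nat.cast_add, Nat.cast_one, add_sub_cancel_left, norm_one, sum_const, Nat.card_Ico,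
      nsmul_eq_mul, mul_one]
    refine le_trans ?_ hX
    exact_mod_cast Nat.sub_le _ _
  rw [Complex.norm_natCast]
  linarith

theorem sum_sum_le_two_mul_sum_of_symm {W : ℕ → ℕ → ℝ} (hW : ∀ a b, 0 ≤ W a b)
    (hsymm : ∀ a b, W a b = W b a) (S : Finset ℕ) :
    ∑ a ∈ S, ∑ b ∈ S, W a b ≤ 2 * ∑ a ∈ S, ∑ b ∈ S with b ≤ a, W a b := by
  have h1 : ∑ a ∈ S, ∑ b ∈ S with ¬ b ≤ a, W a b ≤ ∑ a ∈ S, ∑ b ∈ S with b ≤ a, W a b := by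
    simp only [sum_filter]
    rw [sum_comm]
    refine sum_le_sum fun a _ => sum_le_sum fun b _ => ?_
    rw [hsymm b a]
    split_ifs with h2 h3 h3
    · exact hW a b
    · rfl
    · rfl
    · omega
  calc _ = ∑ a ∈ S, (∑ b ∈ S with b ≤ a, W a b + ∑ b ∈ S with ¬ b ≤ a, W a b) :=
        sum_congr rfl fun a _ => (sum_filter_add_sum_filter_not _ _ _).symm
    _ ≤ _ := by
        rw [sum_add_distrib]
        linarith

/-- Opening the square of a bilinear sum. -/
theorem sum_natCast_mul_norm_sq_le {c : ℕ → ℂ} (hc : ∀ k, ‖c k‖ ≤ 1) (θ : ℝ) (U N : ℕ)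
    {S : Finset ℕ} (hS : ∀ k ∈ S, 0 < k) :
    ∑ h ∈ Ioc U N, (h : ℝ) * ‖∑ k ∈ S with h * k ≤ N, c k * additiveChar (h * (k * θ))‖ ^ 2 ≤
      ∑ a ∈ S, ∑ b ∈ S,
        ‖∑ h ∈ Ioc U (N / max a b), (h : ℂ) * additiveChar (h * (((a : ℝ) - b) * θ))‖ := by
  set V := ∑ h ∈ Ioc U N, (h : ℝ) *
    ‖∑ k ∈ S with h * k ≤ N, c k * additiveChar (h * (k * θ))‖ ^ 2 with hV
  have hkey : (V : ℂ) = ∑ a ∈ S, ∑ b ∈ S, c a * starRingEnd ℂ (c b) *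
      ∑ h ∈ Ioc U (N / max a b), (h : ℂ) * additiveChar (h * (((a : ℝ) - b) * θ)) := by
    have h1 (a : ℕ) (ha : a ∈ S) (b : ℕ) (hb : b ∈ S) : Ioc U (N / max a b) =
        {h ∈ Ioc U N | h * a ≤ N ∧ h * b ≤ N} := by
      ext h
      have h2 : 0 < max a b := lt_max_of_lt_left (hS a ha)
      rw [mem_Ioc, mem_filter, mem_Ioc, Nat.le_div_iff_mul_le h2, ← Nat.mul_max_mul_left,
        max_le_iff]
      refine ⟨fun ⟨e1, e2⟩ => ⟨⟨e1, ?_⟩, e2⟩, fun ⟨e1, e2⟩ => ⟨e1.1, e2⟩⟩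
      exact (Nat.le_mul_of_pos_right h (hS a ha)).trans e2.1
    rw [hV]
    push_cast
    simp_rw [← Complex.mul_conj', sum_filter, map_sum, sum_mul_sum, mul_sum]
    rw [sum_comm]
    refine sum_congr rfl fun a ha => ?_
    rw [sum_comm]
    refine sum_congr rfl fun b hb => ?_
    rw [h1 a ha b hb, sum_filter]
    refine sum_congr rfl fun h _ => ?_
    have h3 : additiveChar (h * (((a : ℝ) - b) * θ)) =
        additiveChar (h * (a * θ)) * starRingEnd ℂ (additiveChar (h * (b * θ))) := by
      rw [← additiveChar_neg, ← additiveChar_add]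
      congr 1
      ring
    by_cases e1 : h * a ≤ N <;> by_cases e2 : h * b ≤ N <;> simp [e1, e2]
    rw [h3]
    ring
  calc V ≤ ‖(V : ℂ)‖ := by
        rw [Complex.norm_real]
        exact le_abs_self V
    _ ≤ _ := by
        rw [hkey]
        refine norm_sum_le_of_le _ fun a _ => norm_sum_le_of_le _ fun b _ => ?_
        rw [norm_mul, norm_mul, RCLike.norm_conj]
        refine mul_le_of_le_one_left (norm_nonneg _) ?_
        exact mul_le_one₀ (hc a) (norm_nonneg _) (hc b)

theorem sum_filter_le_norm_sum_additiveChar_le {q : ℕ} (hq : 0 < q) {a : ℤ} (ha : IsCoprime a q)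
    {θ : ℝ} (hθ : |θ - a / q| ≤ 1 / q ^ 2) (U N : ℕ) {S : Finset ℕ} (hS : ∀ k ∈ S, 0 < k) {k : ℕ}
    (hk : k ∈ S) :
    ∑ b ∈ S with b ≤ k,
        ‖∑ h ∈ Ioc U (N / max k b), (h : ℂ) * additiveChar (h * (((k : ℝ) - b) * θ))‖ ≤
      2 * (N / k) * ((k / q + 1) * (3 * (2 * (N / k) + q * (1 + Real.log q)))) := by
  have hX : ((N / k : ℕ) : ℝ) ≤ (N : ℝ) / k := Nat.cast_div_le
  have hX0 : (0 : ℝ) ≤ (N : ℝ) / k := by positivity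
  calc _ ≤ ∑ b ∈ S with b ≤ k, 2 * ((N : ℝ) / k) *
          geomSumMajorant (N / k) q ⌊q * Int.fract ((k - b : ℕ) * θ)⌋₊ := by
        refine sum_le_sum fun b hb => ?_
        have hbk := (mem_filter.1 hb).2
        rw [max_eq_left hbk, ← Nat.cast_sub hbk]
        exact norm_sum_natCast_mul_additiveChar_le U hX hq _
    _ = 2 * ((N : ℝ) / k) * ∑ i ∈ image (fun b => k - b) {b ∈ S | b ≤ k},
          geomSumMajorant (N / k) q ⌊q * Int.fract (i * θ)⌋₊ := by
        rw [← mul_sum, sum_image]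
        intro b hb b' hb' h
        have h1 := (mem_filter.1 hb).2
        have h2 := (mem_filter.1 hb').2
        simp only at h
        omega
    _ ≤ 2 * ((N : ℝ) / k) * ∑ i ∈ range k,
          geomSumMajorant (N / k) q ⌊q * Int.fract (i * θ)⌋₊ := by
        gcongr
        · intro _ _ _
          exact geomSumMajorant_nonneg hX0 q _
        · intro i hi
          obtain ⟨b, hb, rfl⟩ := mem_image.1 hi
          have h1 := hS b (mem_filter.1 hb).1
          have h2 := hS k hk
          rw [mem_range]
          omega
    _ ≤ _ := by
        gcongr
        exact sum_range_geomSumMajorant_le_of_block hq ha hθ hX0 k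

theorem sum_sum_divisorsAntidiagonal_le {F : ℕ → ℕ → ℝ} (hF : ∀ a b, 0 ≤ F a b) (N : ℕ) :
    ∑ n ∈ Icc 1 N, ∑ x ∈ n.divisorsAntidiagonal, F x.1 x.2 ≤
      ∑ a ∈ Icc 1 N, ∑ b ∈ Icc 1 N, F a b := by
  rw [Icc_one_eq_Ioc_zero, ← sum_product']
  calc _ = ∑ n ∈ Ioc 0 N, ∑ x ∈ Ioc 0 N ×ˢ Ioc 0 N with x.1 * x.2 = n, F x.1 x.2 := by
        refine sum_congr rfl fun n hn => ?_
        simp only [mem_Ioc] at hn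
        rw [Nat.divisorsAntidiagonal_eq_prod_filter_of_le hn.1.ne' hn.2]
    _ = ∑ x ∈ Ioc 0 N ×ˢ Ioc 0 N, if x.1 * x.2 ∈ Ioc 0 N then F x.1 x.2 else 0 := by
        simp_rw [sum_filter]
        rw [sum_comm]
        exact sum_congr rfl fun x _ => sum_ite_eq _ _ _
    _ ≤ _ := by
        refine sum_le_sum fun x _ => ?_
        split_ifs
        · rfl
        · exact hF _ _

theorem card_divisors_eq_sum (n : ℕ) (c : ℝ) :
    (#n.divisors : ℝ) * c = ∑ _x ∈ n.divisorsAntidiagonal, c := by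
  rw [sum_const, nsmul_eq_mul, ← Nat.map_div_right_divisors, card_map]

theorem sum_card_divisors_div_le (N : ℕ) :
    ∑ n ∈ Icc 1 N, (#n.divisors : ℝ) * (1 / n) ≤ (1 + Real.log N) ^ 2 := by
  calc _ = ∑ n ∈ Icc 1 N, ∑ x ∈ n.divisorsAntidiagonal, (1 / x.1 : ℝ) * (1 / x.2) := by
        refine sum_congr rfl fun n _ => ?_
        rw [card_divisors_eq_sum]
        refine sum_congr rfl fun x hx => ?_
        rw [← (Nat.mem_divisorsAntidiagonal.1 hx).1]
        push_cast
        exact (one_div_mul_one_div _ _).symm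
    _ ≤ _ := sum_sum_divisorsAntidiagonal_le (F := fun a b => (1 / a : ℝ) * (1 / b))
      (fun _ _ => by positivity) N
    _ = (∑ a ∈ Icc 1 N, (1 / a : ℝ)) ^ 2 := by
        rw [sq, sum_mul_sum]
    _ ≤ _ := by
        gcongr
        exact sum_inv_natCast_le_one_add_log N

theorem sum_card_divisors_sq_div_le (N : ℕ) :
    ∑ n ∈ Icc 1 N, (#n.divisors : ℝ) ^ 2 / n ≤ (1 + Real.log N) ^ 4 := by
  calc _ ≤ ∑ n ∈ Icc 1 N, ∑ x ∈ n.divisorsAntidiagonal,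
          ((#x.1.divisors : ℝ) * (1 / x.1)) * (#x.2.divisors * (1 / x.2)) := by
        refine sum_le_sum fun n _ => ?_
        rw [sq, mul_div_assoc, card_divisors_eq_sum]
        refine sum_le_sum fun x hx => ?_
        rw [← (Nat.mem_divisorsAntidiagonal.1 hx).1]
        have h1 : (#(x.1 * x.2).divisors : ℝ) ≤ #x.1.divisors * #x.2.divisors := by
          rw [Nat.divisors_mul]
          exact_mod_cast card_mul_le
        calc ((#(x.1 * x.2).divisors : ℝ)) / (x.1 * x.2 : ℕ)
            ≤ (#x.1.divisors * #x.2.divisors : ℝ) / (x.1 * x.2 : ℕ) := by gcongr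
          _ = _ := by
            push_cast
            rw [mul_div_mul_comm, div_eq_mul_one_div (#x.1.divisors : ℝ),
              div_eq_mul_one_div (#x.2.divisors : ℝ)]
    _ ≤ _ := sum_sum_divisorsAntidiagonal_le
      (F := fun a b => ((#a.divisors : ℝ) * (1 / a)) * (#b.divisors * (1 / b)))
      (fun _ _ => by positivity) N
    _ = (∑ a ∈ Icc 1 N, (#a.divisors : ℝ) * (1 / a)) ^ 2 := by
        rw [sq, sum_mul_sum]
    _ ≤ ((1 + Real.log N) ^ 2) ^ 2 := by
        gcongr
        exact sum_card_divisors_div_le N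
    _ = _ := by ring

theorem sum_natCast_mul_norm_sq_additiveChar_le {c : ℕ → ℂ} (hc : ∀ k, ‖c k‖ ≤ 1) {q : ℕ}
    (hq : 0 < q) {a : ℤ} (ha : IsCoprime a q) {θ : ℝ} (hθ : |θ - a / q| ≤ 1 / q ^ 2) {U N : ℕ}
    (hU : 0 < U) (hN : 0 < N) (hqN : q ≤ N) :
    ∑ h ∈ Ioc U N, (h : ℝ) *
        ‖∑ k ∈ Ioc U (N / U) with h * k ≤ N, c k * additiveChar (h * (k * θ))‖ ^ 2 ≤
      12 * N ^ 2 * (1 + Real.log N) ^ 2 * (2 / q + 3 / U + q / N) := by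
  have hS (k : ℕ) (hk : k ∈ Ioc U (N / U)) : 0 < k := (Nat.zero_le U).trans_lt (mem_Ioc.1 hk).1
  have hq' : (0 : ℝ) < q := Nat.cast_pos.2 hq
  have hU' : (0 : ℝ) < U := Nat.cast_pos.2 hU
  have hN' : (0 : ℝ) < N := Nat.cast_pos.2 hN
  have hlogN : 0 ≤ Real.log N := Real.log_natCast_nonneg N
  have hlog : Real.log q ≤ Real.log N := by gcongr
  set l := 1 + Real.log N with hl
  have hl1 : 1 ≤ l := by linarith
  have hsum : ∑ k ∈ Ioc U (N / U), (1 / k : ℝ) ≤ l := by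
    refine le_trans ?_ (sum_inv_natCast_le_one_add_log N)
    refine sum_le_sum_of_subset_of_nonneg ?_ fun _ _ _ => by positivity
    intro k hk
    exact mem_Icc.2 ⟨hS k hk, (mem_Ioc.1 hk).2.trans (Nat.div_le_self _ _)⟩
  have hcard : (#(Ioc U (N / U)) : ℝ) ≤ N / U := by
    rw [Nat.card_Ioc]
    refine le_trans ?_ (Nat.cast_div_le (α := ℝ))
    exact_mod_cast Nat.sub_le _ _
  calc _ ≤ _ := sum_natCast_mul_norm_sq_le hc θ U N hS
    _ ≤ _ := sum_sum_le_two_mul_sum_of_symm (fun _ _ => norm_nonneg _) (fun i j => by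
        rw [← RCLike.norm_conj, map_sum, max_comm]
        congr 1
        refine sum_congr rfl fun h _ => ?_
        rw [map_mul, ← additiveChar_neg, Complex.conj_natCast]
        congr 2
        ring) _
    _ ≤ 2 * ∑ k ∈ Ioc U (N / U), (12 * N ^ 2 / q * (1 / k) + 6 * N * l + 12 * N ^ 2 / U * (1 / k) +
          6 * N * q * l * (1 / k)) := by
        gcongr with k hk
        refine (sum_filter_le_norm_sum_additiveChar_le hq ha hθ U N hS hk).trans ?_
        have hk' : (0 : ℝ) < k := Nat.cast_pos.2 (hS k hk)
        have hUk : (U : ℝ) ≤ k := Nat.cast_le.2 (mem_Ioc.1 hk).1.le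
        calc _ ≤ 2 * ((N : ℝ) / k) * ((k / q + 1) * (3 * (2 * (N / k) + q * l))) := by
              gcongr
              linarith
          _ = 12 * N ^ 2 / q * (1 / k) + 6 * N * l + 12 * N ^ 2 / k * (1 / k) +
                6 * N * q * l * (1 / k) := by
              field_simp
              ring
          _ ≤ _ := by gcongr
    _ = 2 * ((12 * N ^ 2 / q + 12 * N ^ 2 / U + 6 * N * q * l) * ∑ k ∈ Ioc U (N / U), (1 / k : ℝ) +
          #(Ioc U (N / U)) * (6 * N * l)) := by
        congr 1
        rw [mul_sum, ← nsmul_eq_mul, ← sum_const, ← sum_add_distrib]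
        refine sum_congr rfl fun k _ => ?_
        ring
    _ ≤ 2 * ((12 * N ^ 2 / q + 12 * N ^ 2 / U + 6 * N * q * l) * l + N / U * (6 * N * l)) := by
        gcongr
    _ = 12 * N ^ 2 * l * (2 / q + 3 / U) + 12 * N ^ 2 * l ^ 2 * (q / N) := by
        field_simp
        ring
    _ ≤ 12 * N ^ 2 * l ^ 2 * (2 / q + 3 / U) + 12 * N ^ 2 * l ^ 2 * (q / N) := by
        gcongr
        exact le_self_pow₀ hl1 two_ne_zero
    _ = _ := by ring

/-- The Möbius function truncated to `[1, U]`. -/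
def moebiusLow (U : ℕ) : ArithmeticFunction ℤ :=
  ⟨fun n => if n ≤ U then ArithmeticFunction.moebius n else 0, by simp⟩

/-- The Möbius function truncated to `(U, ∞)`. -/
def moebiusHigh (U : ℕ) : ArithmeticFunction ℤ :=
  ⟨fun n => if n ≤ U then 0 else ArithmeticFunction.moebius n, by simp⟩

theorem moebiusLow_apply (U n : ℕ) :
    moebiusLow U n = if n ≤ U then ArithmeticFunction.moebius n else 0 := rfl

theorem moebiusHigh_apply (U n : ℕ) :
    moebiusHigh U n = if n ≤ U then 0 else ArithmeticFunction.moebius n := rfl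

theorem moebiusLow_add_moebiusHigh (U : ℕ) :
    moebiusLow U + moebiusHigh U = ArithmeticFunction.moebius := by
  ext n
  rw [ArithmeticFunction.add_apply, moebiusLow_apply, moebiusHigh_apply]
  split_ifs <;> simp

theorem norm_moebius_le_one (n : ℕ) : ‖(ArithmeticFunction.moebius n : ℂ)‖ ≤ 1 := by
  rw [Complex.norm_intCast]
  exact_mod_cast abs_moebius_le_one

theorem norm_moebiusLow_le (U n : ℕ) : ‖(moebiusLow U n : ℂ)‖ ≤ if n ≤ U then 1 else 0 := by
  rw [moebiusLow_apply]
  split_ifs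
  · exact norm_moebius_le_one n
  · simp

theorem abs_moebiusHigh_le (U n : ℕ) : |moebiusHigh U n| ≤ 1 := by
  rw [moebiusHigh_apply]
  split_ifs
  · simp
  · exact abs_moebius_le_one

/-- Vaughan's identity for the Möbius function. -/
theorem moebius_eq_vaughan (U : ℕ) : ArithmeticFunction.moebius =
    2 * moebiusLow U - moebiusLow U * (moebiusLow U * (zeta : ArithmeticFunction ℤ)) +
      moebiusHigh U * (zeta : ArithmeticFunction ℤ) * moebiusHigh U := by
  have h1 := moebiusLow_add_moebiusHigh U
  have h2 := moebius_mul_coe_zeta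
  rw [← h1] at h2 ⊢
  linear_combination (moebiusLow U - moebiusHigh U) * h2

theorem norm_moebiusHigh_mul_zeta_le (U n : ℕ) :
    ‖((moebiusHigh U * (zeta : ArithmeticFunction ℤ)) n : ℂ)‖ ≤ #n.divisors := by
  rw [coe_mul_zeta_apply, Complex.norm_intCast]
  have h : |∑ d ∈ n.divisors, moebiusHigh U d| ≤ #n.divisors :=
    (abs_sum_le_sum_abs _ _).trans ((sum_le_sum fun d _ => abs_moebiusHigh_le U d).trans (by simp))
  exact_mod_cast h

theorem moebiusHigh_mul_zeta_eq_zero {U n : ℕ} (hn : n ≤ U) :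
    (moebiusHigh U * (zeta : ArithmeticFunction ℤ)) n = 0 := by
  rw [coe_mul_zeta_apply]
  refine sum_eq_zero fun d hd => ?_
  rw [moebiusHigh_apply, if_pos ((Nat.divisor_le hd).trans hn)]

theorem sum_mul_apply_mul_eq (f g : ArithmeticFunction ℤ) (F : ℕ → ℂ) (N : ℕ) :
    ∑ n ∈ Ioc 0 N, ((f * g) n : ℂ) * F n =
      ∑ a ∈ Ioc 0 N, (f a : ℂ) * ∑ b ∈ Ioc 0 N with a * b ≤ N, (g b : ℂ) * F (a * b) := by
  trans ∑ n ∈ Ioc 0 N, ∑ x ∈ Ioc 0 N ×ˢ Ioc 0 N with x.1 * x.2 = n,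
    (f x.1 : ℂ) * (g x.2 * F (x.1 * x.2))
  · refine sum_congr rfl fun n hn => ?_
    simp only [mem_Ioc] at hn
    rw [mul_apply, Nat.divisorsAntidiagonal_eq_prod_filter_of_le hn.1.ne' hn.2]
    push_cast
    rw [sum_mul]
    refine sum_congr rfl fun x hx => ?_
    rw [(mem_filter.1 hx).2, mul_assoc]
  · simp_rw [sum_filter, mul_sum]
    rw [sum_comm, sum_product]
    refine sum_congr rfl fun a ha => sum_congr rfl fun b hb => ?_
    rw [sum_ite_eq]
    simp only [mem_Ioc] at ha hb ⊢
    have : 0 < a * b := Nat.mul_pos ha.1 hb.1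
    by_cases h : a * b ≤ N <;> simp [h, this]

theorem filter_mul_le_eq_Ioc {a : ℕ} (ha : 0 < a) (N : ℕ) :
    {b ∈ Ioc 0 N | a * b ≤ N} = Ioc 0 (N / a) := by
  ext b
  rw [mem_filter, mem_Ioc, mem_Ioc, Nat.le_div_iff_mul_le ha, mul_comm b a]
  refine ⟨fun h => ⟨h.1.1, h.2⟩, fun h => ⟨⟨h.1, ?_⟩, h.2⟩⟩
  exact (Nat.le_mul_of_pos_left b ha).trans h.2

theorem le_fract_and_le_one_sub_fract {q : ℕ} (hq : 0 < q) {a : ℤ} (ha : IsCoprime a q) {θ : ℝ}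
    (hθ : |θ - a / q| ≤ 1 / q ^ 2) {d : ℕ} (hd : 0 < d) (hdq : 2 * d ≤ q) :
    1 / (2 * q : ℝ) ≤ Int.fract (d * θ) ∧ 1 / (2 * q : ℝ) ≤ 1 - Int.fract (d * θ) := by
  have hq' : (0 : ℝ) < q := Nat.cast_pos.2 hq
  have hnd : ¬ (q : ℤ) ∣ d * a := by
    intro h
    have h1 : (q : ℤ) ∣ d := ha.symm.dvd_of_dvd_mul_right h
    have h2 := Nat.le_of_dvd hd (Int.natCast_dvd_natCast.1 h1)
    omega
  have hdist (k : ℤ) : 1 / (2 * q : ℝ) ≤ |d * θ - k| := by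
    have h1 : (1 : ℝ) ≤ |(d * a - k * q : ℤ)| := by
      have : d * a - k * q ≠ 0 := by
        intro h
        exact hnd ⟨k, by linarith⟩
      exact_mod_cast Int.one_le_abs this
    have h2 : (1 : ℝ) / q ≤ |d * (a / q : ℝ) - k| := by
      have e : d * (a / q : ℝ) - k = (d * a - k * q : ℤ) / (q : ℝ) := by
        push_cast
        field_simp
      rw [e, abs_div, abs_of_pos hq', Int.cast_abs.symm]
      gcongr
    have h3 : |d * (θ - a / q)| ≤ 1 / (2 * q : ℝ) := by
      rw [abs_mul, abs_of_nonneg (Nat.cast_nonneg d)]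
      have h4 : (2 * d : ℝ) ≤ q := by exact_mod_cast hdq
      calc (d : ℝ) * |θ - a / q| ≤ q / 2 * (1 / q ^ 2) := by
            gcongr
            linarith
        _ = _ := by
            field_simp
    have h5 : d * (a / q : ℝ) - k = (d * θ - k) - d * (θ - a / q) := by ring
    have h6 : (1 : ℝ) / q = 1 / (2 * q) + 1 / (2 * q) := by
      field_simp
      norm_num
    have h7 := abs_sub (d * θ - k) (d * (θ - a / q))
    rw [h5] at h2
    linarith
  constructor
  · have := hdist ⌊d * θ⌋
    rwa [Int.self_sub_floor, abs_of_nonneg (Int.fract_nonneg _)] at this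
  · have := hdist (⌊d * θ⌋ + 1)
    push_cast at this
    rw [← sub_sub, Int.self_sub_floor, abs_sub_comm,
      abs_of_nonneg (by linarith [Int.fract_lt_one (d * θ)])] at this
    exact this

/-- The type I sums in Vaughan's identity. -/
theorem norm_typeOne_le {q : ℕ} {a : ℤ} (ha : IsCoprime a q) {θ : ℝ}
    (hθ : |θ - a / q| ≤ 1 / q ^ 2) {U : ℕ} (N : ℕ) (hU : 0 < U) (hUq : 2 * U ^ 2 ≤ q) :
    ‖∑ n ∈ Ioc 0 N, ((moebiusLow U * (moebiusLow U * (zeta : ArithmeticFunction ℤ))) n : ℂ) *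
      additiveChar (n * θ)‖ ≤ U ^ 2 * q := by
  have hU2 : 0 < U ^ 2 := by positivity
  have hq : 0 < q := by omega
  have hq' : (0 : ℝ) < q := Nat.cast_pos.2 hq
  have hcount : ∑ d ∈ Ioc 0 N, (if d ≤ U then 1 else 0 : ℝ) ≤ U := by
    rw [sum_boole]
    have h1 : {d ∈ Ioc 0 N | d ≤ U} ⊆ Ioc 0 U := by
      intro d hd
      simp only [mem_filter, mem_Ioc] at hd ⊢
      omega
    have := card_le_card h1
    rw [Nat.card_Ioc] at this
    exact_mod_cast this
  have hinner (d : ℕ) (hd : 0 < d) (hdU : d ≤ U) (e : ℕ) (he : 0 < e) (heU : e ≤ U) (M : ℕ) :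
      ‖∑ b ∈ Ioc 0 M with e * b ≤ M, ((zeta : ArithmeticFunction ℤ) b : ℂ) *
        additiveChar ((d * (e * b) : ℕ) * θ)‖ ≤ q := by
    rw [filter_mul_le_eq_Ioc he]
    have hde : d * e ≤ U ^ 2 := by
      rw [sq]
      exact Nat.mul_le_mul hdU heU
    obtain ⟨h1, h2⟩ := le_fract_and_le_one_sub_fract hq ha hθ (Nat.mul_pos hd he)
      (by omega)
    have h3 := norm_sum_additiveChar_le_inv 0 (M / e) (by positivity) h1 h2
    calc _ = ‖∑ b ∈ Ioc 0 (M / e), additiveChar (b * ((d * e : ℕ) * θ))‖ := by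
          congr 1
          refine sum_congr rfl fun b hb => ?_
          rw [natCoe_apply, zeta_apply_ne (mem_Ioc.1 hb).1.ne']
          push_cast
          rw [one_mul]
          congr 1
          ring
      _ ≤ _ := h3
      _ = q := by field_simp
  rw [sum_mul_apply_mul_eq]
  calc _ ≤ ∑ d ∈ Ioc 0 N, (if d ≤ U then 1 else 0 : ℝ) * (U * q) := by
        refine norm_sum_le_of_le _ fun d hd => ?_
        rw [norm_mul]
        by_cases hdU : d ≤ U
        · refine mul_le_mul (norm_moebiusLow_le U d) ?_ (norm_nonneg _) (by positivity)
          have hd0 := (mem_Ioc.1 hd).1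
          rw [filter_mul_le_eq_Ioc hd0,
            sum_mul_apply_mul_eq _ _ (fun n => additiveChar ((d * n : ℕ) * θ))]
          calc _ ≤ ∑ e ∈ Ioc 0 (N / d), (if e ≤ U then 1 else 0 : ℝ) * q := by
                refine norm_sum_le_of_le _ fun e he => ?_
                rw [norm_mul]
                by_cases heU : e ≤ U
                · exact mul_le_mul (norm_moebiusLow_le U e)
                    (hinner d hd0 hdU e (mem_Ioc.1 he).1 heU _) (norm_nonneg _) (by positivity)
                · simp [moebiusLow_apply, heU]
            _ ≤ ∑ e ∈ Ioc 0 N, (if e ≤ U then 1 else 0 : ℝ) * q := by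
                refine sum_le_sum_of_subset_of_nonneg
                  (Ioc_subset_Ioc_right (Nat.div_le_self _ _)) fun _ _ _ => by positivity
            _ ≤ _ := by
                rw [← sum_mul]
                gcongr
        · simp [moebiusLow_apply, hdU]
    _ ≤ U * (U * q) := by
        rw [← sum_mul]
        gcongr
    _ = _ := by ring

/-- The type II sums in Vaughan's identity. -/
theorem norm_typeTwo_sq_le {q : ℕ} (hq : 0 < q) {a : ℤ} (ha : IsCoprime a q) {θ : ℝ}
    (hθ : |θ - a / q| ≤ 1 / q ^ 2) {U N : ℕ} (hU : 0 < U) (hN : 0 < N) (hqN : q ≤ N) :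
    ‖∑ n ∈ Ioc 0 N,
      ((moebiusHigh U * (zeta : ArithmeticFunction ℤ) * moebiusHigh U) n : ℂ) *
        additiveChar (n * θ)‖ ^ 2 ≤
      12 * N ^ 2 * (1 + Real.log N) ^ 6 * (2 / q + 3 / U + q / N) := by
  set g := moebiusHigh U * (zeta : ArithmeticFunction ℤ) with hg
  set A : ℕ → ℂ := fun h => ∑ k ∈ Ioc U (N / U) with h * k ≤ N,
    (moebiusHigh U k : ℂ) * additiveChar (h * (k * θ)) with hA
  have hc (k : ℕ) : ‖(moebiusHigh U k : ℂ)‖ ≤ 1 := by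
    rw [Complex.norm_intCast]
    exact_mod_cast abs_moebiusHigh_le U k
  have h1 : ∑ n ∈ Ioc 0 N, ((g * moebiusHigh U) n : ℂ) * additiveChar (n * θ) =
      ∑ h ∈ Ioc U N, (g h : ℂ) * A h := by
    rw [sum_mul_apply_mul_eq g (moebiusHigh U) (fun n => additiveChar (n * θ))]
    symm
    refine sum_subset_zero_on_sdiff (Ioc_subset_Ioc_left (Nat.zero_le U)) ?_ ?_
    · intro h hh
      simp only [mem_sdiff, mem_Ioc] at hh
      rw [hg, moebiusHigh_mul_zeta_eq_zero (by omega)]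
      simp
    · intro h hh
      congr 1
      rw [hA]
      simp only [sum_filter]
      refine sum_subset_zero_on_sdiff
        (Ioc_subset_Ioc (Nat.zero_le U) (Nat.div_le_self _ _)) ?_ ?_
      · intro k hk
        simp only [mem_sdiff, mem_Ioc, not_and, not_le] at hk
        split_ifs with hhk
        · have h2 : k ≤ U := by
            by_contra! h3
            have h4 := hk.2 h3
            rw [Nat.div_lt_iff_lt_mul hU] at h4
            have h5 : k * U ≤ h * k := by
              rw [mul_comm h k]
              exact Nat.mul_le_mul_left k (mem_Ioc.1 hh).1.le
            omega
          rw [moebiusHigh_apply, if_pos h2]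
          simp
        · rfl
      · intro k _
        push_cast
        rw [mul_assoc (h : ℝ) k θ]
  have h2 : ‖∑ h ∈ Ioc U N, (g h : ℂ) * A h‖ ^ 2 ≤
      (∑ h ∈ Ioc U N, (#h.divisors : ℝ) ^ 2 / h) * ∑ h ∈ Ioc U N, (h : ℝ) * ‖A h‖ ^ 2 := by
    calc _ ≤ (∑ h ∈ Ioc U N, (#h.divisors : ℝ) * ‖A h‖) ^ 2 := by
          gcongr
          refine norm_sum_le_of_le _ fun h _ => ?_
          rw [norm_mul]
          gcongr
          exact norm_moebiusHigh_mul_zeta_le U h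
      _ ≤ _ := by
          refine sum_sq_le_sum_mul_sum_of_sq_le_mul _ (fun _ _ => by positivity)
            (fun _ _ => by positivity) fun h hh => ?_
          have hh' : (h : ℝ) ≠ 0 := by
            have := (mem_Ioc.1 hh).1
            exact Nat.cast_ne_zero.2 (by omega)
          refine le_of_eq ?_
          field_simp
  have h3 : ∑ h ∈ Ioc U N, (#h.divisors : ℝ) ^ 2 / h ≤ (1 + Real.log N) ^ 4 := by
    refine le_trans ?_ (sum_card_divisors_sq_div_le N)
    rw [Icc_one_eq_Ioc_zero]
    exact sum_le_sum_of_subset_of_nonneg (Ioc_subset_Ioc_left (Nat.zero_le U))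
      fun _ _ _ => by positivity
  have h4 := sum_natCast_mul_norm_sq_additiveChar_le hc hq ha hθ hU hN hqN
  rw [h1]
  calc _ ≤ _ := h2
    _ ≤ (1 + Real.log N) ^ 4 * (12 * N ^ 2 * (1 + Real.log N) ^ 2 * (2 / q + 3 / U + q / N)) := by
        gcongr
    _ = _ := by ring

theorem norm_sum_moebius_mul_additiveChar_le {q : ℕ} {a : ℤ} (ha : IsCoprime a q) {θ : ℝ}
    (hθ : |θ - a / q| ≤ 1 / q ^ 2) {U N : ℕ} (hU : 0 < U) (hN : 0 < N) (hqN : q ≤ N)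
    (hUq : 2 * U ^ 2 ≤ q) :
    ‖∑ n ∈ Icc 1 N, (ArithmeticFunction.moebius n : ℂ) * additiveChar (n * θ)‖ ≤
      2 * U + U ^ 2 * q +
        √(12 * N ^ 2 * (1 + Real.log N) ^ 6 * (2 / q + 3 / U + q / N)) := by
  have hU2 : 0 < U ^ 2 := by positivity
  have hq : 0 < q := by omega
  have h1 := norm_typeOne_le ha hθ N hU hUq
  have h2 := Real.le_sqrt_of_sq_le (norm_typeTwo_sq_le hq ha hθ hU hN hqN)
  have h3 : ‖∑ n ∈ Ioc 0 N, (moebiusLow U n : ℂ) * additiveChar (n * θ)‖ ≤ U := by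
    calc _ ≤ ∑ n ∈ Ioc 0 N, (if n ≤ U then 1 else 0 : ℝ) := by
          refine norm_sum_le_of_le _ fun n _ => ?_
          rw [norm_mul, norm_additiveChar, mul_one]
          exact norm_moebiusLow_le U n
      _ ≤ U := by
          rw [sum_boole]
          have h1 : {d ∈ Ioc 0 N | d ≤ U} ⊆ Ioc 0 U := by
            intro d hd
            simp only [mem_filter, mem_Ioc] at hd ⊢
            omega
          have := card_le_card h1
          rw [Nat.card_Ioc] at this
          exact_mod_cast this
  rw [Icc_one_eq_Ioc_zero]
  have h4 : ∑ n ∈ Ioc 0 N, (ArithmeticFunction.moebius n : ℂ) * additiveChar (n * θ) =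
      2 * ∑ n ∈ Ioc 0 N, (moebiusLow U n : ℂ) * additiveChar (n * θ) -
      ∑ n ∈ Ioc 0 N, ((moebiusLow U * (moebiusLow U * (zeta : ArithmeticFunction ℤ))) n : ℂ) *
        additiveChar (n * θ) +
      ∑ n ∈ Ioc 0 N, ((moebiusHigh U * (zeta : ArithmeticFunction ℤ) * moebiusHigh U) n : ℂ) *
        additiveChar (n * θ) := by
    rw [mul_sum, ← sum_sub_distrib, ← sum_add_distrib]
    refine sum_congr rfl fun n _ => ?_
    have h5 : ArithmeticFunction.moebius n = 2 * moebiusLow U n -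
        (moebiusLow U * (moebiusLow U * (zeta : ArithmeticFunction ℤ))) n +
        (moebiusHigh U * (zeta : ArithmeticFunction ℤ) * moebiusHigh U) n := by
      conv_lhs => rw [moebius_eq_vaughan U]
      rw [two_mul]
      simp only [ArithmeticFunction.add_apply, sub_eq_add_neg, ArithmeticFunction.neg_apply]
      ring
    rw [h5]
    push_cast
    ring
  rw [h4]
  refine (norm_add_le _ _).trans (add_le_add ((norm_sub_le _ _).trans (add_le_add ?_ h1)) h2)
  rw [norm_mul, Complex.norm_ofNat]
  gcongr

theorem norm_sum_moebius_mul_additiveChar_le_self (N : ℕ) (θ : ℝ) :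
    ‖∑ n ∈ Icc 1 N, (ArithmeticFunction.moebius n : ℂ) * additiveChar (n * θ)‖ ≤ N := by
  refine (norm_sum_le_of_le (n := fun _ => (1 : ℝ)) _ fun n _ => ?_).trans (by simp)
  rw [norm_mul, norm_additiveChar, mul_one]
  exact norm_moebius_le_one n

theorem norm_sum_moebius_mul_additiveChar_le_of_large_denominator {q : ℕ} {a : ℤ}
    (ha : IsCoprime a q) {θ : ℝ} (hθ : |θ - a / q| ≤ 1 / q ^ 2) {N : ℕ} (hN : 2 ≤ Real.log N)
    (hq : Real.log N ^ 24 ≤ q) (hqN : q ≤ N / Real.log N ^ 24) :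
    ‖∑ n ∈ Icc 1 N, (ArithmeticFunction.moebius n : ℂ) * additiveChar (n * θ)‖ ≤
      87 * (N / Real.log N ^ 2) := by
  set L := Real.log N with hL
  have hL1 : 1 ≤ L := by linarith
  have hL0 : 0 < L := by linarith
  have hN0 : 0 < N := by
    rcases Nat.eq_zero_or_pos N with h | h
    · simp [hL, h] at hL0
    · exact h
  have hN' : (0 : ℝ) < N := Nat.cast_pos.2 hN0
  have hq0 : (0 : ℝ) < q := lt_of_lt_of_le (by positivity) hq
  set U := ⌊L ^ 10⌋₊ with hU
  have hU1 : (U : ℝ) ≤ L ^ 10 := Nat.floor_le (by positivity)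
  have hU2 : L ^ 10 < U + 1 := Nat.lt_floor_add_one _
  have hU3 : 0 < U := Nat.floor_pos.2 (one_le_pow₀ hL1)
  have hU3' : (1 : ℝ) ≤ U := by exact_mod_cast hU3
  have hU4 : L ^ 10 / 2 ≤ U := by linarith
  have hUsq : (U : ℝ) ^ 2 ≤ L ^ 20 := by
    calc (U : ℝ) ^ 2 ≤ (L ^ 10) ^ 2 := by gcongr
      _ = _ := by ring
  have hUq : 2 * U ^ 2 ≤ q := by
    have h1 : (2 : ℝ) * U ^ 2 ≤ q := by
      calc (2 : ℝ) * U ^ 2 ≤ L ^ 4 * L ^ 20 := by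
            gcongr
            calc (2 : ℝ) ≤ L := hN
              _ ≤ L ^ 4 := le_self_pow₀ hL1 (by norm_num)
        _ = L ^ 24 := by ring
        _ ≤ q := hq
    exact_mod_cast h1
  have hqN2 : q ≤ N := by
    have : (q : ℝ) ≤ N := hqN.trans (div_le_self hN'.le (one_le_pow₀ hL1))
    exact_mod_cast this
  refine (norm_sum_moebius_mul_additiveChar_le ha hθ hU3 hN0 hqN2 hUq).trans ?_
  have hI : 2 * U + U ^ 2 * q ≤ 3 * (N / L ^ 2) := by
    have hq1 : (1 : ℝ) ≤ q := by
      have : 0 < q := by exact_mod_cast hq0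
      exact_mod_cast this
    calc (2 * U + U ^ 2 * q : ℝ) ≤ 2 * (U ^ 2 * q) + U ^ 2 * q := by
          gcongr
          nlinarith [mul_le_mul hU3' hq1 zero_le_one (by linarith)]
      _ = 3 * (U ^ 2 * q) := by ring
      _ ≤ 3 * (L ^ 20 * (N / L ^ 24)) := by gcongr
      _ = 3 * (N / L ^ 4) := by field_simp
      _ ≤ 3 * (N / L ^ 2) := by
        gcongr
        norm_num
  have hII : √(12 * N ^ 2 * (1 + L) ^ 6 * (2 / q + 3 / U + q / N)) ≤ 84 * (N / L ^ 2) := by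
    refine Real.sqrt_le_iff.2 ⟨by positivity, ?_⟩
    have e0 : L ^ 10 ≤ L ^ 24 := pow_le_pow_right₀ hL1 (by norm_num)
    have e1 : (2 : ℝ) / q ≤ 2 / L ^ 10 := by
      gcongr
      exact e0.trans hq
    have e2 : (3 : ℝ) / U ≤ 3 / (L ^ 10 / 2) := by gcongr
    have e3 : (q : ℝ) / N ≤ 1 / L ^ 10 := by
      rw [div_le_iff₀ hN']
      refine hqN.trans ?_
      rw [one_div_mul_eq_div]
      gcongr
    calc _ ≤ 12 * N ^ 2 * (L + L) ^ 6 * (2 / L ^ 10 + 3 / (L ^ 10 / 2) + 1 / L ^ 10) := by gcongr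
      _ = 6912 * (N / L ^ 2) ^ 2 := by
        field_simp
        ring
      _ ≤ 7056 * (N / L ^ 2) ^ 2 := by
        gcongr
        norm_num
      _ = _ := by ring
  linarith

/-- Davenport's theorem, with two powers of the logarithm. -/
theorem exists_norm_sum_moebius_mul_additiveChar_le :
    ∃ C : ℝ, 0 < C ∧ ∀ (N : ℕ) (θ : ℝ), 2 ≤ N →
      ‖∑ n ∈ Icc 1 N, (ArithmeticFunction.moebius n : ℂ) * additiveChar (n * θ)‖ ≤
        C * (N / Real.log N ^ 2) := by
  obtain ⟨C, hC, hmajor⟩ := exists_norm_sum_moebius_mul_additiveChar_near_rational_le 98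
  refine ⟨4 + (48).factorial + 87 + C * (1 + 2 * Real.pi), by positivity, fun N θ hN => ?_⟩
  set L := Real.log N with hL
  have hN' : (0 : ℝ) < N := by positivity
  have hL0 : 0 < L := Real.log_pos (by exact_mod_cast hN)
  have hD : 0 ≤ N / L ^ 2 := by positivity
  have hpi := Real.pi_pos
  have htrivial {K : ℝ} (hK : L ^ 2 ≤ K) :
      ‖∑ n ∈ Icc 1 N, (ArithmeticFunction.moebius n : ℂ) * additiveChar (n * θ)‖ ≤
        K * (N / L ^ 2) := by
    refine (norm_sum_moebius_mul_additiveChar_le_self N θ).trans ?_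
    calc (N : ℝ) = L ^ 2 * (N / L ^ 2) := by field_simp
      _ ≤ _ := by gcongr
  rcases lt_or_ge L 2 with hL2 | hL2
  · refine (htrivial (K := 4) (by nlinarith)).trans ?_
    gcongr
    have : 0 ≤ C * (1 + 2 * Real.pi) := by positivity
    have : (0 : ℝ) ≤ (48).factorial := Nat.cast_nonneg _
    linarith
  have hL1 : 1 ≤ L := by linarith
  rcases lt_or_ge (N : ℝ) (L ^ 24) with hsmall | hlarge
  · have h1 := log_pow_le_factorial_mul (by omega : 1 ≤ N) 48
    have h2 : L ^ 24 ≤ (48).factorial := by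
      refine le_of_mul_le_mul_right ?_ (by positivity : 0 < L ^ 24)
      calc L ^ 24 * L ^ 24 = L ^ 48 := by ring
        _ ≤ ((48).factorial : ℝ) * N := h1
        _ ≤ _ := by gcongr
    refine (htrivial ((pow_le_pow_right₀ hL1 (by norm_num)).trans h2)).trans ?_
    gcongr
    have : 0 ≤ C * (1 + 2 * Real.pi) := by positivity
    linarith
  have hQ : 0 < ⌊N / L ^ 24⌋₊ := by
    rw [Nat.floor_pos, le_div_iff₀ (by positivity)]
    linarith
  obtain ⟨r, hr, hrQ⟩ := Real.exists_rat_abs_sub_le_and_den_le θ hQ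
  have hq0 : (0 : ℝ) < r.den := Nat.cast_pos.2 r.den_pos
  have hcop : IsCoprime r.num (r.den : ℤ) := Rat.isCoprime_num_den r
  have hqN : (r.den : ℝ) ≤ N / L ^ 24 :=
    (Nat.cast_le.2 hrQ).trans (Nat.floor_le (by positivity))
  have hQ' : N / L ^ 24 < (⌊N / L ^ 24⌋₊ : ℝ) + 1 := Nat.lt_floor_add_one _
  rw [Rat.cast_def] at hr
  rcases le_or_gt (r.den : ℝ) (L ^ 24) with hq | hq
  · have : NeZero r.den := ⟨r.den_nz⟩
    have h1 := hmajor r.den r.num (θ - r.num / r.den) N hN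
    rw [add_sub_cancel] at h1
    refine h1.trans ?_
    have hβ : |θ - r.num / r.den| * N ≤ L ^ 24 := by
      have hq1 : (1 : ℝ) ≤ r.den := by exact_mod_cast r.den_pos
      calc |θ - r.num / r.den| * N ≤ 1 / ((N / L ^ 24) * 1) * N := by
            gcongr
            refine hr.trans ?_
            gcongr
        _ = L ^ 24 := by field_simp
    calc C * r.den ^ 3 * (1 + 2 * Real.pi * |θ - r.num / r.den| * N) * (N / L ^ 98)
        ≤ C * (L ^ 24) ^ 3 * (L ^ 24 + 2 * Real.pi * L ^ 24) * (N / L ^ 98) := by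
          rw [mul_assoc (2 * Real.pi)]
          gcongr
          exact one_le_pow₀ hL1
      _ = C * (1 + 2 * Real.pi) * (N / L ^ 2) := by
          field_simp
      _ ≤ _ := by
          gcongr
          have : (0 : ℝ) ≤ (48).factorial := Nat.cast_nonneg _
          linarith
  · have hθ : |θ - r.num / r.den| ≤ 1 / (r.den : ℝ) ^ 2 := by
      refine hr.trans ?_
      rw [sq]
      gcongr
      linarith
    refine (norm_sum_moebius_mul_additiveChar_le_of_large_denominator hcop hθ hL2 hq.le hqN).trans
      ?_
    gcongr
    have : 0 ≤ C * (1 + 2 * Real.pi) := by positivity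
    have : (0 : ℝ) ≤ (48).factorial := Nat.cast_nonneg _
    linarith

theorem sum_range_additiveChar {M : ℕ} (hM : 0 < M) (j : ℤ) :
    ∑ t ∈ range M, additiveChar (j * (t / M : ℝ)) = if (M : ℤ) ∣ j then (M : ℂ) else 0 := by
  have hM' : (M : ℝ) ≠ 0 := Nat.cast_ne_zero.2 hM.ne'
  split_ifs with h
  · obtain ⟨k, rfl⟩ := h
    rw [sum_congr rfl (g := fun _ => (1 : ℂ)) (fun t _ => ?_)]
    · simp
    · rw [← additiveChar_intCast (k * t)]
      congr 1
      push_cast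
      field_simp
  · set z := additiveChar (j / M : ℝ) with hz
    have hz1 : z ≠ 1 := by
      intro h1
      rw [hz, additiveChar, Complex.exp_eq_one_iff] at h1
      obtain ⟨n, hn⟩ := h1
      refine h ⟨n, ?_⟩
      have h2 : (n : ℂ) * (2 * Real.pi * Complex.I) =
          ((j / M : ℝ) : ℂ) * (2 * Real.pi * Complex.I) := by
        rw [← hn]
        push_cast
        ring
      have h3 := mul_right_cancel₀ Complex.two_pi_I_ne_zero h2
      have h4 : (n : ℝ) = j / M := by exact_mod_cast h3
      rw [eq_div_iff hM'] at h4
      have h5 : n * M = j := by exact_mod_cast h4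
      rw [← h5, mul_comm]
    have h1 : ∑ t ∈ range M, additiveChar (j * (t / M : ℝ)) = ∑ t ∈ range M, z ^ t := by
      refine sum_congr rfl fun t _ => ?_
      rw [hz, ← additiveChar_natCast_mul]
      congr 1
      ring
    have h2 : z ^ M = 1 := by
      rw [hz, ← additiveChar_natCast_mul, mul_div_cancel₀ _ hM', additiveChar_intCast]
    rw [h1, geom_sum_eq hz1, h2, sub_self, zero_div]

theorem sum_range_norm_sq_eq {M K : ℕ} (hM : 0 < M) (hK : K ≤ M) (b : ℕ → ℂ) :
    ∑ t ∈ range M, ‖∑ m ∈ Icc 1 K, b m * additiveChar (m * (t / M : ℝ))‖ ^ 2 =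
      M * ∑ m ∈ Icc 1 K, ‖b m‖ ^ 2 := by
  have h1 : ((∑ t ∈ range M, ‖∑ m ∈ Icc 1 K, b m * additiveChar (m * (t / M : ℝ))‖ ^ 2 : ℝ) : ℂ) =
      ((M * ∑ m ∈ Icc 1 K, ‖b m‖ ^ 2 : ℝ) : ℂ) := by
    push_cast
    simp_rw [← Complex.mul_conj', map_sum, sum_mul_sum, mul_sum]
    rw [sum_comm]
    refine sum_congr rfl fun m hm => ?_
    rw [sum_comm]
    calc _ = ∑ n ∈ Icc 1 K, b m * starRingEnd ℂ (b n) * if n = m then (M : ℂ) else 0 := by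
          refine sum_congr rfl fun n hn => ?_
          have h2 : (n = m) ↔ (M : ℤ) ∣ (m : ℤ) - n := by
            simp only [mem_Icc] at hm hn
            constructor
            · rintro rfl
              simp
            · intro h
              have h3 := Int.eq_zero_of_abs_lt_dvd h (by rw [abs_lt]; constructor <;> omega)
              omega
          rw [if_congr h2 rfl rfl, ← sum_range_additiveChar hM, mul_sum]
          refine sum_congr rfl fun t _ => ?_
          have h3 : additiveChar (((m : ℤ) - n : ℤ) * (t / M : ℝ)) =
              additiveChar (m * (t / M : ℝ)) *
                starRingEnd ℂ (additiveChar (n * (t / M : ℝ))) := by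
            rw [← additiveChar_neg, ← additiveChar_add]
            congr 1
            push_cast
            ring
          rw [h3, map_mul]
          ring
      _ = _ := by
          simp only [mul_ite, mul_zero]
          rw [sum_ite_eq' _ m, if_pos hm]
          ring
  exact_mod_cast h1

/-- Self-correlations are controlled on average by the exponential sums. -/
theorem sum_abs_selfCorrelation_le {f : ℕ → ℝ} (hf : ∀ n, |f n| ≤ 1) {N : ℕ} (hN : 0 < N) {B : ℝ}
    (hB : ∀ θ : ℝ, ‖∑ n ∈ Icc 1 N, (f n : ℂ) * additiveChar (n * θ)‖ ≤ B) :
    ∑ n ∈ Icc 1 N, |∑ k ∈ Icc 1 N, f k * f (k + n)| ≤ 3 / 2 * B * N := by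
  have hB0 : 0 ≤ B := (norm_nonneg _).trans (hB 0)
  obtain ⟨ε, hε, hεc⟩ : ∃ ε : ℕ → ℝ, (∀ n, |ε n| = 1) ∧
      ∀ n, ε n * ∑ k ∈ Icc 1 N, f k * f (k + n) = |∑ k ∈ Icc 1 N, f k * f (k + n)| := by
    refine ⟨fun n => if 0 ≤ ∑ k ∈ Icc 1 N, f k * f (k + n) then 1 else -1, fun n => ?_,
      fun n => ?_⟩
    · dsimp only
      split_ifs <;> simp
    · dsimp only
      split_ifs with h
      · rw [abs_of_nonneg h, one_mul]
      · rw [abs_of_neg (not_le.1 h), neg_one_mul]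
  set M := 2 * N with hM
  have hM0 : 0 < M := by omega
  have hM' : (0 : ℝ) < M := Nat.cast_pos.2 hM0
  set S : ℕ → ℂ := fun t => ∑ k ∈ Icc 1 N, (f k : ℂ) * additiveChar (k * (t / M : ℝ)) with hS
  set T : ℕ → ℂ := fun t => ∑ m ∈ Icc 1 M, (f m : ℂ) * additiveChar (m * (t / M : ℝ)) with hT
  set E : ℕ → ℂ := fun t => ∑ n ∈ Icc 1 N, (ε n : ℂ) * additiveChar (n * (t / M : ℝ)) with hE
  have hkey : ((M * ∑ n ∈ Icc 1 N, |∑ k ∈ Icc 1 N, f k * f (k + n)| : ℝ) : ℂ) =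
      ∑ t ∈ range M, starRingEnd ℂ (E t) * (starRingEnd ℂ (S t) * T t) := by
    simp_rw [← hεc]
    push_cast
    simp_rw [hE, hS, hT, map_sum, sum_mul_sum, mul_sum]
    symm
    rw [sum_comm]
    refine sum_congr rfl fun n hn => ?_
    rw [sum_comm]
    refine sum_congr rfl fun k hk => ?_
    rw [sum_comm]
    calc _ = ∑ m ∈ Icc 1 M, (ε n : ℂ) * f k * f m * if m = k + n then (M : ℂ) else 0 := by
          refine sum_congr rfl fun m hm => ?_
          have h2 : (m = k + n) ↔ (M : ℤ) ∣ (m : ℤ) - k - n := by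
            simp only [mem_Icc] at hm hn hk
            constructor
            · rintro rfl
              simp
            · intro h
              have h3 := Int.eq_zero_of_abs_lt_dvd h (by rw [abs_lt]; constructor <;> omega)
              omega
          rw [if_congr h2 rfl rfl, ← sum_range_additiveChar hM0, mul_sum]
          refine sum_congr rfl fun t _ => ?_
          have h3 : additiveChar (((m : ℤ) - k - n : ℤ) * (t / M : ℝ)) =
              starRingEnd ℂ (additiveChar (n * (t / M : ℝ))) *
                starRingEnd ℂ (additiveChar (k * (t / M : ℝ))) *
                additiveChar (m * (t / M : ℝ)) := by
            rw [← additiveChar_neg, ← additiveChar_neg, ← additiveChar_add, ← additiveChar_add]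
            congr 1
            push_cast
            ring
          rw [h3, map_mul, map_mul, Complex.conj_ofReal, Complex.conj_ofReal]
          ring
      _ = _ := by
          have h4 : k + n ∈ Icc 1 M := by
            simp only [mem_Icc] at hn hk ⊢
            omega
          simp only [mul_ite, mul_zero]
          rw [sum_ite_eq' _ (k + n), if_pos h4]
          ring
  have hTE : ∑ t ∈ range M, ‖E t‖ * ‖T t‖ ≤ M * (3 / 2 * N) := by
    have h1 := sum_range_norm_sq_eq hM0 (by omega : N ≤ M) (fun n => (ε n : ℂ))
    have h2 := sum_range_norm_sq_eq hM0 le_rfl (fun n => (f n : ℂ))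
    have h3 : ∑ m ∈ Icc 1 N, ‖(ε m : ℂ)‖ ^ 2 = N := by
      simp [hε]
    have h4 : ∑ m ∈ Icc 1 M, ‖(f m : ℂ)‖ ^ 2 ≤ M := by
      refine (sum_le_sum (g := fun _ => (1 : ℝ)) fun m _ => ?_).trans (by simp)
      rw [Complex.norm_real, Real.norm_eq_abs]
      exact pow_le_one₀ (abs_nonneg _) (hf m)
    calc _ ≤ ∑ t ∈ range M, (‖E t‖ ^ 2 + ‖T t‖ ^ 2) / 2 := by
          refine sum_le_sum fun t _ => ?_
          nlinarith [sq_nonneg (‖E t‖ - ‖T t‖)]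
      _ = (M * N + M * ∑ m ∈ Icc 1 M, ‖(f m : ℂ)‖ ^ 2) / 2 := by
          rw [← sum_div, sum_add_distrib, ← h2, ← h3, ← h1]
      _ ≤ (M * N + M * M) / 2 := by gcongr
      _ = _ := by
          rw [hM]
          push_cast
          ring
  have hmain : M * ∑ n ∈ Icc 1 N, |∑ k ∈ Icc 1 N, f k * f (k + n)| ≤ M * (3 / 2 * B * N) := by
    calc _ ≤ ‖((M * ∑ n ∈ Icc 1 N, |∑ k ∈ Icc 1 N, f k * f (k + n)| : ℝ) : ℂ)‖ := by
          rw [Complex.norm_real]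
          exact le_abs_self _
      _ ≤ ∑ t ∈ range M, B * (‖E t‖ * ‖T t‖) := by
          rw [hkey]
          refine norm_sum_le_of_le _ fun t _ => ?_
          rw [norm_mul, norm_mul, RCLike.norm_conj, RCLike.norm_conj]
          have h1 : ‖S t‖ ≤ B := hB _
          calc ‖E t‖ * (‖S t‖ * ‖T t‖) ≤ ‖E t‖ * (B * ‖T t‖) := by gcongr
            _ = _ := by ring
      _ ≤ B * (M * (3 / 2 * N)) := by
          rw [← mul_sum]
          gcongr
      _ = _ := by ring
  exact le_of_mul_le_mul_left hmain hM'

theorem exists_average_selfCorrelation_le :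
    ∃ C : ℝ, 0 < C ∧ ∀ N : ℕ, 2 ≤ N →
      (1 / (N : ℝ)) * ∑ n ∈ Icc 1 N, |(1 / (N : ℝ)) * ∑ k ∈ Icc 1 N,
        ((ArithmeticFunction.moebius k * ArithmeticFunction.moebius (k + n) : ℤ) : ℝ)| ≤
      C / Real.log N ^ 2 := by
  obtain ⟨C, hC, h⟩ := exists_norm_sum_moebius_mul_additiveChar_le
  refine ⟨3 / 2 * C, by positivity, fun N hN => ?_⟩
  have hN' : (0 : ℝ) < N := by positivity
  have h1 := sum_abs_selfCorrelation_le (f := fun n => (ArithmeticFunction.moebius n : ℝ))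
    (fun n => by exact_mod_cast abs_moebius_le_one (n := n)) (by omega : 0 < N)
    (B := C * (N / Real.log N ^ 2)) (fun θ => by simpa using h N θ hN)
  push_cast
  simp_rw [abs_mul, ← mul_sum, abs_of_pos (one_div_pos.2 hN')]
  calc _ ≤ 1 / (N : ℝ) * (1 / N * (3 / 2 * (C * (N / Real.log N ^ 2)) * N)) := by gcongr
    _ = _ := by field_simp

theorem half_le_natFloor {x : ℝ} (hx : 1 ≤ x) : x / 2 ≤ ⌊x⌋₊ := by
  have h1 : (1 : ℝ) ≤ ⌊x⌋₊ := by exact_mod_cast Nat.floor_pos.2 hx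
  have h2 := Nat.lt_floor_add_one x
  linarith

/-- For every `ρ > 1`, the series
`∑_{m=1}^{∞} (1/⌊ρ^m⌋) ∑_{n=1}^{⌊ρ^m⌋} |(1/⌊ρ^m⌋) ∑_{k=1}^{⌊ρ^m⌋} μ(k) μ(k+n)|`
converges. -/
theorem moebius_selfcorrelation_geometric_summable (ρ : ℝ) (hρ : 1 < ρ) :
    Summable (fun m : ℕ =>
      (1 / (⌊ρ ^ (m + 1)⌋₊ : ℝ)) * ∑ n ∈ Finset.Icc 1 ⌊ρ ^ (m + 1)⌋₊,
        |(1 / (⌊ρ ^ (m + 1)⌋₊ : ℝ)) * ∑ k ∈ Finset.Icc 1 ⌊ρ ^ (m + 1)⌋₊,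
          ((ArithmeticFunction.moebius k * ArithmeticFunction.moebius (k + n) : ℤ) : ℝ)|) := by
  obtain ⟨C, hC, h⟩ := exists_average_selfCorrelation_le
  have hlogρ : 0 < Real.log ρ := Real.log_pos hρ
  have hsum : Summable fun m : ℕ => 4 * C / Real.log ρ ^ 2 * (1 / ((m + 1 : ℕ) : ℝ) ^ 2) :=
    ((summable_nat_add_iff 1).2 (Real.summable_one_div_nat_pow.2 one_lt_two)).mul_left _
  refine Summable.of_norm_bounded_eventually_nat hsum ?_
  obtain ⟨m₀, hm₀⟩ := exists_nat_gt (2 * Real.log 2 / Real.log ρ)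
  filter_upwards [Filter.eventually_ge_atTop m₀] with m hm
  rw [Real.norm_of_nonneg (by positivity)]
  set N := ⌊ρ ^ (m + 1)⌋₊ with hN
  have h1 : ρ ^ (m + 1) / 2 ≤ N := half_le_natFloor (one_le_pow₀ hρ.le)
  have hpow : 0 < ρ ^ (m + 1) := by positivity
  have h2 : (m + 1 : ℕ) * Real.log ρ / 2 ≤ Real.log N := by
    have h3 : 2 * Real.log 2 ≤ (m + 1 : ℕ) * Real.log ρ := by
      rw [div_lt_iff₀ hlogρ] at hm₀
      refine hm₀.le.trans ?_
      gcongr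
      omega
    have h4 := Real.log_le_log (by positivity) h1
    rw [Real.log_div hpow.ne' two_ne_zero, Real.log_pow] at h4
    linarith
  have h5 : 0 < (m + 1 : ℕ) * Real.log ρ / 2 := by positivity
  have hN2 : 2 ≤ N := by
    by_contra! h6
    have h7 : Real.log N ≤ 0 :=
      Real.log_nonpos (Nat.cast_nonneg _) (by exact_mod_cast Nat.lt_succ_iff.1 h6)
    linarith
  refine (h N hN2).trans ?_
  calc C / Real.log N ^ 2 ≤ C / ((m + 1 : ℕ) * Real.log ρ / 2) ^ 2 := by gcongr
    _ = _ := by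
      field_simp
      norm_num
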